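/- Let B = (F_{i_1},…,F_{i_k}) be a k-belt in a simple 3-polytope P. Then: (1) the union |B| of the facets of B is homeomorphic to a cylinder; (2) the boundary of |B| consists of two simple edge-cycles γ_1 and γ_2; (3) ∂P ∖ |B| consists of two connected components P_1 and P_2; (4) setting W_α = {facets F_j whose relative interior lies in P_α} for α = 1,2, the set of all facets of P is the disjoint union W_1 ⊔ W_2 ⊔ B; (5) the closure of P_α equals |W_α| and is homeomorphic to a disk for α = 1,2; (6) the boundary of P_α is γ_α for α = 1,2. -/

import Mathlib

open Set

noncomputable section

/-- The ambient space `ℝ³`. -/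
abbrev E3 := EuclideanSpace ℝ (Fin 3)

/-- The cyclic successor in `Fin k`. -/
def nxt {k : ℕ} (i : Fin k) : Fin k := ⟨(i.1 + 1) % k, Nat.mod_lt _ i.pos⟩

/-- The cyclic predecessor in `Fin k`. -/
def prv {k : ℕ} (i : Fin k) : Fin k := ⟨(i.1 + (k - 1)) % k, Nat.mod_lt _ i.pos⟩

/-- A convex polytope in `ℝ³`: the convex hull of a finite set of points. -/
def IsPolytope (P : Set E3) : Prop := ∃ V : Finset E3, P = convexHull ℝ (V : Set E3)

/-- The dimension of a subset of `ℝ³` (the dimension of its affine hull). -/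
def setDim (A : Set E3) : ℕ := Module.finrank ℝ ↥(vectorSpan ℝ A)

/-- A face of a polytope: a nonempty closed convex extreme subset. -/
def IsFaceOf (F P : Set E3) : Prop :=
  F.Nonempty ∧ IsClosed F ∧ Convex ℝ F ∧ IsExtreme ℝ P F

/-- A facet: a `2`-dimensional face. -/
def IsFacetOf (F P : Set E3) : Prop := IsFaceOf F P ∧ setDim F = 2

/-- An edge: a `1`-dimensional face. -/
def IsEdgeOf (F P : Set E3) : Prop := IsFaceOf F P ∧ setDim F = 1

/-- A vertex: a point whose singleton is a face. -/
def IsVertexOf (v : E3) (P : Set E3) : Prop := IsFaceOf {v} P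

/-- The set of facets of `P`. -/
def facets (P : Set E3) : Set (Set E3) := {F | IsFacetOf F P}

/-- A simple 3-polytope: a 3-dimensional convex polytope each of whose vertices
is contained in exactly 3 facets. -/
def IsSimplePolytope3 (P : Set E3) : Prop :=
  IsPolytope P ∧ setDim P = 3 ∧
    ∀ v : E3, IsVertexOf v P → {F | IsFacetOf F P ∧ v ∈ F}.ncard = 3

/-- The number of edges of a facet `F` of `P`. -/
def facetEdges (P F : Set E3) : ℕ := {e | IsEdgeOf e P ∧ e ⊆ F}.ncard

/-- `pVec P k` is the number of `k`-gonal facets of `P`. -/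
def pVec (P : Set E3) (k : ℕ) : ℕ := {F | IsFacetOf F P ∧ facetEdges P F = k}.ncard

/-- A (mathematical) fullerene: a simple 3-polytope with all facets pentagons
and hexagons. -/
def IsFullerene (P : Set E3) : Prop :=
  IsSimplePolytope3 P ∧ ∀ F, IsFacetOf F P → facetEdges P F = 5 ∨ facetEdges P F = 6

/-- A `k`-loop in `P` (`k ≥ 2`): a cyclic sequence of facets in which
(cyclically) consecutive facets intersect in an edge; a `1`-loop is a single facet. -/
def IsLoop (P : Set E3) {k : ℕ} (L : Fin k → Set E3) : Prop :=
  0 < k ∧ (∀ i, IsFacetOf (L i) P) ∧ (2 ≤ k → ∀ i, IsEdgeOf (L i ∩ L (nxt i)) P)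

/-- A simple loop: a loop with pairwise different facets. -/
def IsSimpleLoop (P : Set E3) {k : ℕ} (L : Fin k → Set E3) : Prop :=
  IsLoop P L ∧ Function.Injective L

/-- A `k`-belt (`k ≥ 3`): a `k`-loop such that for `k = 3` the three facets have empty
total intersection, and for `k ≥ 4` two facets intersect iff they are cyclically successive. -/
def IsBelt (P : Set E3) {k : ℕ} (L : Fin k → Set E3) : Prop :=
  3 ≤ k ∧ IsLoop P L ∧
    (k = 3 → ∀ i, L i ∩ L (nxt i) ∩ L (nxt (nxt i)) = ∅) ∧
    (4 ≤ k → ∀ p q, p ≠ q → ((L p ∩ L q).Nonempty ↔ q = nxt p ∨ p = nxt q))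

/-- A flag 3-polytope: a simple 3-polytope different from the tetrahedron
(i.e. not having exactly 4 facets) without 3-belts. -/
def IsFlag3Polytope (P : Set E3) : Prop :=
  IsSimplePolytope3 P ∧ (facets P).ncard ≠ 4 ∧ ∀ B : Fin 3 → Set E3, ¬ IsBelt P B

/-- `γ` is the simple edge-cycle of `P` traced by the cyclically ordered distinct
vertices `v 0, …, v (n-1)` (`n ≥ 3`), consecutive ones joined by edges of `P`. -/
def IsSimpleEdgeCycleVia (P γ : Set E3) {n : ℕ} (v : Fin n → E3) : Prop :=
  3 ≤ n ∧ Function.Injective v ∧ (∀ i, IsVertexOf (v i) P) ∧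
    (∀ i, IsEdgeOf (segment ℝ (v i) (v (nxt i))) P) ∧
    γ = ⋃ i, segment ℝ (v i) (v (nxt i))

/-- A simple edge-cycle in the graph of `P`. -/
def IsSimpleEdgeCycle (P γ : Set E3) : Prop :=
  ∃ (n : ℕ) (v : Fin n → E3), IsSimpleEdgeCycleVia P γ v

/-- `C` is a connected component of the set `A`. -/
def IsCompOf (C A : Set E3) : Prop := ∃ x ∈ A, C = connectedComponentIn A x

/-- The loop `L` is obtained by walking round the simple edge-cycle `γ` inside the
connected component `C` of `∂P ∖ γ`: the facets of `L` lie on the side `C`, and the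
edges of `γ`, in cyclic order, lie in the facets of `L` in cyclic order (the loop
index advancing exactly when the facet changes, and making exactly one turn). -/
def WalksRound (P γ C : Set E3) {k : ℕ} (L : Fin k → Set E3) : Prop :=
  IsLoop P L ∧ (∀ i, intrinsicInterior ℝ (L i) ⊆ C) ∧
    ∃ (n : ℕ) (v : Fin n → E3) (φ : Fin n → Fin k),
      IsSimpleEdgeCycleVia P γ v ∧
      (∀ i, segment ℝ (v i) (v (nxt i)) ⊆ L (φ i)) ∧
      (∀ i, φ (nxt i) = φ i ∨ φ (nxt i) = nxt (φ i)) ∧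
      Function.Surjective φ ∧
      (2 ≤ k → (Finset.univ.filter (fun i : Fin n => φ (nxt i) ≠ φ i)).card = k)

/-- Two loops border each other: they are obtained by walking round the same simple
edge-cycle `γ` in the two different connected components of `∂P ∖ γ`. -/
def Borders (P : Set E3) {k₁ k₂ : ℕ} (L₁ : Fin k₁ → Set E3) (L₂ : Fin k₂ → Set E3) : Prop :=
  ∃ γ C₁ C₂ : Set E3, IsCompOf C₁ (frontier P \ γ) ∧ IsCompOf C₂ (frontier P \ γ) ∧
    C₁ ≠ C₂ ∧ WalksRound P γ C₁ L₁ ∧ WalksRound P γ C₂ L₂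

/-- A loop surrounds the facet `F` if it borders the `1`-loop `(F)`. -/
def Surrounds (P : Set E3) {k : ℕ} (L : Fin k → Set E3) (F : Set E3) : Prop :=
  IsFacetOf F P ∧ Borders P L (fun _ : Fin 1 => F)

/-- The number of edges of `P` lying in the facet `F` and in the set `γ`. -/
def edgesInCommon (P F γ : Set E3) : ℕ := {e | IsEdgeOf e P ∧ e ⊆ F ∧ e ⊆ γ}.ncard
/-- A simple 3-polytope all of whose facets are pentagons and hexagons except for
at most one exceptional facet, which is a quadrangle or a heptagon. -/
def IsAlmostFullerene (P : Set E3) : Prop :=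
  IsSimplePolytope3 P ∧
    (∀ F, IsFacetOf F P → facetEdges P F ∈ ({4, 5, 6, 7} : Set ℕ)) ∧
    {F | IsFacetOf F P ∧ (facetEdges P F = 4 ∨ facetEdges P F = 7)}.ncard ≤ 1

/-- The (combinatorial) dodecahedron: a simple 3-polytope with all facets pentagons. -/
def IsDodecahedron (P : Set E3) : Prop :=
  IsSimplePolytope3 P ∧ ∀ F, IsFacetOf F P → facetEdges P F = 5

/-- `e` and `e'` are opposite edges of the hexagonal facet `H`: they are disjoint and no
edge of `H` meets both of them. -/
def OppositeEdges (P H e e' : Set E3) : Prop :=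
  IsEdgeOf e P ∧ IsEdgeOf e' P ∧ e ⊆ H ∧ e' ⊆ H ∧ e ∩ e' = ∅ ∧
    ∀ e'', IsEdgeOf e'' P → e'' ⊆ H → (e'' ∩ e).Nonempty → e'' ≠ e → e'' ∩ e' = ∅

/-- A cap: a pentagonal facet `F₀` together with a surrounding 5-belt of pentagons. -/
def IsCapOf (P F₀ : Set E3) (L : Fin 5 → Set E3) : Prop :=
  IsFacetOf F₀ P ∧ facetEdges P F₀ = 5 ∧ (∀ i, facetEdges P (L i) = 5) ∧
    IsBelt P L ∧ Surrounds P L F₀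

/-- The number of 5-belts of `P` (counted as sets of facets). -/
def fiveBeltCount (P : Set E3) : ℕ :=
  {S : Set (Set E3) | ∃ B : Fin 5 → Set E3, IsBelt P B ∧ S = Set.range B}.ncard

/-- The structure of the `k`-th fullerene of Family I: two caps separated by `k`
hexagonal 5-belts, each bordering the next (for `k = 0` the caps border each other,
giving the dodecahedron). -/
def FamilyI (P : Set E3) (k : ℕ) : Prop :=
  ∃ (F₀ F₀' : Set E3) (L L' : Fin 5 → Set E3) (B : ℕ → Fin 5 → Set E3),
    IsCapOf P F₀ L ∧ IsCapOf P F₀' L' ∧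
    (∀ i < k, IsBelt P (B i) ∧ ∀ j, facetEdges P (B i j) = 6) ∧
    (∀ i, i + 1 < k → Borders P (B i) (B (i + 1))) ∧
    (0 < k → Borders P L (B 0) ∧ Borders P (B (k - 1)) L') ∧
    (k = 0 → Borders P L L') ∧
    facets P = {F₀, F₀'} ∪ Set.range L ∪ Set.range L' ∪ ⋃ i ∈ Set.Iio k, Set.range (B i)

/-- `P` is obtained from `Q` by an `(s,k;t₀,t₁)`-truncation with new edge `Enew`:
`P` is cut off from `Q` by a halfspace `{f ≤ c}` whose boundary plane crosses exactly
two edges `E₀ ≠ E₁` of a `k`-gonal facet `F` of `Q`, cutting off exactly `s` vertices,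
all belonging to `F`; `G₀` and `G₁` are the facets meeting `F` along `E₀` and `E₁`, and
they are `t₀`- and `t₁`-gons; `Enew` is the new edge dividing `F`. -/
def IsTruncation (s k t₀ t₁ : ℕ) (Q P Enew : Set E3) : Prop :=
  IsSimplePolytope3 Q ∧ IsSimplePolytope3 P ∧
    ∃ (F E₀ E₁ G₀ G₁ : Set E3) (f : E3 →ₗ[ℝ] ℝ) (c : ℝ),
      IsFacetOf F Q ∧ facetEdges Q F = k ∧
      IsEdgeOf E₀ Q ∧ IsEdgeOf E₁ Q ∧ E₀ ≠ E₁ ∧ E₀ ⊆ F ∧ E₁ ⊆ F ∧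
      IsFacetOf G₀ Q ∧ IsFacetOf G₁ Q ∧ G₀ ≠ F ∧ G₁ ≠ F ∧ E₀ ⊆ G₀ ∧ E₁ ⊆ G₁ ∧
      facetEdges Q G₀ = t₀ ∧ facetEdges Q G₁ = t₁ ∧
      P = Q ∩ {x | f x ≤ c} ∧
      (∀ e, IsEdgeOf e Q → (∃ x ∈ e, c < f x) → (∃ x ∈ e, f x < c) → e = E₀ ∨ e = E₁) ∧
      (∃ x ∈ E₀, c < f x) ∧ (∃ x ∈ E₀, f x < c) ∧
      (∃ x ∈ E₁, c < f x) ∧ (∃ x ∈ E₁, f x < c) ∧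
      (∀ v, IsVertexOf v Q → f v ≠ c) ∧
      {v | IsVertexOf v Q ∧ c < f v}.ncard = s ∧
      (∀ v, IsVertexOf v Q → c < f v → v ∈ F) ∧
      Enew = F ∩ {x | f x = c}

/-- Combinatorial equivalence of polytopes: an inclusion-preserving bijection
between the sets of faces. -/
def CombEquiv (P Q : Set E3) : Prop :=
  ∃ φ : {A : Set E3 // IsFaceOf A P} ≃ {A : Set E3 // IsFaceOf A Q},
    ∀ A B : {A : Set E3 // IsFaceOf A P}, A.1 ⊆ B.1 ↔ (φ A).1 ⊆ (φ B).1

/-- Combinatorial equivalence sending the face `Ep` of `P` to the face `Eq` of `Q`. -/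
def CombEquivMapping (P Q Ep Eq : Set E3) : Prop :=
  ∃ φ : {A : Set E3 // IsFaceOf A P} ≃ {A : Set E3 // IsFaceOf A Q},
    (∀ A B : {A : Set E3 // IsFaceOf A P}, A.1 ⊆ B.1 ↔ (φ A).1 ⊆ (φ B).1) ∧
    ∀ h : IsFaceOf Ep P, ((φ ⟨Ep, h⟩) : {A : Set E3 // IsFaceOf A Q}).1 = Eq

/-- The straightening of `P` along the edge `E` is defined: `P` is combinatorially
obtained from some simple 3-polytope `Q` by an `(s,k)`-truncation whose new edge
corresponds to `E`. -/
def StraighteningDefined (P E : Set E3) : Prop :=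
  ∃ (s k t₀ t₁ : ℕ) (Q P₁ E₁ : Set E3),
    IsTruncation s k t₀ t₁ Q P₁ E₁ ∧ CombEquivMapping P P₁ E E₁

/-- `P` is obtained from `Q` by one of the truncations
`(1;4,5)`, `(1;5,5)`, `(2,6;4,5)`, `(2,6;5,5)`, `(2,6;5,6)`, `(2,7;5,5)`, `(2,7;5,6)`. -/
def FullereneStep (Q P : Set E3) : Prop :=
  ∃ (s k t₀ t₁ : ℕ) (Enew : Set E3), IsTruncation s k t₀ t₁ Q P Enew ∧
    ((s = 1 ∧ (({t₀, t₁} : Finset ℕ) = {4, 5} ∨ ({t₀, t₁} : Finset ℕ) = {5, 5})) ∨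
     (s = 2 ∧ k = 6 ∧ (({t₀, t₁} : Finset ℕ) = {4, 5} ∨ ({t₀, t₁} : Finset ℕ) = {5, 5} ∨
        ({t₀, t₁} : Finset ℕ) = {5, 6})) ∨
     (s = 2 ∧ k = 7 ∧ (({t₀, t₁} : Finset ℕ) = {5, 5} ∨ ({t₀, t₁} : Finset ℕ) = {5, 6})))


/-! ## Topology: homeomorphisms between compact sets -/

section Topo

variable {X Y Z : Type*} [TopologicalSpace X] [TopologicalSpace Y] [TopologicalSpace Z]

/-- `f` restricts to a continuous bijection from `A` to `B`. -/
def HomeoOn (f : X → Y) (A : Set X) (B : Set Y) : Prop := ContinuousOn f A ∧ BijOn f A B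

lemma HomeoOn.image_eq {f : X → Y} {A : Set X} {B : Set Y} (h : HomeoOn f A B) : f '' A = B :=
  h.2.image_eq

lemma HomeoOn.compact {f : X → Y} {A : Set X} {B : Set Y} (h : HomeoOn f A B)
    (hA : IsCompact A) : IsCompact B := by
  rw [← h.image_eq]; exact hA.image_of_continuousOn h.1

lemma HomeoOn.comp {f : X → Y} {g : Y → Z} {A : Set X} {B : Set Y} {C : Set Z}
    (hg : HomeoOn g B C) (hf : HomeoOn f A B) : HomeoOn (g ∘ f) A C :=
  ⟨hg.1.comp hf.1 hf.2.mapsTo, hg.2.comp hf.2⟩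

lemma HomeoOn.restrict {f : X → Y} {A A' : Set X} {B : Set Y} (h : HomeoOn f A B)
    (hA : A' ⊆ A) : HomeoOn f A' (f '' A') :=
  ⟨h.1.mono hA, (h.2.injOn.mono hA).bijOn_image⟩

lemma HomeoOn.congr {f g : X → Y} {A : Set X} {B : Set Y} (h : HomeoOn f A B)
    (hfg : EqOn g f A) : HomeoOn g A B :=
  ⟨h.1.congr hfg, h.2.congr hfg.symm⟩

lemma HomeoOn.symm [T2Space Y] {f : X → Y} {A : Set X} {B : Set Y} (h : HomeoOn f A B)
    (hA : IsCompact A) (hne : A.Nonempty) :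
    ∃ g : Y → X, HomeoOn g B A ∧ (∀ x ∈ A, g (f x) = x) ∧ (∀ y ∈ B, f (g y) = y) := by
  obtain ⟨x0, hx0⟩ := hne
  have : Nonempty X := ⟨x0⟩
  have hinv : InvOn (Function.invFunOn f A) f A B := h.2.invOn_invFunOn
  refine ⟨Function.invFunOn f A, ⟨?_, ?_⟩, hinv.1, hinv.2⟩
  · rw [continuousOn_iff_isClosed]
    intro s hs
    refine ⟨f '' (A ∩ s), ((hA.inter_right hs).image_of_continuousOn
      (h.1.mono inter_subset_left)).isClosed, ?_⟩
    ext y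
    constructor
    · rintro ⟨h1, h2⟩
      exact ⟨⟨_, ⟨h.2.surjOn.mapsTo_invFunOn h2, h1⟩, hinv.2 h2⟩, h2⟩
    · rintro ⟨⟨x, ⟨hxA, hxs⟩, rfl⟩, h2⟩
      refine ⟨?_, h2⟩
      show _ ∈ s
      rw [hinv.1 hxA]; exact hxs
  · exact h.2.symm hinv.symm

lemma HomeoOn.homeomorph [T2Space Y] {f : X → Y} {A : Set X} {B : Set Y} (h : HomeoOn f A B)
    (hA : IsCompact A) : Nonempty (↥A ≃ₜ ↥B) := by
  have : CompactSpace A := isCompact_iff_compactSpace.1 hA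
  exact ⟨Continuous.homeoOfEquivCompactToT2 (f := h.2.equiv)
    (by
      refine Continuous.subtype_mk ?_ _
      exact continuousOn_iff_continuous_domRestrict.1 h.1)⟩

/-- Pasting finitely many homeomorphisms between closed sets. -/
lemma paste_homeo {ι : Type*} [Finite ι] [Nonempty Y] (A : ι → Set X) (B : ι → Set Y)
    (f : ι → X → Y)
    (hA : ∀ i, IsClosed (A i)) (hf : ∀ i, HomeoOn (f i) (A i) (B i))
    (hag : ∀ i j, ∀ x ∈ A i ∩ A j, f i x = f j x)
    (hB : ∀ i j, B i ∩ B j ⊆ f i '' (A i ∩ A j)) :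
    ∃ g : X → Y, HomeoOn g (⋃ i, A i) (⋃ i, B i) ∧ ∀ i, EqOn g (f i) (A i) := by
  classical
  let g : X → Y := fun x => if h : ∃ i, x ∈ A i then f h.choose x else Classical.arbitrary Y
  have hg : ∀ i, EqOn g (f i) (A i) := by
    intro i x hx
    have h : ∃ i, x ∈ A i := ⟨i, hx⟩
    simp only [g, dif_pos h]
    exact hag _ _ x ⟨h.choose_spec, hx⟩
  refine ⟨g, ⟨?_, ?_, ?_, ?_⟩, hg⟩
  · exact (locallyFinite_of_finite A).continuousOn_iUnion hA (fun i => (hf i).1.congr (hg i))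
  · intro x hx
    obtain ⟨i, hi⟩ := mem_iUnion.1 hx
    rw [hg i hi]
    exact mem_iUnion.2 ⟨i, (hf i).2.mapsTo hi⟩
  · intro x hx y hy hxy
    obtain ⟨i, hi⟩ := mem_iUnion.1 hx
    obtain ⟨j, hj⟩ := mem_iUnion.1 hy
    rw [hg i hi, hg j hj] at hxy
    obtain ⟨z, hz, hzx⟩ := hB i j ⟨(hf i).2.mapsTo hi, hxy ▸ (hf j).2.mapsTo hj⟩
    have h1 : z = x := (hf i).2.injOn hz.1 hi hzx
    subst h1
    rw [hag i j z hz] at hxy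
    exact (hf j).2.injOn hz.2 hj hxy
  · intro y hy
    obtain ⟨i, hi⟩ := mem_iUnion.1 hy
    obtain ⟨x, hx, rfl⟩ := (hf i).2.surjOn hi
    exact ⟨x, mem_iUnion.2 ⟨i, hx⟩, hg i hx⟩

/-- Two-piece version of pasting. -/
lemma paste_two [Nonempty Y] {A A' : Set X} {B B' : Set Y} {f f' : X → Y}
    (hA : IsClosed A) (hA' : IsClosed A') (hf : HomeoOn f A B) (hf' : HomeoOn f' A' B')
    (hag : ∀ x ∈ A ∩ A', f x = f' x) (hB : B ∩ B' ⊆ f '' (A ∩ A')) :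
    ∃ g : X → Y, HomeoOn g (A ∪ A') (B ∪ B') ∧ EqOn g f A ∧ EqOn g f' A' := by
  have key := paste_homeo (ι := Bool) (fun b => cond b A A') (fun b => cond b B B')
    (fun b => cond b f f') (by rintro (_ | _) <;> assumption) (by rintro (_ | _) <;> assumption)
    (by
      rintro (_ | _) (_ | _) x hx
      · rfl
      · exact (hag x ⟨hx.2, hx.1⟩).symm
      · exact hag x hx
      · rfl)
    (by
      rintro (_ | _) (_ | _)
      · intro y hy
        simp only [cond_false, inter_self] at hy ⊢
        rw [hf'.image_eq]; exact hy
      · intro y hy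
        obtain ⟨x, hx, rfl⟩ := hB ⟨hy.2, hy.1⟩
        exact ⟨x, ⟨hx.2, hx.1⟩, (hag x hx).symm⟩
      · exact hB
      · intro y hy
        simp only [cond_true, inter_self] at hy ⊢
        rw [hf.image_eq]; exact hy)
  obtain ⟨g, h1, h2⟩ := key
  refine ⟨g, ?_, h2 true, h2 false⟩
  rw [union_eq_iUnion, union_eq_iUnion]
  exact h1

/-- `A` is a closed disc with boundary circle `C`. -/
def IsDisc (A C : Set X) : Prop :=
  IsCompact A ∧ C ⊆ A ∧ ∃ f : X → ℂ, HomeoOn f A (Metric.closedBall 0 1) ∧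
    f '' C = Metric.sphere 0 1

/-- `C` is a topological circle. -/
def IsCirc (C : Set X) : Prop :=
  IsCompact C ∧ ∃ f : X → ℂ, HomeoOn f C (Metric.sphere 0 1)

/-- `J` is an arc from `p` to `q`. -/
def IsArc (J : Set X) (p q : X) : Prop :=
  IsCompact J ∧ p ∈ J ∧ q ∈ J ∧ ∃ σ : X → ℝ, HomeoOn σ J (Icc 0 1) ∧ σ p = 0 ∧ σ q = 1

lemma IsDisc.mem_iff {A C : Set X} {f : X → ℂ} (hCA : C ⊆ A)
    (hf : HomeoOn f A (Metric.closedBall 0 1))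
    (hC : f '' C = Metric.sphere 0 1) {x : X} (hx : x ∈ A) : x ∈ C ↔ ‖f x‖ = 1 := by
  constructor
  · intro h
    have : f x ∈ Metric.sphere (0:ℂ) 1 := hC ▸ mem_image_of_mem f h
    simpa using this
  · intro h
    have : f x ∈ f '' C := by rw [hC]; simpa using h
    obtain ⟨y, hy, hyx⟩ := this
    rwa [← hf.2.injOn (hCA hy) hx hyx]

lemma IsDisc.isClosed_bd [T2Space X] {A C : Set X} (h : IsDisc A C) : IsCompact C := by
  obtain ⟨hA, hCA, f, hf, hC⟩ := h
  have h1 : C = A ∩ f ⁻¹' (Metric.sphere 0 1) := by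
    ext x
    constructor
    · intro hx
      exact ⟨hCA hx, hC ▸ mem_image_of_mem f hx⟩
    · rintro ⟨h1, h2⟩
      exact (IsDisc.mem_iff hCA hf hC h1).2 (by simpa using h2)
  rw [h1]
  exact hA.of_isClosed_subset (hf.1.preimage_isClosed_of_isClosed hA.isClosed
    Metric.isClosed_sphere) inter_subset_left

lemma IsDisc.isCirc [T2Space X] {A C : Set X} (h : IsDisc A C) : IsCirc C := by
  refine ⟨h.isClosed_bd, ?_⟩
  obtain ⟨hA, hCA, f, hf, hC⟩ := h
  exact ⟨f, hC ▸ hf.restrict hCA⟩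

lemma IsDisc.nonempty {A C : Set X} (h : IsDisc A C) : A.Nonempty := by
  obtain ⟨hA, hCA, f, hf, hC⟩ := h
  obtain ⟨x, hx, -⟩ := hf.2.surjOn (show (0:ℂ) ∈ Metric.closedBall 0 1 by simp)
  exact ⟨x, hx⟩

lemma IsCirc.nonempty {C : Set X} (h : IsCirc C) : C.Nonempty := by
  obtain ⟨hA, f, hf⟩ := h
  obtain ⟨x, hx, -⟩ := hf.2.surjOn (show (1:ℂ) ∈ Metric.sphere 0 1 by simp)
  exact ⟨x, hx⟩

lemma IsCirc.symm {C : Set X} (h : IsCirc C) :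
    ∃ g : ℂ → X, HomeoOn g (Metric.sphere 0 1) C := by
  obtain ⟨hA, f, hf⟩ := id h
  obtain ⟨g, hg, -, -⟩ := hf.symm hA h.nonempty
  exact ⟨g, hg⟩

lemma IsCirc.isConnected {C : Set X} (h : IsCirc C) : IsConnected C := by
  obtain ⟨g, hg⟩ := h.symm
  rw [← hg.image_eq]
  exact (isConnected_sphere (by simp) 0 zero_le_one).image g hg.1

lemma IsArc.symm {J : Set X} {p q : X} (h : IsArc J p q) : IsArc J q p := by
  obtain ⟨hJ, hp, hq, σ, ⟨hc, hb⟩, h0, h1⟩ := h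
  refine ⟨hJ, hq, hp, fun x => 1 - σ x, ⟨continuousOn_const.sub hc, ?_, ?_, ?_⟩,
    by simp [h1], by simp [h0]⟩
  · intro x hx
    have := hb.mapsTo hx
    simp only [mem_Icc] at this ⊢
    constructor <;> linarith
  · intro x hx y hy hxy
    exact hb.injOn hx hy (by simpa using hxy)
  · intro t ht
    obtain ⟨x, hx, hxt⟩ := hb.surjOn (show 1 - t ∈ Icc (0:ℝ) 1 by
      simp only [mem_Icc] at ht ⊢; constructor <;> linarith)
    exact ⟨x, hx, by simp [hxt]⟩

lemma IsArc.isConnected {J : Set X} {p q : X} (h : IsArc J p q) : IsConnected J := by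
  obtain ⟨hJ, hp, hq, σ, hσ, h0, h1⟩ := h
  obtain ⟨g, hg, -, -⟩ := hσ.symm hJ ⟨p, hp⟩
  rw [← hg.image_eq]
  exact (isConnected_Icc zero_le_one).image g hg.1

lemma IsArc.ne {J : Set X} {p q : X} (h : IsArc J p q) : p ≠ q := by
  obtain ⟨hJ, hp, hq, σ, hσ, h0, h1⟩ := h
  rintro rfl
  rw [h0] at h1
  exact zero_ne_one h1

/-- The cone extension of a self-map of the circle. -/
def coneMap (θ : ℂ → ℂ) (z : ℂ) : ℂ := (‖z‖ : ℂ) * θ (z / ‖z‖)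

lemma div_norm_mem {z : ℂ} (hz : z ≠ 0) : z / (‖z‖ : ℂ) ∈ Metric.sphere (0:ℂ) 1 := by
  simp [hz]

lemma coneMap_homeo {θ : ℂ → ℂ} (hθ : HomeoOn θ (Metric.sphere 0 1) (Metric.sphere 0 1)) :
    HomeoOn (coneMap θ) (Metric.closedBall 0 1) (Metric.closedBall 0 1) := by
  have hn : ∀ z : ℂ, ‖coneMap θ z‖ = ‖z‖ := by
    intro z
    by_cases hz : z = 0
    · simp [coneMap, hz]
    · have : ‖θ (z / ‖z‖)‖ = 1 := by simpa using hθ.2.mapsTo (div_norm_mem hz)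
      simp [coneMap, this]
  refine ⟨?_, ?_, ?_, ?_⟩
  · intro z hz
    by_cases h0 : z = 0
    · subst h0
      apply ContinuousAt.continuousWithinAt
      rw [ContinuousAt, show coneMap θ 0 = 0 by simp [coneMap]]
      rw [tendsto_zero_iff_norm_tendsto_zero]
      simp_rw [hn]
      exact tendsto_norm_zero
    · apply ContinuousAt.continuousWithinAt
      have h1 : ContinuousOn (coneMap θ) {0}ᶜ := by
        have hd : ContinuousOn (fun z : ℂ => z / (‖z‖:ℂ)) {0}ᶜ := by
          refine continuousOn_id.div (Complex.continuous_ofReal.comp continuous_norm).continuousOn ?_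
          intro x hx
          simpa using hx
        exact (Complex.continuous_ofReal.comp continuous_norm).continuousOn.mul
          (hθ.1.comp hd (fun x hx => div_norm_mem hx))
      exact h1.continuousAt (isOpen_compl_singleton.mem_nhds h0)
  · intro z hz
    simp only [Metric.mem_closedBall, dist_zero_right] at hz ⊢
    rwa [hn]
  · intro z hz w hw hzw
    have h1 : ‖z‖ = ‖w‖ := by rw [← hn z, ← hn w, hzw]
    by_cases h0 : z = 0
    · subst h0
      simp only [norm_zero] at h1
      exact (norm_eq_zero.1 h1.symm).symm
    · have hw0 : w ≠ 0 := by
        rintro rfl; exact h0 (norm_eq_zero.1 (by simpa using h1))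
      have hz' : (‖w‖ : ℂ) ≠ 0 := by simpa using hw0
      simp only [coneMap, h1] at hzw
      have h2 := mul_left_cancel₀ hz' hzw
      have h3 := hθ.2.injOn (h1 ▸ div_norm_mem h0) (div_norm_mem hw0) h2
      field_simp at h3
      exact h3
  · intro w hw
    by_cases h0 : w = 0
    · exact ⟨0, by simp, by simp [coneMap, h0]⟩
    · obtain ⟨z, hz, hzw⟩ := hθ.2.surjOn (div_norm_mem h0)
      have hz1 : ‖z‖ = 1 := by simpa using hz
      have hw' : (‖w‖ : ℂ) ≠ 0 := by simpa using h0
      refine ⟨‖w‖ * z, ?_, ?_⟩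
      · simpa [hz1] using hw
      · have : ‖(‖w‖ : ℂ) * z‖ = ‖w‖ := by simp [hz1]
        rw [coneMap, this, mul_div_cancel_left₀ _ hw', hzw]
        field_simp

lemma coneMap_sphere (θ : ℂ → ℂ) {z : ℂ} (hz : ‖z‖ = 1) : coneMap θ z = θ z := by
  simp [coneMap, hz]

/-- A disc can be parametrised extending any parametrisation of its boundary. -/
lemma IsDisc.extend [T2Space X] {A C : Set X} (h : IsDisc A C) {φ : X → ℂ}
    (hφ : HomeoOn φ C (Metric.sphere 0 1)) :
    ∃ f : X → ℂ, HomeoOn f A (Metric.closedBall 0 1) ∧ EqOn f φ C := by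
  have hC := h.isClosed_bd
  have hne := h.isCirc.nonempty
  obtain ⟨hA, hCA, f, hf, hfC⟩ := h
  have hfc : HomeoOn f C (Metric.sphere 0 1) := hfC ▸ hf.restrict hCA
  obtain ⟨g, hg, hgf, -⟩ := hfc.symm hC hne
  have hθ : HomeoOn (φ ∘ g) (Metric.sphere (0:ℂ) 1) (Metric.sphere 0 1) := hφ.comp hg
  refine ⟨coneMap (φ ∘ g) ∘ f, (coneMap_homeo hθ).comp hf, ?_⟩
  intro x hx
  have h1 : ‖f x‖ = 1 := (IsDisc.mem_iff hCA hf hfC (hCA hx)).1 hx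
  simp only [Function.comp_apply]
  rw [coneMap_sphere _ h1, Function.comp_apply, hgf x hx]

lemma IsDisc.extend_between [T2Space X] [T2Space Y] {A C : Set X} {A' C' : Set Y}
    (h : IsDisc A C) (h' : IsDisc A' C') {φ : X → Y} (hφ : HomeoOn φ C C') :
    ∃ f : X → Y, HomeoOn f A A' ∧ EqOn f φ C := by
  have hne := h'.nonempty
  obtain ⟨hA', hCA', f', hf', hfC'⟩ := h'
  have hfc : HomeoOn f' C' (Metric.sphere 0 1) := hfC' ▸ hf'.restrict hCA'
  obtain ⟨f, hf, hfφ⟩ := h.extend (hfc.comp hφ)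
  obtain ⟨g, hg, hgf, -⟩ := hf'.symm hA' hne
  refine ⟨g ∘ f, hg.comp hf, ?_⟩
  intro x hx
  simp only [Function.comp_apply]
  rw [hfφ hx, Function.comp_apply]
  exact hgf _ (hCA' (hφ.2.mapsTo hx))

lemma IsDisc.image [T2Space Y] {A C : Set X} (h : IsDisc A C) {ι : X → Y} {B : Set Y}
    (hι : HomeoOn ι A B) : IsDisc B (ι '' C) := by
  have hne := h.nonempty
  obtain ⟨hA, hCA, f, hf, hfC⟩ := h
  obtain ⟨g, hg, hgf, -⟩ := hι.symm hA hne
  refine ⟨hι.compact hA, ?_, f ∘ g, hf.comp hg, ?_⟩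
  · rw [← hι.image_eq]; exact image_mono hCA
  · rw [← hfC]
    ext z
    constructor
    · rintro ⟨_, ⟨y, hy, rfl⟩, rfl⟩
      exact ⟨y, hy, by simp only [Function.comp_apply]; rw [hgf _ (hCA hy)]⟩
    · rintro ⟨y, hy, rfl⟩
      exact ⟨ι y, ⟨y, hy, rfl⟩, by simp only [Function.comp_apply]; rw [hgf _ (hCA hy)]⟩

lemma isDisc_convex {K : Set ℂ} (hK : IsCompact K) (hc : Convex ℝ K) (hi : (interior K).Nonempty) :
    IsDisc K (frontier K) := by
  obtain ⟨h, h1, h2, h3⟩ := exists_homeomorph_image_interior_closure_frontier_eq_unitBall hc hi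
    hK.isBounded
  rw [hK.isClosed.closure_eq] at h2
  exact ⟨hK, hK.isClosed.frontier_subset, h,
    ⟨h.continuous.continuousOn, h2 ▸ h.injective.injOn.bijOn_image⟩, h3⟩

end Topo

section topology2
variable {X Y : Type*} [TopologicalSpace X] [TopologicalSpace Y]

lemma IsArc.of_param [T2Space X] {h : ℝ → X} {a b : ℝ} (hab : a < b) {J : Set X}
    (hh : HomeoOn h (Icc a b) J) : IsArc J (h a) (h b) := by
  obtain ⟨g, hg, hgh, -⟩ := hh.symm isCompact_Icc ⟨a, left_mem_Icc.2 hab.le⟩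
  have hba : 0 < b - a := sub_pos.2 hab
  have key : HomeoOn (fun t : ℝ => (t - a) / (b - a)) (Icc a b) (Icc 0 1) := by
    refine ⟨by fun_prop, ?_, ?_, ?_⟩
    · rintro t ⟨h1, h2⟩
      exact ⟨div_nonneg (by linarith) hba.le, (div_le_one hba).2 (by linarith)⟩
    · intro s _ t _ hst
      simp only at hst
      rw [div_left_inj' hba.ne'] at hst
      linarith
    · rintro t ⟨h1, h2⟩
      refine ⟨a + t * (b - a), ⟨by nlinarith, by nlinarith⟩, ?_⟩
      field_simp
      ring
  refine ⟨hh.compact isCompact_Icc, hh.2.mapsTo (left_mem_Icc.2 hab.le),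
    hh.2.mapsTo (right_mem_Icc.2 hab.le), _, key.comp hg, ?_, ?_⟩
  · simp [hgh a (left_mem_Icc.2 hab.le)]
  · simp [hgh b (right_mem_Icc.2 hab.le), hba.ne']

lemma IsCirc.param {C : Set X} (hC : IsCirc C) {z : X} (hz : z ∈ C) :
    ∃ h : ℝ → X, Continuous h ∧ h 0 = z ∧ range h = C ∧
      ∀ s t, h s = h t ↔ ∃ n : ℤ, s = t + n := by
  obtain ⟨hc, f, hf⟩ := hC
  obtain ⟨g, hg, hgf, hfg⟩ := hf.symm hc ⟨z, hz⟩
  have hfz : ‖f z‖ = 1 := by simpa using hf.2.mapsTo hz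
  have hfz0 : f z ≠ 0 := by
    intro h0; rw [h0] at hfz; simp at hfz
  set e : ℝ → ℂ := fun t => f z * Complex.exp ((2 * Real.pi * t : ℝ) * Complex.I) with he
  have hes : ∀ t, e t ∈ Metric.sphere (0:ℂ) 1 := by
    intro t
    rw [mem_sphere_zero_iff_norm, he]
    simp only [norm_mul, hfz, Complex.norm_exp_ofReal_mul_I, mul_one]
  have hec : Continuous e := by rw [he]; fun_prop
  refine ⟨fun t => g (e t), hg.1.comp_continuous hec hes, ?_, ?_, ?_⟩
  · simp [he, hgf z hz]
  · apply Subset.antisymm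
    · rintro _ ⟨t, rfl⟩
      exact hg.2.mapsTo (hes t)
    · intro x hx
      have hfx : ‖f x‖ = 1 := by simpa using hf.2.mapsTo hx
      have hn : ‖f x / f z‖ = 1 := by simp [hfx, hfz]
      refine ⟨Complex.arg (f x / f z) / (2 * Real.pi), ?_⟩
      have : e (Complex.arg (f x / f z) / (2 * Real.pi)) = f x := by
        simp only [he]
        rw [mul_div_cancel₀ _ (by positivity)]
        have := Complex.norm_mul_exp_arg_mul_I (f x / f z)
        rw [hn, Complex.ofReal_one, one_mul] at this
        rw [this, mul_div_cancel₀ _ hfz0]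
      simp only [this, hgf x hx]
  · intro s t
    constructor
    · intro hst
      have h1 : e s = e t := hg.2.injOn (hes s) (hes t) hst
      simp only [he] at h1
      have h2 := mul_left_cancel₀ hfz0 h1
      rw [Complex.exp_eq_exp_iff_exists_int] at h2
      obtain ⟨n, hn⟩ := h2
      refine ⟨n, ?_⟩
      have h3 : ((2 * Real.pi * s : ℝ) : ℂ) * Complex.I =
          ((2 * Real.pi * (t + n) : ℝ) : ℂ) * Complex.I := by
        rw [hn]; push_cast; ring
      have h4 := mul_right_cancel₀ Complex.I_ne_zero h3
      have h5 : 2 * Real.pi * s = 2 * Real.pi * (t + n) := by exact_mod_cast h4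
      exact mul_left_cancel₀ (by positivity) h5
    · rintro ⟨n, rfl⟩
      have : e (t + n) = e t := by
        simp only [he]
        congr 1
        rw [Complex.exp_eq_exp_iff_exists_int]
        exact ⟨n, by push_cast; ring⟩
      simp only [this]

/-- A nontrivial proper closed connected subset of a circle is an arc, and so is the
closure of its complement. -/
lemma circle_split [T2Space X] {C J : Set X} (hC : IsCirc C) (hJC : J ⊆ C) (hJ : IsClosed J)
    (hJc : IsConnected J) (hnt : J.Nontrivial) (hne : J ≠ C) :
    ∃ p q, IsArc J p q ∧ IsArc (closure (C \ J)) p q ∧ J ∪ closure (C \ J) = C ∧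
      J ∩ closure (C \ J) = {p, q} := by
  obtain ⟨z, hzC, hzJ⟩ : ∃ z ∈ C, z ∉ J := by
    by_contra hcon
    push Not at hcon
    exact hne (Subset.antisymm hJC hcon)
  obtain ⟨h, hc, h0, hr, hi⟩ := hC.param hzC
  have h1 : h 1 = z := by rw [← h0, hi]; exact ⟨1, by simp⟩
  set S := h ⁻¹' J ∩ Icc 0 1 with hS
  have hScomp : IsCompact S := isCompact_Icc.inter_left (hJ.preimage hc)
  have hS0 : ∀ t ∈ S, 0 < t ∧ t < 1 := by
    rintro t ⟨ht, ht0, ht1⟩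
    constructor
    · refine lt_of_le_of_ne ht0 ?_
      rintro rfl
      exact hzJ (h0 ▸ ht)
    · refine lt_of_le_of_ne ht1 ?_
      rintro rfl
      exact hzJ (h1 ▸ ht)
  have hSinj : InjOn h S := by
    intro s hs t ht hst
    obtain ⟨n, hn⟩ := (hi s t).1 hst
    have a1 := hS0 s hs
    have a2 := hS0 t ht
    have b1 : (-1:ℝ) < n := by linarith
    have b2 : (n:ℝ) < 1 := by linarith
    have b3 : (-1:ℤ) < n := by exact_mod_cast b1
    have b4 : n < 1 := by exact_mod_cast b2
    have : n = 0 := by omega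
    simpa [this] using hn
  have hSim : h '' S = J := by
    apply Subset.antisymm
    · rintro _ ⟨t, ht, rfl⟩; exact ht.1
    · intro x hx
      have : x ∈ range h := hr ▸ hJC hx
      obtain ⟨t, rfl⟩ := this
      have e : h (Int.fract t) = h t := (hi _ _).2 ⟨-⌊t⌋, by rw [Int.fract]; push_cast; ring⟩
      exact ⟨Int.fract t, ⟨by rw [mem_preimage, e]; exact hx, Int.fract_nonneg t,
        (Int.fract_lt_one t).le⟩, e⟩
  have hSh : HomeoOn h S J := ⟨hc.continuousOn, hSim ▸ hSinj.bijOn_image⟩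
  have hSne : S.Nonempty := by
    rw [← image_nonempty (f := h), hSim]; exact hJc.nonempty
  obtain ⟨g, hg, -, -⟩ := hSh.symm hScomp hSne
  have hSconn : IsConnected S := by
    rw [← hg.image_eq]; exact hJc.image g hg.1
  obtain ⟨a, b, hab'⟩ : ∃ a b, S = Icc a b :=
    ⟨_, _, eq_Icc_of_connected_compact hSconn hScomp⟩
  have hab : a < b := by
    obtain ⟨x, hx, y, hy, hxy⟩ := hnt
    rw [← hSim, hab'] at hx hy
    obtain ⟨s, hs, rfl⟩ := hx
    obtain ⟨t, ht, rfl⟩ := hy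
    by_contra hcon
    have : s = t := by
      have := hs.1; have := hs.2; have := ht.1; have := ht.2; linarith
    exact hxy (by rw [this])
  have ha := hS0 a (hab' ▸ left_mem_Icc.2 hab.le)
  have hb := hS0 b (hab' ▸ right_mem_Icc.2 hab.le)
  have hba : b < a + 1 := by linarith
  have hha : h (a + 1) = h a := (hi _ _).2 ⟨1, by simp⟩
  have hcover : J ∪ h '' Icc b (a + 1) = C := by
    apply Subset.antisymm
    · apply union_subset hJC
      rw [← hr]; exact image_subset_range _ _
    · intro x hx
      have : x ∈ range h := hr ▸ hx
      obtain ⟨t, rfl⟩ := this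
      have e : h (a + Int.fract (t - a)) = h t :=
        (hi _ _).2 ⟨-⌊t - a⌋, by rw [Int.fract]; push_cast; ring⟩
      rw [← e]
      have f0 := Int.fract_nonneg (t - a)
      have f1 := Int.fract_lt_one (t - a)
      rcases le_total (a + Int.fract (t - a)) b with hle | hle
      · left
        rw [← hSim, hab']
        exact mem_image_of_mem _ ⟨by linarith, hle⟩
      · right
        exact mem_image_of_mem _ ⟨hle, by linarith⟩
  have hmeet : ∀ s ∈ Icc a b, ∀ t ∈ Icc b (a + 1), h s = h t →
      (s = b ∧ t = b) ∨ (s = a ∧ t = a + 1) := by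
    rintro s ⟨s1, s2⟩ t ⟨t1, t2⟩ hst
    obtain ⟨n, hn⟩ := (hi s t).1 hst
    have b1 : (-1:ℝ) ≤ n := by linarith
    have b2 : (n:ℝ) ≤ 0 := by linarith
    have b3 : (-1:ℤ) ≤ n := by exact_mod_cast b1
    have b4 : n ≤ 0 := by exact_mod_cast b2
    have : n = 0 ∨ n = -1 := by omega
    rcases this with rfl | rfl
    · left; push_cast at hn; constructor <;> linarith
    · right; push_cast at hn; constructor <;> linarith
  have hKinj : InjOn h (Icc b (a + 1)) := by
    intro s hs t ht hst
    obtain ⟨n, hn⟩ := (hi s t).1 hst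
    have := hs.1; have := hs.2; have := ht.1; have := ht.2
    have b1 : (-1:ℝ) < n := by linarith
    have b2 : (n:ℝ) < 1 := by linarith
    have b3 : (-1:ℤ) < n := by exact_mod_cast b1
    have b4 : n < 1 := by exact_mod_cast b2
    have : n = 0 := by omega
    simpa [this] using hn
  have hKh : HomeoOn h (Icc b (a + 1)) (h '' Icc b (a + 1)) :=
    ⟨hc.continuousOn, hKinj.bijOn_image⟩
  have hKcl : closure (C \ J) = h '' Icc b (a + 1) := by
    apply Subset.antisymm
    · apply closure_minimal
      · rintro x ⟨hx, hxJ⟩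
        rw [← hcover] at hx
        exact hx.resolve_left hxJ
      · exact (isCompact_Icc.image hc).isClosed
    · rw [← closure_Ioo hba.ne]
      refine (image_closure_subset_closure_image hc).trans (closure_mono ?_)
      rintro _ ⟨t, ht, rfl⟩
      refine ⟨hr ▸ mem_range_self t, ?_⟩
      intro hJt
      rw [← hSim, hab'] at hJt
      obtain ⟨s, hs, hst⟩ := hJt
      rcases hmeet s hs t ⟨ht.1.le, ht.2.le⟩ hst with ⟨-, h⟩ | ⟨-, h⟩
      · exact ht.1.ne' h
      · exact ht.2.ne h
  rw [hKcl]
  refine ⟨h a, h b, IsArc.of_param hab (hab' ▸ hSh), ?_, hcover, ?_⟩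
  · have := (IsArc.of_param hba hKh).symm
    rwa [hha] at this
  · apply Subset.antisymm
    · rintro x ⟨hx, t, ht, rfl⟩
      rw [← hSim, hab'] at hx
      obtain ⟨s, hs, hst⟩ := hx
      rcases hmeet s hs t ht hst with ⟨-, h⟩ | ⟨-, h⟩
      · rw [h]; simp
      · rw [h, hha]; simp
    · rw [insert_subset_iff, singleton_subset_iff, ← hSim, hab']
      exact ⟨⟨mem_image_of_mem _ (left_mem_Icc.2 hab.le), a + 1, ⟨by linarith, le_rfl⟩, hha⟩,
        mem_image_of_mem _ (right_mem_Icc.2 hab.le), b, ⟨le_rfl, by linarith⟩, rfl⟩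

/-- Endpoints of an arc are intrinsic. -/
lemma IsArc.endpoint_aux {J : Set X} {σ τ : X → ℝ} {p : X} (hJ : IsCompact J) (hp : p ∈ J)
    (hσ : HomeoOn σ J (Icc 0 1)) (hτ : HomeoOn τ J (Icc 0 1)) (h0 : σ p = 0) :
    τ p = 0 ∨ τ p = 1 := by
  obtain ⟨g, hg, hgσ, hσg⟩ := hσ.symm hJ ⟨p, hp⟩
  by_contra hcon
  push Not at hcon
  have hτp := hτ.2.mapsTo hp
  have hc : IsPreconnected ((τ ∘ g) '' Ioc 0 1) :=
    isPreconnected_Ioc.image _ ((hτ.1.comp hg.1 hg.2.mapsTo).mono Ioc_subset_Icc_self)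
  have hmem : ∀ t ∈ Icc (0:ℝ) 1, t ≠ τ p → t ∈ (τ ∘ g) '' Ioc 0 1 := by
    intro t ht hne
    obtain ⟨x, hx, rfl⟩ := hτ.2.surjOn ht
    have hs := hσ.2.mapsTo hx
    refine ⟨σ x, ⟨lt_of_le_of_ne hs.1 ?_, hs.2⟩, by simp [hgσ x hx]⟩
    intro h
    apply hne
    rw [hσ.2.injOn hx hp (by rw [← h, h0])]
  have hmem2 := hc.ordConnected.out (hmem 0 (by simp) (fun h => hcon.1 h.symm))
    (hmem 1 (by simp) (fun h => hcon.2 h.symm)) hτp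
  obtain ⟨s, hs, hst⟩ := hmem2
  have hs' : s ∈ Icc (0:ℝ) 1 := Ioc_subset_Icc_self hs
  have := hτ.2.injOn (hg.2.mapsTo hs') hp hst
  have h2 : σ (g s) = s := hσg s hs'
  rw [this, h0] at h2
  exact hs.1.ne h2

lemma IsArc.endpoints {J : Set X} {p q p' q' : X} (h : IsArc J p q) (h' : IsArc J p' q') :
    (p = p' ∧ q = q') ∨ (p = q' ∧ q = p') := by
  obtain ⟨hJ, hp, hq, σ, hσ, h0, h1⟩ := id h
  obtain ⟨-, -, -, σ2, hσ2, h02, h12⟩ := id h.symm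
  obtain ⟨-, hp', hq', τ, hτ, k0, k1⟩ := id h'
  have hpq := h.ne
  have a1 := IsArc.endpoint_aux hJ hp hσ hτ h0
  have a2 := IsArc.endpoint_aux hJ hq hσ2 hτ h02
  have e0 : ∀ x ∈ J, τ x = 0 → x = p' := fun x hx h => hτ.2.injOn hx hp' (by rw [h, k0])
  have e1 : ∀ x ∈ J, τ x = 1 → x = q' := fun x hx h => hτ.2.injOn hx hq' (by rw [h, k1])
  rcases a1 with a1 | a1 <;> rcases a2 with a2 | a2
  · exact absurd ((e0 p hp a1).trans (e0 q hq a2).symm) hpq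
  · exact Or.inl ⟨e0 p hp a1, e1 q hq a2⟩
  · exact Or.inr ⟨e1 p hp a1, e0 q hq a2⟩
  · exact absurd ((e1 p hp a1).trans (e1 q hq a2).symm) hpq

/-- Half circles. -/
def semi (ε : ℝ) (t : ℝ) : ℂ := ⟨2 * t - 1, ε * Real.sqrt (1 - (2 * t - 1) ^ 2)⟩

lemma cont_mk {Z : Type*} [TopologicalSpace Z] {a b : Z → ℝ} (ha : Continuous a)
    (hb : Continuous b) : Continuous (fun z => (⟨a z, b z⟩ : ℂ)) := by
  have : (fun z => (⟨a z, b z⟩ : ℂ)) = fun z => (a z : ℂ) + (b z : ℂ) * Complex.I := by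
    funext z; apply Complex.ext <;> simp
  rw [this]; fun_prop

lemma normSq_semi {ε t : ℝ} (hε : ε ^ 2 = 1) (ht : t ∈ Icc (0:ℝ) 1) : ‖semi ε t‖ = 1 := by
  have h : 0 ≤ 1 - (2 * t - 1) ^ 2 := by nlinarith [ht.1, ht.2]
  have h2 := Real.sq_sqrt h
  rw [← sq_eq_sq₀ (norm_nonneg _) zero_le_one, ← Complex.normSq_eq_norm_sq, Complex.normSq_apply]
  simp only [semi]
  nlinarith

lemma semi_homeo {ε : ℝ} (hε : ε ^ 2 = 1) :
    HomeoOn (semi ε) (Icc 0 1) {z | ‖z‖ = 1 ∧ 0 ≤ ε * z.im} := by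
  refine ⟨?_, ?_, ?_, ?_⟩
  · apply Continuous.continuousOn
    exact cont_mk (by fun_prop) (by fun_prop)
  · intro t ht
    refine ⟨normSq_semi hε ht, ?_⟩
    simp only [semi]
    rw [← mul_assoc, ← sq, hε, one_mul]
    exact Real.sqrt_nonneg _
  · intro s _ t _ hst
    have := congrArg Complex.re hst
    simp only [semi] at this
    linarith
  · rintro z ⟨hz, him⟩
    have h1 : z.re ^ 2 + z.im ^ 2 = 1 := by
      have := Complex.normSq_eq_norm_sq z
      rw [Complex.normSq_apply, hz] at this
      nlinarith
    refine ⟨(z.re + 1) / 2, ⟨by nlinarith [sq_nonneg z.im], by nlinarith [sq_nonneg z.im]⟩, ?_⟩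
    apply Complex.ext
    · simp only [semi]; ring
    · simp only [semi]
      have : 1 - (2 * ((z.re + 1) / 2) - 1) ^ 2 = (ε * z.im) ^ 2 := by
        rw [mul_pow, hε]; nlinarith
      rw [this, Real.sqrt_sq him, ← mul_assoc, ← sq, hε, one_mul]

lemma semi_zero (ε : ℝ) : semi ε 0 = -1 := by
  apply Complex.ext <;> simp [semi]

lemma semi_one (ε : ℝ) : semi ε 1 = 1 := by
  apply Complex.ext <;> norm_num [semi]

end topology2

section topology3
variable {X Y : Type*} [TopologicalSpace X] [TopologicalSpace Y]

lemma norm_one_iff (z : ℂ) : ‖z‖ = 1 ↔ z.re ^ 2 + z.im ^ 2 = 1 := by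
  rw [← sq_eq_sq₀ (norm_nonneg _) zero_le_one, ← Complex.normSq_eq_norm_sq, Complex.normSq_apply]
  constructor <;> intro h <;> nlinarith

lemma norm_le_one_iff (z : ℂ) : ‖z‖ ≤ 1 ↔ z.re ^ 2 + z.im ^ 2 ≤ 1 := by
  rw [← sq_le_sq₀ (norm_nonneg _) zero_le_one, ← Complex.normSq_eq_norm_sq, Complex.normSq_apply]
  constructor <;> intro h <;> nlinarith

lemma arcs_circle [T2Space X] {J K : Set X} {p q : X} {σ τ : X → ℝ} {ε : ℝ} (hε : ε ^ 2 = 1)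
    (hJ : IsCompact J) (hK : IsCompact K)
    (hσ : HomeoOn σ J (Icc 0 1)) (hτ : HomeoOn τ K (Icc 0 1)) (hJK : J ∩ K = {p, q})
    (h0 : σ p = 0) (h1 : σ q = 1) (k0 : τ p = 0) (k1 : τ q = 1) :
    ∃ φ : X → ℂ, HomeoOn φ (J ∪ K) (Metric.sphere 0 1) ∧ EqOn φ (semi ε ∘ σ) J ∧
      EqOn φ (semi (-ε) ∘ τ) K := by
  have hε' : (-ε) ^ 2 = 1 := by rw [neg_sq, hε]
  obtain ⟨φ, h1, h2, h3⟩ := paste_two hJ.isClosed hK.isClosed ((semi_homeo hε).comp hσ)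
    ((semi_homeo hε').comp hτ) (by
      rw [hJK]
      rintro x (rfl | rfl)
      · simp [h0, k0, semi_zero]
      · simp [h1, k1, semi_one]) (by
      rw [hJK]
      rintro z ⟨⟨hz, hz1⟩, ⟨-, hz2⟩⟩
      have hz0 : z.im = 0 := by
        have : ε * z.im = 0 := by
          apply le_antisymm _ hz1
          linarith
        rcases mul_eq_zero.1 this with h | h
        · rw [h] at hε; norm_num at hε
        · exact h
      have h1' : z.re ^ 2 = 1 := by
        have := (norm_one_iff z).1 hz
        rw [hz0] at this
        nlinarith
      rcases sq_eq_one_iff.1 h1' with h | h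
      · exact ⟨q, by simp, by simp only [Function.comp, h1, semi_one]; apply Complex.ext <;> simp [h, hz0]⟩
      · exact ⟨p, by simp, by simp only [Function.comp, h0, semi_zero]; apply Complex.ext <;> simp [h, hz0]⟩)
  refine ⟨φ, ?_, h2, h3⟩
  convert h1 using 1
  ext z
  simp only [mem_sphere_zero_iff_norm, mem_union, mem_ofPred_eq, neg_mul, Left.nonneg_neg_iff]
  have := le_total 0 (ε * z.im)
  tauto

def shear (ε : ℝ) (z : ℂ) : ℂ := ⟨z.re, (z.im + ε * Real.sqrt (1 - z.re ^ 2)) / 2⟩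

lemma shear_homeo {ε : ℝ} (hε : ε ^ 2 = 1) :
    HomeoOn (shear ε) (Metric.closedBall 0 1) {z | ‖z‖ ≤ 1 ∧ 0 ≤ ε * z.im} := by
  have hcases : ε = 1 ∨ ε = -1 := sq_eq_one_iff.1 hε
  refine ⟨?_, ?_, ?_, ?_⟩
  · apply Continuous.continuousOn
    exact cont_mk (by fun_prop) (by fun_prop)
  · intro z hz
    rw [mem_closedBall_zero_iff, norm_le_one_iff] at hz
    have h : 0 ≤ 1 - z.re ^ 2 := by nlinarith [sq_nonneg z.im]
    have h2 := Real.sq_sqrt h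
    have h3 := Real.sqrt_nonneg (1 - z.re ^ 2)
    simp only [mem_ofPred_eq, norm_le_one_iff, shear]
    have h4 : |z.im| ≤ Real.sqrt (1 - z.re ^ 2) := by
      apply Real.abs_le_sqrt; linarith
    rw [abs_le] at h4
    rcases hcases with rfl | rfl
    · exact ⟨by nlinarith, by linarith⟩
    · exact ⟨by nlinarith, by linarith⟩
  · intro z _ w _ hzw
    have h1 := congrArg Complex.re hzw
    have h2 := congrArg Complex.im hzw
    simp only [shear] at h1 h2
    rw [h1] at h2
    exact Complex.ext h1 (by linarith)
  · rintro z ⟨hz, him⟩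
    rw [norm_le_one_iff] at hz
    have h : 0 ≤ 1 - z.re ^ 2 := by nlinarith [sq_nonneg z.im]
    have h2 := Real.sq_sqrt h
    have h3 := Real.sqrt_nonneg (1 - z.re ^ 2)
    have h4 : |z.im| ≤ Real.sqrt (1 - z.re ^ 2) := by
      apply Real.abs_le_sqrt; linarith
    rw [abs_le] at h4
    refine ⟨⟨z.re, 2 * z.im - ε * Real.sqrt (1 - z.re ^ 2)⟩, ?_, ?_⟩
    · rw [mem_closedBall_zero_iff, norm_le_one_iff]
      simp only
      rcases hcases with rfl | rfl
      · nlinarith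
      · nlinarith
    · apply Complex.ext <;> simp [shear]

lemma shear_semi {ε : ℝ} (t : ℝ) : shear ε (semi ε t) = semi ε t := by
  apply Complex.ext <;> simp [shear, semi]

lemma shear_semi' {ε : ℝ} (t : ℝ) : shear ε (semi (-ε) t) = ((2 * t - 1 : ℝ) : ℂ) := by
  apply Complex.ext <;> simp [shear, semi]

/-- One half of the gluing. -/
lemma half_glue [T2Space X] {A C J : Set X} {p q : X} {σ : X → ℝ} {ε : ℝ} (hε : ε ^ 2 = 1)
    (hA : IsDisc A C) (hJ : IsCompact J) (hσ : HomeoOn σ J (Icc 0 1)) (h0 : σ p = 0) (h1 : σ q = 1)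
    (hK : IsArc (closure (C \ J)) p q) (hu : J ∪ closure (C \ J) = C)
    (hi : J ∩ closure (C \ J) = {p, q}) :
    ∃ f : X → ℂ, HomeoOn f A {z | ‖z‖ ≤ 1 ∧ 0 ≤ ε * z.im} ∧
      (∀ x ∈ J, f x = ((2 * σ x - 1 : ℝ) : ℂ)) ∧
      f '' (closure (C \ J)) = {z | ‖z‖ = 1 ∧ 0 ≤ ε * z.im} := by
  have hε' : (-ε) ^ 2 = 1 := by rw [neg_sq, hε]
  obtain ⟨hKc, -, -, τ, hτ, k0, k1⟩ := hK
  obtain ⟨φ, hφ, hφJ, hφK⟩ := arcs_circle hε' hJ hKc hσ hτ hi h0 h1 k0 k1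
  rw [hu] at hφ
  rw [neg_neg] at hφK
  obtain ⟨f, hf, hfφ⟩ := hA.extend hφ
  have hJC : J ⊆ C := hu ▸ subset_union_left
  have hKC : closure (C \ J) ⊆ C := by
    conv_rhs => rw [← hu]
    exact subset_union_right
  refine ⟨shear ε ∘ f, (shear_homeo hε).comp hf, ?_, ?_⟩
  · intro x hx
    simp only [Function.comp, hfφ (hJC hx), hφJ hx, shear_semi']
  · rw [← (semi_homeo hε).image_eq, ← hτ.image_eq, image_image]
    apply image_congr
    intro x hx
    simp only [Function.comp, hfφ (hKC hx), hφK hx, shear_semi]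

/-- Gluing two discs along a common boundary arc. -/
lemma glue [T2Space X] {A C A' C' J : Set X} (hA : IsDisc A C) (hA' : IsDisc A' C')
    (hAA : A ∩ A' = J) (hJC : J ⊆ C) (hJC' : J ⊆ C') (hJc : IsConnected J)
    (hnt : J.Nontrivial) (hne : J ≠ C) (hne' : J ≠ C') :
    IsDisc (A ∪ A') (closure (C \ J) ∪ closure (C' \ J)) := by
  have hJcl : IsClosed J := hAA ▸ hA.1.isClosed.inter hA'.1.isClosed
  obtain ⟨p, q, ⟨hJ, hp, hq, σ, hσ, h0, h1⟩, hK, hu, hi⟩ :=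
    circle_split hA.isCirc hJC hJcl hJc hnt hne
  obtain ⟨p', q', hJ', hK', hu', hi'⟩ :=
    circle_split hA'.isCirc hJC' hJcl hJc hnt hne'
  have hK'' : IsArc (closure (C' \ J)) p q ∧ J ∩ closure (C' \ J) = {p, q} := by
    rcases IsArc.endpoints ⟨hJ, hp, hq, σ, hσ, h0, h1⟩ hJ' with ⟨rfl, rfl⟩ | ⟨rfl, rfl⟩
    · exact ⟨hK', hi'⟩
    · exact ⟨hK'.symm, by rw [hi', pair_comm]⟩
  obtain ⟨f, hf, hfJ, hfK⟩ := half_glue (ε := 1) (by norm_num) hA hJ hσ h0 h1 hK hu hi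
  obtain ⟨f', hf', hfJ', hfK'⟩ := half_glue (ε := -1) (by norm_num) hA' hJ hσ h0 h1 hK''.1 hu' hK''.2
  obtain ⟨g, hg, hgf, hgf'⟩ := paste_two hA.1.isClosed hA'.1.isClosed hf hf' (by
    rw [hAA]
    intro x hx
    rw [hfJ x hx, hfJ' x hx]) (by
    rw [hAA]
    rintro z ⟨⟨hz, hz1⟩, ⟨-, hz2⟩⟩
    have hz0 : z.im = 0 := by linarith
    rw [norm_le_one_iff, hz0] at hz
    obtain ⟨x, hx, hxz⟩ := hσ.2.surjOn (show (z.re + 1) / 2 ∈ Icc (0:ℝ) 1 from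
      ⟨by nlinarith, by nlinarith⟩)
    refine ⟨x, hx, ?_⟩
    rw [hfJ x hx, hxz]
    apply Complex.ext
    · simp only [Complex.ofReal_re]; ring
    · simp [hz0])
  have hKA : closure (C \ J) ⊆ A := closure_minimal (sdiff_subset.trans hA.2.1) hA.1.isClosed
  have hKA' : closure (C' \ J) ⊆ A' := closure_minimal (sdiff_subset.trans hA'.2.1) hA'.1.isClosed
  refine ⟨hA.1.union hA'.1, union_subset_union hKA hKA', g, ?_, ?_⟩
  · convert hg using 1
    ext z
    simp only [mem_closedBall_zero_iff, mem_union, mem_ofPred_eq, neg_mul, Left.nonneg_neg_iff]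
    have := le_total 0 (1 * z.im)
    tauto
  · rw [image_union, (hgf.mono hKA).image_eq, (hgf'.mono hKA').image_eq, hfK, hfK']
    ext z
    simp only [mem_sphere_zero_iff_norm, mem_union, mem_ofPred_eq, neg_mul, Left.nonneg_neg_iff]
    have := le_total 0 (1 * z.im)
    tauto

/-- Subarcs. -/
lemma IsArc.sub [T2Space X] {K : Set X} {σ : X → ℝ} (hK : IsCompact K) (hσ : HomeoOn σ K (Icc 0 1))
    {x y : X} (hx : x ∈ K) (hy : y ∈ K) (hxy : σ x < σ y) :
    IsArc (K ∩ σ ⁻¹' Icc (σ x) (σ y)) x y := by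
  obtain ⟨g, hg, hgσ, hσg⟩ := hσ.symm hK ⟨x, hx⟩
  have hsub : Icc (σ x) (σ y) ⊆ Icc 0 1 := Icc_subset_Icc (hσ.2.mapsTo hx).1 (hσ.2.mapsTo hy).2
  have := IsArc.of_param hxy (hg.restrict hsub)
  rw [hgσ x hx, hgσ y hy] at this
  convert this using 1
  ext z
  constructor
  · rintro ⟨hz, hz'⟩
    exact ⟨σ z, hz', hgσ z hz⟩
  · rintro ⟨t, ht, rfl⟩
    refine ⟨hg.2.mapsTo (hsub ht), ?_⟩
    rw [mem_preimage, hσg t (hsub ht)]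
    exact ht

/-- Splitting a circle along two disjoint arcs. -/
lemma circle_split4 [T2Space X] {C e e' : Set X} (hC : IsCirc C) (heC : e ⊆ C) (heC' : e' ⊆ C)
    (he : IsClosed e) (he' : IsClosed e') (hec : IsConnected e) (hec' : IsConnected e')
    (hnt : e.Nontrivial) (hnt' : e'.Nontrivial) (hd : Disjoint e e') :
    ∃ p q p' q' K1 K2, IsArc e p q ∧ IsArc e' p' q' ∧ IsArc K1 p p' ∧ IsArc K2 q q' ∧
      C = e ∪ e' ∪ K1 ∪ K2 ∧ e ∩ K1 = {p} ∧ e' ∩ K1 = {p'} ∧ e ∩ K2 = {q} ∧ e' ∩ K2 = {q'} ∧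
      K1 ∩ K2 = ∅ := by
  have hne : e ≠ C := by
    rintro rfl
    obtain ⟨x, hx⟩ := hec'.nonempty
    exact disjoint_left.1 hd (heC' hx) hx
  obtain ⟨p, q, hep, ⟨hKc, hpK, hqK, σ, hσ, h0, h1⟩, hu, hi⟩ := circle_split hC heC he hec hnt hne
  set K := closure (C \ e) with hK
  have heK : e' ⊆ K := fun x hx => by
    have : x ∈ e ∪ K := hu.symm ▸ heC' hx
    exact this.resolve_left (fun h => disjoint_left.1 hd h hx)
  have hσc : IsCompact (σ '' e') :=
    (hKc.of_isClosed_subset he' heK).image_of_continuousOn (hσ.1.mono heK)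
  have hσn : IsConnected (σ '' e') := hec'.image σ (hσ.1.mono heK)
  obtain ⟨a, b, hab'⟩ : ∃ a b, σ '' e' = Icc a b := ⟨_, _, eq_Icc_of_connected_compact hσn hσc⟩
  have hab : a < b := by
    obtain ⟨x, hx, y, hy, hxy⟩ := hnt'
    by_contra hcon
    have h1 : σ x ∈ Icc a b := hab' ▸ mem_image_of_mem _ hx
    have h2 : σ y ∈ Icc a b := hab' ▸ mem_image_of_mem _ hy
    refine hxy (hσ.2.injOn (heK hx) (heK hy) ?_)
    have := h1.1; have := h1.2; have := h2.1; have := h2.2; linarith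
  have ha : a ∈ σ '' e' := hab' ▸ left_mem_Icc.2 hab.le
  have hb : b ∈ σ '' e' := hab' ▸ right_mem_Icc.2 hab.le
  obtain ⟨p', hp', rfl⟩ := ha
  obtain ⟨q', hq', rfl⟩ := hb
  have hpe : p ∈ e := hep.2.1
  have hqe : q ∈ e := hep.2.2.1
  have hee : ∀ x ∈ K, x ∈ e' ↔ σ x ∈ Icc (σ p') (σ q') := by
    intro x hx
    constructor
    · intro h; rw [← hab']; exact mem_image_of_mem _ h
    · intro h
      rw [← hab'] at h
      obtain ⟨y, hy, hyx⟩ := h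
      rwa [← hσ.2.injOn (heK hy) hx hyx]
  have hee2 : ∀ x ∈ K, x ∈ e ↔ σ x = 0 ∨ σ x = 1 := by
    intro x hx
    constructor
    · intro h
      have : x ∈ e ∩ K := ⟨h, hx⟩
      rw [hi] at this
      rcases this with rfl | rfl
      · exact Or.inl h0
      · exact Or.inr h1
    · rintro (h | h)
      · rwa [hσ.2.injOn hx hpK (h.trans h0.symm)]
      · rwa [hσ.2.injOn hx hqK (h.trans h1.symm)]
  have hp'0 : 0 < σ p' := by
    refine lt_of_le_of_ne (hσ.2.mapsTo (heK hp')).1 ?_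
    intro h
    exact disjoint_left.1 hd ((hee2 p' (heK hp')).2 (Or.inl h.symm)) hp'
  have hq'1 : σ q' < 1 := by
    refine lt_of_le_of_ne (hσ.2.mapsTo (heK hq')).2 ?_
    intro h
    exact disjoint_left.1 hd ((hee2 q' (heK hq')).2 (Or.inr h)) hq'
  have hmem : ∀ x ∈ K, 0 ≤ σ x ∧ σ x ≤ 1 := fun x hx => hσ.2.mapsTo hx
  refine ⟨p, q, p', q', K ∩ σ ⁻¹' Icc (σ p) (σ p'), K ∩ σ ⁻¹' Icc (σ q') (σ q), hep, ?_,
    IsArc.sub hKc hσ hpK (heK hp') (by rw [h0]; exact hp'0),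
    (IsArc.sub hKc hσ (heK hq') hqK (by rw [h1]; exact hq'1)).symm, ?_, ?_, ?_, ?_, ?_, ?_⟩
  · have := IsArc.sub hKc hσ (heK hp') (heK hq') hab
    convert this using 1
    ext x
    constructor
    · intro hx; exact ⟨heK hx, (hee x (heK hx)).1 hx⟩
    · rintro ⟨hx, hx'⟩; exact (hee x hx).2 hx'
  · apply Subset.antisymm
    · intro x hx
      rw [← hu] at hx
      rcases hx with hx | hx
      · exact Or.inl (Or.inl (Or.inl hx))
      · have h2 := hmem x hx
        rcases le_total (σ x) (σ p') with h | h
        · exact Or.inl (Or.inr ⟨hx, by rw [h0]; exact h2.1, h⟩)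
        rcases le_total (σ x) (σ q') with h' | h'
        · exact Or.inl (Or.inl (Or.inr ((hee x hx).2 ⟨h, h'⟩)))
        · exact Or.inr ⟨hx, h', by rw [h1]; exact h2.2⟩
    · have hKC : K ⊆ C := hu ▸ subset_union_right
      exact union_subset (union_subset (union_subset heC heC') (inter_subset_left.trans hKC))
        (inter_subset_left.trans hKC)
  · ext x
    constructor
    · rintro ⟨hxe, hxK, hx1, hx2⟩
      rcases (hee2 x hxK).1 hxe with h | h
      · exact hσ.2.injOn hxK hpK (h.trans h0.symm)
      · linarith
    · rintro rfl
      exact ⟨hpe, hpK, le_rfl, by rw [h0]; exact hp'0.le⟩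
  · ext x
    constructor
    · rintro ⟨hxe, hxK, hx1, hx2⟩
      have := (hee x hxK).1 hxe
      exact hσ.2.injOn hxK (heK hp') (le_antisymm hx2 this.1)
    · rintro rfl
      exact ⟨hp', heK hp', by rw [h0]; exact hp'0.le, le_rfl⟩
  · ext x
    constructor
    · rintro ⟨hxe, hxK, hx1, hx2⟩
      rcases (hee2 x hxK).1 hxe with h | h
      · linarith
      · exact hσ.2.injOn hxK hqK (h.trans h1.symm)
    · rintro rfl
      exact ⟨hqe, hqK, by rw [h1]; exact hq'1.le, le_rfl⟩
  · ext x
    constructor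
    · rintro ⟨hxe, hxK, hx1, hx2⟩
      have := (hee x hxK).1 hxe
      exact hσ.2.injOn hxK (heK hq') (le_antisymm this.2 hx1)
    · rintro rfl
      exact ⟨hq', heK hq', le_rfl, by rw [h1]; exact hq'1.le⟩
  · rw [eq_empty_iff_forall_notMem]
    rintro x ⟨⟨-, -, h1⟩, ⟨-, h2, -⟩⟩
    linarith

end topology3

section topology4
variable {X Y : Type*} [TopologicalSpace X] [TopologicalSpace Y]

lemma isDisc_prod_arc [T2Space X] {α : Set X} {p p' : X} (hα : IsArc α p p') :
    IsDisc (Icc (0:ℝ) 1 ×ˢ α)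
      (((Icc (0:ℝ) 1 ×ˢ {p} ∪ Icc (0:ℝ) 1 ×ˢ {p'}) ∪ {0} ×ˢ α) ∪ {1} ×ˢ α) := by
  obtain ⟨hc, hp, hp', σ, hσ, h0, h1⟩ := hα
  obtain ⟨g, hg, hgσ, hσg⟩ := hσ.symm hc ⟨p, hp⟩
  have hR : IsDisc (Icc (0:ℝ) 1 ×ℂ Icc (0:ℝ) 1) (frontier (Icc (0:ℝ) 1 ×ℂ Icc (0:ℝ) 1)) := by
    apply isDisc_convex
    · exact isCompact_Icc.reProdIm isCompact_Icc
    · exact ((convex_Icc (0:ℝ) 1).linear_preimage Complex.reLm).inter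
        ((convex_Icc (0:ℝ) 1).linear_preimage Complex.imLm)
    · rw [Complex.interior_reProdIm, interior_Icc]
      exact ⟨⟨1/2, 1/2⟩, by norm_num [Complex.mem_reProdIm]⟩
  have hg0 : g 0 = p := by rw [← h0, hgσ p hp]
  have hg1 : g 1 = p' := by rw [← h1, hgσ p' hp']
  have hm : HomeoOn (fun z : ℂ => (z.re, g z.im)) (Icc (0:ℝ) 1 ×ℂ Icc (0:ℝ) 1)
      (Icc (0:ℝ) 1 ×ˢ α) := by
    refine ⟨?_, ?_, ?_, ?_⟩
    · refine ContinuousOn.prodMk Complex.continuous_re.continuousOn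
        (hg.1.comp Complex.continuous_im.continuousOn ?_)
      intro z hz; exact hz.2
    · intro z hz; exact ⟨hz.1, hg.2.mapsTo hz.2⟩
    · intro z hz w hw hzw
      simp only [Prod.mk.injEq] at hzw
      exact Complex.ext hzw.1 (hg.2.injOn hz.2 hw.2 hzw.2)
    · rintro ⟨t, x⟩ ⟨ht, hx⟩
      exact ⟨⟨t, σ x⟩, ⟨ht, hσ.2.mapsTo hx⟩, by simp [hgσ x hx]⟩
  convert hR.image hm using 1
  rw [Complex.frontier_reProdIm, closure_Icc, frontier_Icc zero_le_one]
  ext ⟨t, x⟩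
  simp only [mem_union, mem_prod, mem_image, mem_singleton_iff, Complex.mem_reProdIm,
    Prod.mk.injEq, mem_insert_iff]
  constructor
  · rintro (((⟨ht, rfl⟩ | ⟨ht, rfl⟩) | ⟨rfl, hx⟩) | ⟨rfl, hx⟩)
    · exact ⟨⟨t, 0⟩, by simp_all, rfl, hg0⟩
    · exact ⟨⟨t, 1⟩, by simp_all, rfl, hg1⟩
    · exact ⟨⟨0, σ x⟩, Or.inr ⟨by simp, hσ.2.mapsTo hx⟩, rfl, hgσ x hx⟩
    · exact ⟨⟨1, σ x⟩, Or.inr ⟨by simp, hσ.2.mapsTo hx⟩, rfl, hgσ x hx⟩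
  · rintro ⟨z, (⟨hz, hz' | hz'⟩ | ⟨hz | hz, hz'⟩), rfl, rfl⟩
    · left; left; left; exact ⟨hz, by rw [hz', hg0]⟩
    · left; left; right; exact ⟨hz, by rw [hz', hg1]⟩
    · left; right; exact ⟨hz, hg.2.mapsTo hz'⟩
    · right; exact ⟨hz, hg.2.mapsTo hz'⟩

/-- A disc whose boundary is split into four arcs is a product. -/
lemma quad [T2Space X] {F C e e' K1 K2 : Set X} {p q p' q' : X} {σ σ' : X → ℝ}
    (hF : IsDisc F C) (hCe : C = e ∪ e' ∪ K1 ∪ K2)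
    (hec : IsClosed e) (hec' : IsClosed e') (hd : e ∩ e' = ∅)
    (hσ : HomeoOn σ e (Icc 0 1)) (h0 : σ p = 0) (h1 : σ q = 1)
    (hσ' : HomeoOn σ' e' (Icc 0 1)) (h0' : σ' p' = 0) (h1' : σ' q' = 1)
    (hK1 : IsArc K1 p p') (hK2 : IsArc K2 q q')
    (he1 : e ∩ K1 = {p}) (he1' : e' ∩ K1 = {p'}) (he2 : e ∩ K2 = {q}) (he2' : e' ∩ K2 = {q'})
    (hK : K1 ∩ K2 = ∅) :
    ∃ g : X → ℝ × X, HomeoOn g F (Icc 0 1 ×ˢ K1) ∧ (∀ x ∈ e, g x = (σ x, p)) ∧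
      (∀ x ∈ e', g x = (σ' x, p')) := by
  have hne := hK1.ne
  have hD := isDisc_prod_arc hK1
  have hp : p ∈ K1 := hK1.2.1
  have hp' : p' ∈ K1 := hK1.2.2.1
  have : Nonempty X := ⟨p⟩
  obtain ⟨hc1, -, -, τ1, ht1, a0, a1⟩ := hK1
  obtain ⟨hc2, hq, hq', τ2, ht2, b0, b1⟩ := hK2
  obtain ⟨g1, hg1, hgt, -⟩ := ht1.symm hc1 ⟨p, hp⟩
  have hμ : HomeoOn (g1 ∘ τ2) K2 K1 := hg1.comp ht2
  have mu0 : g1 (τ2 q) = p := by rw [b0, ← a0, hgt p hp]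
  have mu1 : g1 (τ2 q') = p' := by rw [b1, ← a1, hgt p' hp']
  have inj : ∀ x ∈ e, σ x = 0 → x = p := fun x hx h =>
    hσ.2.injOn hx (he1.symm ▸ mem_singleton p : p ∈ e ∩ K1).1 (h.trans h0.symm)
  have m1 : HomeoOn (fun x => (σ x, p)) e (Icc (0:ℝ) 1 ×ˢ ({p} : Set X)) := by
    refine ⟨hσ.1.prodMk continuousOn_const, ?_, ?_, ?_⟩
    · intro x hx; exact ⟨hσ.2.mapsTo hx, rfl⟩
    · intro x hx y hy h
      exact hσ.2.injOn hx hy (congrArg Prod.fst h)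
    · rintro ⟨t, x⟩ ⟨ht, hx⟩
      obtain ⟨y, hy, rfl⟩ := hσ.2.surjOn ht
      exact ⟨y, hy, by rw [show x = p from hx]⟩
  have m2 : HomeoOn (fun x => (σ' x, p')) e' (Icc (0:ℝ) 1 ×ˢ ({p'} : Set X)) := by
    refine ⟨hσ'.1.prodMk continuousOn_const, ?_, ?_, ?_⟩
    · intro x hx; exact ⟨hσ'.2.mapsTo hx, rfl⟩
    · intro x hx y hy h
      exact hσ'.2.injOn hx hy (congrArg Prod.fst h)
    · rintro ⟨t, x⟩ ⟨ht, hx⟩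
      obtain ⟨y, hy, rfl⟩ := hσ'.2.surjOn ht
      exact ⟨y, hy, by rw [show x = p' from hx]⟩
  have m3 : HomeoOn (fun x => ((0:ℝ), x)) K1 (({0} : Set ℝ) ×ˢ K1) := by
    refine ⟨by fun_prop, ?_, ?_, ?_⟩
    · intro x hx; exact ⟨rfl, hx⟩
    · intro x hx y hy h; exact congrArg Prod.snd h
    · rintro ⟨t, x⟩ ⟨ht, hx⟩
      exact ⟨x, hx, by rw [show t = 0 from ht]⟩
  have m4 : HomeoOn (fun x => ((1:ℝ), g1 (τ2 x))) K2 (({1} : Set ℝ) ×ˢ K1) := by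
    refine ⟨continuousOn_const.prodMk hμ.1, ?_, ?_, ?_⟩
    · intro x hx; exact ⟨rfl, hμ.2.mapsTo hx⟩
    · intro x hx y hy h
      exact hμ.2.injOn hx hy (congrArg Prod.snd h)
    · rintro ⟨t, x⟩ ⟨ht, hx⟩
      obtain ⟨y, hy, hyx⟩ := hμ.2.surjOn hx
      exact ⟨y, hy, Prod.ext (show (1:ℝ) = t from (show t = 1 from ht).symm) hyx⟩
  have mem : p ∈ e ∩ K1 ∧ p' ∈ e' ∩ K1 ∧ q ∈ e ∩ K2 ∧ q' ∈ e' ∩ K2 := by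
    rw [he1, he1', he2, he2']; simp
  obtain ⟨⟨me1, -⟩, ⟨me2, -⟩, ⟨me3, -⟩, ⟨me4, -⟩⟩ := mem
  obtain ⟨φ, hφ, hφe, hφe'⟩ := paste_two hec hec' m1 m2 (by rw [hd]; simp) (by
    rintro ⟨t, x⟩ ⟨⟨-, hx⟩, ⟨-, hx'⟩⟩
    exact absurd ((show x = p from hx).symm.trans (show x = p' from hx')) hne)
  obtain ⟨ψ, hψ, hψe, hψ1⟩ := paste_two (hec.union hec') hc1.isClosed hφ m3 (by
    rintro x ⟨hx | hx, hx1⟩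
    · have : x = p := by rw [← mem_singleton_iff, ← he1]; exact ⟨hx, hx1⟩
      subst this
      rw [hφe hx]; simp [h0]
    · have : x = p' := by rw [← mem_singleton_iff, ← he1']; exact ⟨hx, hx1⟩
      subst this
      rw [hφe' hx]; simp [h0']) (by
    rintro ⟨t, x⟩ ⟨⟨-, hx⟩ | ⟨-, hx⟩, ⟨ht, -⟩⟩
    · refine ⟨p, ⟨Or.inl me1, hp⟩, ?_⟩
      rw [hφe me1]
      exact Prod.ext (h0.trans (show t = 0 from ht).symm) (show x = p from hx).symm
    · refine ⟨p', ⟨Or.inr me2, hp'⟩, ?_⟩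
      rw [hφe' me2]
      exact Prod.ext (h0'.trans (show t = 0 from ht).symm) (show x = p' from hx).symm)
  obtain ⟨χ, hχ, hχe, hχ2⟩ := paste_two ((hec.union hec').union hc1.isClosed) hc2.isClosed hψ m4 (by
    rintro x ⟨(hx | hx) | hx, hx1⟩
    · have : x = q := by rw [← mem_singleton_iff, ← he2]; exact ⟨hx, hx1⟩
      subst this
      rw [hψe (Or.inl hx), hφe hx]; simp only [h1, mu0]
    · have : x = q' := by rw [← mem_singleton_iff, ← he2']; exact ⟨hx, hx1⟩
      subst this
      rw [hψe (Or.inr hx), hφe' hx]; simp only [h1', mu1]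
    · have : x ∈ K1 ∩ K2 := ⟨hx, hx1⟩
      rw [hK] at this; exact absurd this (notMem_empty x)) (by
    rintro ⟨t, x⟩ ⟨(⟨-, hx⟩ | ⟨-, hx⟩) | ⟨ht', -⟩, ⟨ht, -⟩⟩
    · refine ⟨q, ⟨Or.inl (Or.inl me3), hq⟩, ?_⟩
      rw [hψe (Or.inl me3), hφe me3]
      exact Prod.ext (h1.trans (show t = 1 from ht).symm) (show x = p from hx).symm
    · refine ⟨q', ⟨Or.inl (Or.inr me4), hq'⟩, ?_⟩
      rw [hψe (Or.inr me4), hφe' me4]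
      exact Prod.ext (h1'.trans (show t = 1 from ht).symm) (show x = p' from hx).symm
    · exact absurd ((show t = 0 from ht').symm.trans (show t = 1 from ht)) zero_ne_one)
  rw [← hCe] at hχ
  obtain ⟨f, hf, hfχ⟩ := hF.extend_between hD hχ
  refine ⟨f, hf, ?_, ?_⟩
  · intro x hx
    rw [hfχ (by rw [hCe]; exact Or.inl (Or.inl (Or.inl hx))), hχe (Or.inl (Or.inl hx)),
      hψe (Or.inl hx), hφe hx]
  · intro x hx
    rw [hfχ (by rw [hCe]; exact Or.inl (Or.inl (Or.inr hx))), hχe (Or.inl (Or.inr hx)),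
      hψe (Or.inr hx), hφe' hx]

end topology4

section hrep

/-- One variable elimination. -/
lemma elim_one {ι : Type*} [Finite ι] (α c : ι → ℝ) :
    (∃ t : ℝ, ∀ i, α i ≤ t * c i) ↔
      (∀ i, c i = 0 → α i ≤ 0) ∧ ∀ i j, 0 < c i → c j < 0 → α i * (-c j) + α j * c i ≤ 0 := by
  classical
  have := Fintype.ofFinite ι
  constructor
  · rintro ⟨t, ht⟩
    refine ⟨fun i hi => by simpa [hi] using ht i, fun i j hi hj => ?_⟩
    nlinarith [ht i, ht j]
  · rintro ⟨h0, h1⟩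
    by_cases hp : (Finset.univ.filter (fun i => 0 < c i)).Nonempty
    · obtain ⟨m, hm, hmax⟩ := Finset.exists_max_image _ (fun i => α i / c i) hp
      simp only [Finset.mem_filter, Finset.mem_univ, true_and] at hm hmax
      refine ⟨α m / c m, fun i => ?_⟩
      rcases lt_trichotomy (c i) 0 with h | h | h
      · have := h1 m i hm h
        rw [div_mul_eq_mul_div, le_div_iff₀ hm]
        linarith
      · rw [h, mul_zero]; exact h0 i h
      · have := hmax i h
        rwa [div_le_iff₀ h] at this
    · by_cases hn : (Finset.univ.filter (fun i => c i < 0)).Nonempty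
      · obtain ⟨m, hm, hmin⟩ := Finset.exists_min_image _ (fun i => α i / c i) hn
        simp only [Finset.mem_filter, Finset.mem_univ, true_and] at hm hmin
        refine ⟨α m / c m, fun i => ?_⟩
        rcases lt_trichotomy (c i) 0 with h | h | h
        · have := hmin i h
          rwa [le_div_iff_of_neg h] at this
        · rw [h, mul_zero]; exact h0 i h
        · exact absurd ⟨i, by simp [h]⟩ hp
      · refine ⟨0, fun i => ?_⟩
        rcases lt_trichotomy (c i) 0 with h | h | h
        · exact absurd ⟨i, by simp [h]⟩ hn
        · rw [zero_mul]; exact h0 i h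
        · exact absurd ⟨i, by simp [h]⟩ hp

abbrev Hs := (E3 →ₗ[ℝ] ℝ) × ℝ

def IsPolyh (S : Set E3) : Prop :=
  ∃ (ι : Type) (_ : Finite ι) (c : ι → Hs), S = {x | ∀ i, (c i).1 x ≤ (c i).2}

lemma isPolyh_singleton (v : E3) : IsPolyh {v} := by
  refine ⟨Fin 3 × Bool, inferInstance, fun i => cond i.2
    ((EuclideanSpace.proj (𝕜 := ℝ) i.1 : E3 →L[ℝ] ℝ).toLinearMap, v i.1)
    (-(EuclideanSpace.proj (𝕜 := ℝ) i.1 : E3 →L[ℝ] ℝ).toLinearMap, - v i.1), ?_⟩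
  ext x
  simp only [mem_singleton_iff, mem_ofPred_eq]
  constructor
  · rintro rfl ⟨i, _ | _⟩ <;> simp
  · intro h
    ext i
    have h1 := h (i, true)
    have h2 := h (i, false)
    simp at h1 h2
    exact le_antisymm h1 h2

lemma isPolyh_insert {S : Set E3} (hS : IsPolyh S) (hne : S.Nonempty) (hb : Bornology.IsBounded S)
    (v : E3) : IsPolyh (convexJoin ℝ {v} S) := by
  obtain ⟨ι, hι, c, rfl⟩ := hS
  -- constraints: `f (x - v) ≤ t (b - f v)`, `0 ≤ t`, `-1 ≤ -t`
  set C : ι ⊕ Bool → ℝ := Sum.elim (fun i => (c i).2 - (c i).1 v) (fun b => cond b 1 (-1)) with hC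
  set A : E3 → ι ⊕ Bool → ℝ := fun x => Sum.elim (fun i => (c i).1 (x - v))
    (fun b => cond b 0 (-1)) with hA
  have key : ∀ x, x ∈ convexJoin ℝ {v} {x | ∀ i, (c i).1 x ≤ (c i).2} ↔
      ∃ t : ℝ, ∀ i, A x i ≤ t * C i := by
    intro x
    rw [mem_convexJoin]
    simp only [mem_singleton_iff, exists_eq_left, mem_ofPred_eq]
    constructor
    · rintro ⟨y, hy, a, t, ha, ht, hat, rfl⟩
      refine ⟨t, ?_⟩
      have e : a • v + t • y - v = t • (y - v) := by
        have : a = 1 - t := by linarith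
        rw [this]; module
      rintro (i | _ | _)
      · simp only [hA, hC, Sum.elim_inl]
        rw [e, map_smul, smul_eq_mul, map_sub]
        exact mul_le_mul_of_nonneg_left (by linarith [hy i]) ht
      · simp [hA, hC]; linarith
      · simp [hA, hC]; linarith
    · rintro ⟨t, ht⟩
      have t0 : 0 ≤ t := by simpa [hA, hC] using ht (Sum.inr true)
      have t1 : t ≤ 1 := by simpa [hA, hC] using ht (Sum.inr false)
      have hi : ∀ i, (c i).1 (x - v) ≤ t * ((c i).2 - (c i).1 v) := fun i => ht (Sum.inl i)
      rcases t0.eq_or_lt with h | h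
      · obtain ⟨y, hy⟩ := hne
        refine ⟨y, hy, ?_⟩
        have hxv : x = v := by
          by_contra hxv
          have hd : 0 < ‖x - v‖ := norm_pos_iff.2 (sub_ne_zero.2 hxv)
          obtain ⟨M, hM⟩ := hb.exists_norm_le
          have hn : ∀ n : ℕ, y + (n:ℝ) • (x - v) ∈ {x | ∀ i, (c i).1 x ≤ (c i).2} := by
            intro n i
            rw [map_add, map_smul, smul_eq_mul]
            have h1 := hi i
            rw [← h, zero_mul] at h1
            nlinarith [hy i, (Nat.cast_nonneg n : (0:ℝ) ≤ n)]
          obtain ⟨n, hn'⟩ := exists_nat_gt ((M + ‖y‖) / ‖x - v‖)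
          rw [div_lt_iff₀ hd] at hn'
          have h2 := hM _ (hn n)
          have h3 : ‖(n:ℝ) • (x - v)‖ ≤ ‖y + (n:ℝ) • (x - v)‖ + ‖y‖ := by
            have := norm_sub_le (y + (n:ℝ) • (x - v)) y
            simpa using this
          rw [norm_smul, Real.norm_natCast] at h3
          linarith
        rw [hxv]
        exact left_mem_segment ℝ v y
      · refine ⟨v + t⁻¹ • (x - v), ?_, ?_⟩
        · intro i
          rw [map_add, map_smul, smul_eq_mul]
          have := mul_le_mul_of_nonneg_left (hi i) (inv_nonneg.2 h.le)
          rw [inv_mul_cancel_left₀ h.ne'] at this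
          linarith
        · refine ⟨1 - t, t, by linarith, h.le, by ring, ?_⟩
          rw [smul_add, smul_inv_smul₀ h.ne']
          module
  have hfin : Finite (ι ⊕ Bool) := inferInstance
  have hlin : ∀ i, ∃ (f : E3 →ₗ[ℝ] ℝ) (b : ℝ), ∀ x, A x i = f x - b := by
    rintro (i | _ | _)
    · exact ⟨(c i).1, (c i).1 v, fun x => by simp [hA]⟩
    · exact ⟨0, 1, fun x => by simp [hA]⟩
    · exact ⟨0, 0, fun x => by simp [hA]⟩
  choose f b hfb using hlin
  classical
  refine ⟨(ι ⊕ Bool) ⊕ ((ι ⊕ Bool) × (ι ⊕ Bool)), inferInstance,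
    Sum.elim (fun i => if C i = 0 then (f i, b i) else (0, 0))
      (fun p => if 0 < C p.1 ∧ C p.2 < 0 then ((-C p.2) • f p.1 + C p.1 • f p.2,
        (-C p.2) * b p.1 + C p.1 * b p.2) else (0, 0)), ?_⟩
  ext x
  rw [key, elim_one]
  rw [mem_ofPred_eq]
  refine Iff.trans ?_ Sum.forall.symm
  simp only [Sum.elim_inl, Sum.elim_inr, Prod.forall]
  constructor
  · rintro ⟨h1, h2⟩
    constructor
    · intro i
      split_ifs with h
      · have := h1 i h
        rw [hfb] at this
        simpa using this
      · simp
    · intro i j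
      split_ifs with h
      · have := h2 i j h.1 h.2
        rw [hfb, hfb] at this
        simp only [LinearMap.add_apply, LinearMap.smul_apply, smul_eq_mul]
        nlinarith
      · simp
  · rintro ⟨h1, h2⟩
    constructor
    · intro i h
      have := h1 i
      rw [if_pos h] at this
      rw [hfb]
      simpa using this
    · intro i j hi hj
      have := h2 i j
      rw [if_pos ⟨hi, hj⟩] at this
      simp only [LinearMap.add_apply, LinearMap.smul_apply, smul_eq_mul] at this
      rw [hfb, hfb]
      nlinarith

lemma isPolyh_convexHull (V : Finset E3) (hV : V.Nonempty) :
    IsPolyh (convexHull ℝ (V : Set E3)) := by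
  classical
  induction hV using Finset.Nonempty.cons_induction with
  | singleton a => simpa using isPolyh_singleton a
  | cons a s ha hs ih =>
    rw [Finset.coe_cons, convexHull_insert (by simpa using hs)]
    exact isPolyh_insert ih (by simpa using hs)
      ((isBounded_convexHull).2 s.finite_toSet.isBounded) a

/-- An irredundant representation by half spaces. -/
lemma exists_irred {P : Set E3} (h : IsPolyh P) :
    ∃ s : Finset Hs, P = {x | ∀ c ∈ s, c.1 x ≤ c.2} ∧
      ∀ c ∈ s, ∃ z : E3, c.2 < c.1 z ∧ ∀ d ∈ s, d ≠ c → d.1 z ≤ d.2 := by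
  classical
  obtain ⟨ι, hι, c, hc⟩ := h
  have := Fintype.ofFinite ι
  have hex : ∃ n, ∃ s : Finset Hs, s.card = n ∧ P = {x | ∀ c ∈ s, c.1 x ≤ c.2} :=
    ⟨_, Finset.univ.image c, rfl, by rw [hc]; simp⟩
  obtain ⟨s, hs, hP⟩ := Nat.find_spec hex
  refine ⟨s, hP, fun c hcs => ?_⟩
  by_contra hcon
  push Not at hcon
  refine Nat.find_min hex (m := (s.erase c).card) ?_ ⟨s.erase c, rfl, ?_⟩
  · rw [← hs]; exact Finset.card_erase_lt_of_mem hcs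
  · rw [hP]
    ext x
    simp only [mem_ofPred_eq, Finset.mem_erase]
    constructor
    · intro h d hd; exact h d hd.2
    · intro h d hd
      by_cases hdc : d = c
      · subst hdc
        by_contra hlt
        obtain ⟨e, he, hec, hee⟩ := hcon x (not_le.1 hlt)
        exact absurd (h e ⟨hec, he⟩) (not_le.2 hee)
      · exact h d ⟨hdc, hd⟩

end hrep

section geom

structure HR (P : Set E3) (s : Finset Hs) : Prop where
  mem : ∀ x, x ∈ P ↔ ∀ c ∈ s, c.1 x ≤ c.2
  irr : ∀ c ∈ s, ∃ z : E3, c.2 < c.1 z ∧ ∀ d ∈ s, d ≠ c → d.1 z ≤ d.2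
  cpt : IsCompact P
  cvx : Convex ℝ P
  int : (interior P).Nonempty

/-- The smallest face containing `x`. -/
def Fc (P : Set E3) (s : Finset Hs) (x : E3) : Set E3 :=
  {y | y ∈ P ∧ ∀ c ∈ s, c.1 x = c.2 → c.1 y = c.2}

/-- Its direction. -/
def Dr (s : Finset Hs) (x : E3) : Submodule ℝ E3 where
  carrier := {d | ∀ c ∈ s, c.1 x = c.2 → c.1 d = 0}
  zero_mem' := by intro c _ _; simp
  add_mem' := by
    intro a b ha hb c hc h
    rw [map_add, ha c hc h, hb c hc h, add_zero]
  smul_mem' := by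
    intro r a ha c hc h
    rw [map_smul, ha c hc h, smul_zero]

lemma mem_Dr {s : Finset Hs} {x d : E3} : d ∈ Dr s x ↔ ∀ c ∈ s, c.1 x = c.2 → c.1 d = 0 := Iff.rfl

def Fh (P : Set E3) (c : Hs) : Set E3 := {x | x ∈ P ∧ c.1 x = c.2}

lemma lin_cont (f : E3 →ₗ[ℝ] ℝ) : Continuous f := f.continuous_of_finiteDimensional

variable {P : Set E3} {s : Finset Hs}

lemma wiggle (s : Finset Hs) (x d : E3) : ∀ᶠ t in nhds (0:ℝ), ∀ c ∈ s, c.1 x < c.2 →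
    c.1 (x + t • d) < c.2 := by
  rw [Filter.eventually_all_finset]
  intro c _
  by_cases h : c.1 x < c.2
  · have hc : Continuous (fun t : ℝ => c.1 (x + t • d)) := (lin_cont c.1).comp (by fun_prop)
    have : ∀ᶠ t in nhds (0:ℝ), c.1 (x + t • d) < c.2 :=
      hc.continuousAt.eventually_lt continuousAt_const (by simpa using h)
    filter_upwards [this] with t ht _ using ht
  · filter_upwards with t ht using absurd ht h

/-- Moving in a direction of `Dr`. -/
lemma HR.move (h : HR P s) {x d : E3} (hx : x ∈ P) (hd : d ∈ Dr s x) :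
    ∃ ε > (0:ℝ), x + ε • d ∈ Fc P s x ∧ x - ε • d ∈ Fc P s x := by
  obtain ⟨ε, hε, hb⟩ := Metric.eventually_nhds_iff.1 (wiggle s x d)
  have key : ∀ t : ℝ, |t| < ε → x + t • d ∈ Fc P s x := by
    intro t ht
    have := hb (y := t) (by simpa using ht)
    refine ⟨(h.mem _).2 fun c hc => ?_, fun c hc hcx => by
      rw [map_add, map_smul, hd c hc hcx]; simpa using hcx⟩
    rcases ((h.mem x).1 hx c hc).lt_or_eq with h1 | h1
    · exact (this c hc h1).le
    · rw [map_add, map_smul, hd c hc h1]; simpa using h1.le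
  refine ⟨ε / 2, by positivity, key _ ?_, ?_⟩
  · rw [abs_of_pos (by positivity)]; linarith
  · rw [sub_eq_add_neg, ← neg_smul]
    apply key
    rw [abs_neg, abs_of_pos (by positivity)]; linarith

lemma Fc_self {x : E3} (hx : x ∈ P) : x ∈ Fc P s x := ⟨hx, fun _ _ h => h⟩

lemma HR.isClosed_Fc (h : HR P s) (x : E3) : IsClosed (Fc P s x) := by
  have : Fc P s x = P ∩ ⋂ c ∈ s, ⋂ (_ : c.1 x = c.2), {y | c.1 y = c.2} := by
    ext y; simp [Fc]
  rw [this]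
  refine h.cpt.isClosed.inter (isClosed_biInter fun c _ => isClosed_iInter fun _ => ?_)
  exact isClosed_eq (lin_cont c.1) continuous_const

lemma HR.isFace_Fc (h : HR P s) {x : E3} (hx : x ∈ P) : IsFaceOf (Fc P s x) P := by
  refine ⟨⟨x, Fc_self hx⟩, h.isClosed_Fc x, ?_, ?_⟩
  · intro y hy z hz a b ha hb hab
    refine ⟨h.cvx hy.1 hz.1 ha hb hab, fun c hc hcx => ?_⟩
    rw [map_add, map_smul, map_smul, hy.2 c hc hcx, hz.2 c hc hcx, smul_eq_mul, smul_eq_mul,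
      ← add_mul, hab, one_mul]
  · constructor
    · intro y hy; exact hy.1
    · rintro y hy z hz w hw ⟨a, b, ha, hb, hab, rfl⟩
      refine ⟨hy, fun c hc hcx => ?_⟩
      have h1 := hw.2 c hc hcx
      rw [map_add, map_smul, map_smul, smul_eq_mul, smul_eq_mul] at h1
      have h2 := (h.mem y).1 hy c hc
      have h3 := (h.mem z).1 hz c hc
      apply le_antisymm h2
      by_contra hlt
      push Not at hlt
      have : a * c.1 y + b * c.1 z < a * c.2 + b * c.2 := by nlinarith
      rw [← add_mul, hab, one_mul] at this
      linarith

lemma intrinsic_extend {F : Set E3} {x y : E3} (hx : x ∈ intrinsicInterior ℝ F) (hy : y ∈ F) :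
    ∃ ε > (0:ℝ), x - ε • (y - x) ∈ F := by
  obtain ⟨x', hx', rfl⟩ := mem_intrinsicInterior.1 hx
  let γ : ℝ → affineSpan ℝ F := fun t => ⟨AffineMap.lineMap (x' : E3) y t,
    AffineMap.lineMap_mem t x'.2 (subset_affineSpan ℝ F hy)⟩
  have hγ : Continuous γ := by
    apply Continuous.subtype_mk
    exact AffineMap.lineMap_continuous
  have h0 : γ 0 = x' := by apply Subtype.ext; simp [γ]
  have h1 : ∀ᶠ t in nhds (0:ℝ), γ t ∈ ((↑) ⁻¹' F : Set (affineSpan ℝ F)) := by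
    apply hγ.continuousAt.eventually_mem
    rw [h0]
    exact mem_interior_iff_mem_nhds.1 hx'
  obtain ⟨ε, hε, hb⟩ := Metric.eventually_nhds_iff.1 h1
  have := hb (y := -(ε/2)) (by simp [abs_of_pos hε]; linarith)
  refine ⟨ε/2, by positivity, ?_⟩
  have e : ((γ (-(ε/2)) : affineSpan ℝ F) : E3) = (x' : E3) - (ε/2) • (y - x') := by
    simp only [γ, AffineMap.lineMap_apply, vsub_eq_sub, vadd_eq_add]
    rw [neg_smul]; abel
  rw [← e]; exact this

lemma HR.face_eq (h : HR P s) {F : Set E3} (hF : IsFaceOf F P) {x : E3}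
    (hx : x ∈ intrinsicInterior ℝ F) : F = Fc P s x := by
  obtain ⟨-, -, -, hFP, hext⟩ := hF
  have hxF : x ∈ F := intrinsicInterior_subset hx
  apply Subset.antisymm
  · intro y hy
    refine ⟨hFP hy, fun c hc hcx => ?_⟩
    obtain ⟨ε, hε, hm⟩ := intrinsic_extend hx hy
    have h1 := (h.mem _).1 (hFP hm) c hc
    have h2 := (h.mem _).1 (hFP hy) c hc
    rw [map_sub, map_smul, map_sub, smul_eq_mul] at h1
    nlinarith
  · intro y hy
    have hd : y - x ∈ Dr s x := by
      intro c hc hcx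
      rw [map_sub, hcx, hy.2 c hc hcx, sub_self]
    obtain ⟨ε, hε, -, hm⟩ := h.move (hFP hxF) hd
    refine hext hy.1 hm.1 hxF ⟨ε / (1 + ε), 1 / (1 + ε), by positivity, by positivity,
      by field_simp; ring, ?_⟩
    have : (1 + ε) ≠ 0 := by positivity
    apply smul_right_injective E3 this
    simp only [smul_add, smul_smul]
    rw [mul_div_cancel₀ _ this, mul_div_cancel₀ _ this]
    module

lemma HR.vectorSpan_Fc (h : HR P s) {x : E3} (hx : x ∈ P) :
    vectorSpan ℝ (Fc P s x) = Dr s x := by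
  apply le_antisymm
  · rw [vectorSpan, Submodule.span_le]
    rintro _ ⟨y, hy, z, hz, rfl⟩
    intro c hc hcx
    show c.1 (y - z) = 0
    rw [map_sub, hy.2 c hc hcx, hz.2 c hc hcx, sub_self]
  · intro d hd
    obtain ⟨ε, hε, hm, -⟩ := h.move hx hd
    have := vsub_mem_vectorSpan ℝ hm (Fc_self (s := s) hx)
    rw [vsub_eq_sub, add_sub_cancel_left] at this
    have h2 := (vectorSpan ℝ (Fc P s x)).smul_mem ε⁻¹ this
    rwa [inv_smul_smul₀ hε.ne'] at h2

lemma HR.ne_zero (h : HR P s) {c : Hs} (hc : c ∈ s) : c.1 ≠ 0 := by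
  intro h0
  obtain ⟨z, hz, -⟩ := h.irr c hc
  obtain ⟨o, ho⟩ := h.int
  have := (h.mem o).1 (interior_subset ho) c hc
  rw [h0] at hz this
  simp at hz this
  linarith

lemma HR.interior_iff (h : HR P s) {x : E3} : x ∈ interior P ↔ ∀ c ∈ s, c.1 x < c.2 := by
  constructor
  · intro hx c hc
    obtain ⟨d, hd⟩ : ∃ d, 0 < c.1 d := by
      have h0 := h.ne_zero hc
      obtain ⟨d, hd⟩ : ∃ d, c.1 d ≠ 0 := by
        by_contra hcon
        push Not at hcon
        exact h0 (LinearMap.ext hcon)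
      rcases lt_or_gt_of_ne hd with h | h
      · exact ⟨-d, by rw [map_neg]; linarith⟩
      · exact ⟨d, h⟩
    have hcont : Continuous (fun t : ℝ => x + t • d) := by fun_prop
    have h1 : ∀ᶠ t in nhds (0:ℝ), x + t • d ∈ P := by
      apply hcont.continuousAt.eventually_mem
      simpa using mem_interior_iff_mem_nhds.1 hx
    obtain ⟨ε, hε, hb⟩ := Metric.eventually_nhds_iff.1 h1
    have := hb (y := ε/2) (by simp [abs_of_pos hε]; exact hε)
    have h2 := (h.mem _).1 this c hc
    rw [map_add, map_smul, smul_eq_mul] at h2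
    nlinarith
  · intro hx
    have ho : IsOpen (⋂ c ∈ s, {y : E3 | c.1 y < c.2}) :=
      isOpen_biInter_finset fun c _ => isOpen_lt (lin_cont c.1) continuous_const
    refine mem_interior.2 ⟨_, ?_, ho, by simpa using hx⟩
    intro y hy
    simp only [mem_iInter, mem_ofPred_eq] at hy
    exact (h.mem y).2 fun c hc => (hy c hc).le

lemma HR.frontier_iff (h : HR P s) {x : E3} : x ∈ frontier P ↔ x ∈ P ∧ ∃ c ∈ s, c.1 x = c.2 := by
  rw [frontier, h.cpt.isClosed.closure_eq, mem_sdiff, h.interior_iff]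
  constructor
  · rintro ⟨hx, hn⟩
    push Not at hn
    obtain ⟨c, hc, hle⟩ := hn
    exact ⟨hx, c, hc, le_antisymm ((h.mem x).1 hx c hc) hle⟩
  · rintro ⟨hx, c, hc, he⟩
    exact ⟨hx, fun hn => (hn c hc).ne he⟩

/-- A point on exactly one facet. -/
lemma HR.only (h : HR P s) {c : Hs} (hc : c ∈ s) :
    ∃ y ∈ P, c.1 y = c.2 ∧ ∀ d ∈ s, d ≠ c → d.1 y < d.2 := by
  obtain ⟨z, hz, hz'⟩ := h.irr c hc
  obtain ⟨o, ho⟩ := h.int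
  rw [h.interior_iff] at ho
  have hoc := ho c hc
  set r := (c.2 - c.1 o) / (c.1 z - c.1 o) with hr
  have hpos : 0 < c.1 z - c.1 o := by linarith
  have r0 : 0 < r := div_pos (by linarith) hpos
  have r1 : r < 1 := (div_lt_one hpos).2 (by linarith)
  have hrr : r * (c.1 z - c.1 o) = c.2 - c.1 o := div_mul_cancel₀ _ hpos.ne'
  have e1 : c.1 (o + r • (z - o)) = c.2 := by
    rw [map_add, map_smul, map_sub, smul_eq_mul, hrr]; ring
  have e2 : ∀ d ∈ s, d ≠ c → d.1 (o + r • (z - o)) < d.2 := by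
    intro d hd hdc
    rw [map_add, map_smul, map_sub, smul_eq_mul]
    nlinarith [ho d hd, hz' d hd hdc]
  refine ⟨o + r • (z - o), (h.mem _).2 fun d hd => ?_, e1, e2⟩
  by_cases hdc : d = c
  · rw [hdc, e1]
  · exact (e2 d hd hdc).le

lemma HR.Fh_eq (h : HR P s) {c : Hs} (hc : c ∈ s) {y : E3} (hy : c.1 y = c.2)
    (hy' : ∀ d ∈ s, d ≠ c → d.1 y < d.2) : Fh P c = Fc P s y ∧ Dr s y = LinearMap.ker c.1 := by
  have : ∀ d ∈ s, d.1 y = d.2 → d = c := by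
    intro d hd h
    by_contra hdc
    exact (hy' d hd hdc).ne h
  constructor
  · ext x
    constructor
    · rintro ⟨hx, hcx⟩
      exact ⟨hx, fun d hd hdy => by rw [this d hd hdy]; exact hcx⟩
    · rintro ⟨hx, hx'⟩
      exact ⟨hx, hx' c hc hy⟩
  · ext d
    rw [LinearMap.mem_ker]
    constructor
    · intro hd; exact hd c hc hy
    · intro hd e he hey
      rw [this e he hey]; exact hd

lemma finrank_ker {f : E3 →ₗ[ℝ] ℝ} (hf : f ≠ 0) : Module.finrank ℝ (LinearMap.ker f) = 2 := by
  have h1 := f.finrank_range_add_finrank_ker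
  have h2 : Module.finrank ℝ (LinearMap.range f) = 1 := by
    rw [LinearMap.range_eq_top.2 (LinearMap.surjective hf)]
    simp
  simp at h1
  omega

lemma HR.facet_Fh (h : HR P s) {c : Hs} (hc : c ∈ s) : IsFacetOf (Fh P c) P := by
  obtain ⟨y, hy, h1, h2⟩ := h.only hc
  obtain ⟨e1, e2⟩ := h.Fh_eq hc h1 h2
  refine ⟨e1 ▸ h.isFace_Fc hy, ?_⟩
  rw [setDim, e1, h.vectorSpan_Fc hy, e2]
  exact finrank_ker (h.ne_zero hc)

lemma HR.Fh_inj (h : HR P s) {c d : Hs} (hc : c ∈ s) (hd : d ∈ s) (he : Fh P c = Fh P d) :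
    c = d := by
  obtain ⟨y, hy, h1, h2⟩ := h.only hc
  have : y ∈ Fh P d := he ▸ ⟨hy, h1⟩
  by_contra hcd
  exact (h2 d hd (Ne.symm hcd)).ne this.2

lemma IsFaceOf.exists_int {F : Set E3} (hF : IsFaceOf F P) : (intrinsicInterior ℝ F).Nonempty :=
  Set.Nonempty.intrinsicInterior hF.2.2.1 hF.1

lemma HR.facet_eq (h : HR P s) {F : Set E3} (hF : IsFacetOf F P) : ∃ c ∈ s, F = Fh P c := by
  obtain ⟨x, hx⟩ := hF.1.exists_int
  have hxP : x ∈ P := hF.1.2.2.2.1 (intrinsicInterior_subset hx)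
  have e := h.face_eq hF.1 hx
  have hdim := hF.2
  rw [setDim, e, h.vectorSpan_Fc hxP] at hdim
  obtain ⟨c, hc, hcx⟩ : ∃ c ∈ s, c.1 x = c.2 := by
    by_contra hcon
    push Not at hcon
    have : Dr s x = ⊤ := by
      rw [eq_top_iff]
      intro d _ c hc hcx
      exact absurd hcx (hcon c hc)
    rw [this] at hdim
    simp at hdim
  have hle : Dr s x ≤ LinearMap.ker c.1 := fun d hd => hd c hc hcx
  have heq : Dr s x = LinearMap.ker c.1 :=
    Submodule.eq_of_le_of_finrank_eq hle (by rw [hdim, finrank_ker (h.ne_zero hc)])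
  refine ⟨c, hc, ?_⟩
  rw [e]
  apply Subset.antisymm
  · rintro y ⟨hy, hy'⟩; exact ⟨hy, hy' c hc hcx⟩
  · rintro y ⟨hy, hy'⟩
    refine ⟨hy, ?_⟩
    have hd : y - x ∈ Dr s x := by
      rw [heq, LinearMap.mem_ker, map_sub, hy', hcx, sub_self]
    intro d hd' hdx
    have := hd d hd' hdx
    rw [map_sub, hdx] at this
    linarith

lemma HR.intrinsic_not_mem (h : HR P s) {F G : Set E3} (hF : IsFacetOf F P) (hG : IsFacetOf G P)
    (hFG : F ≠ G) {x : E3} (hx : x ∈ intrinsicInterior ℝ F) : x ∉ G := by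
  intro hxG
  obtain ⟨c, hc, rfl⟩ := h.facet_eq hF
  obtain ⟨d, hd, rfl⟩ := h.facet_eq hG
  have e := h.face_eq hF.1 hx
  obtain ⟨y, hy, h1, h2⟩ := h.only hc
  have hy' : y ∈ Fc P s x := e ▸ ⟨hy, h1⟩
  have hdc : d ≠ c := by rintro rfl; exact hFG rfl
  exact (h2 d hd hdc).ne (hy'.2 d hd hxG.2)

lemma exists_HR (hP : IsSimplePolytope3 P) : ∃ s, HR P s := by
  obtain ⟨⟨V, rfl⟩, hdim, -⟩ := hP
  have hV : V.Nonempty := by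
    rw [Finset.nonempty_iff_ne_empty]
    rintro rfl
    rw [setDim, Finset.coe_empty, convexHull_empty, vectorSpan_empty] at hdim
    simp at hdim
  obtain ⟨s, hs, hirr⟩ := exists_irred (isPolyh_convexHull V hV)
  refine ⟨s, fun x => ?_, hirr, V.finite_toSet.isCompact_convexHull ℝ, convex_convexHull ℝ _, ?_⟩
  · conv_lhs => rw [hs]
    rfl
  · rw [(convex_convexHull ℝ _).interior_nonempty_iff_affineSpan_eq_top]
    rw [AffineSubspace.affineSpan_eq_top_iff_vectorSpan_eq_top_of_nonempty (k := ℝ) (V := E3) (P := E3)]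
    · apply Submodule.eq_top_of_finrank_eq
      rw [setDim] at hdim
      rw [hdim]; simp
    · simpa using hV

end geom

section geom3

variable {P : Set E3} {s : Finset Hs}

structure Tri (s : Finset Hs) (v : E3) (c d e : Hs) : Prop where
  hc : c ∈ s
  hd : d ∈ s
  he : e ∈ s
  hcd : c ≠ d
  hce : c ≠ e
  hde : d ≠ e
  tc : c.1 v = c.2
  td : d.1 v = d.2
  te : e.1 v = e.2
  all : ∀ x ∈ s, x.1 v = x.2 → x = c ∨ x = d ∨ x = e

lemma HR.vert_Dr (h : HR P s) {v : E3} (hv : IsVertexOf v P) : Dr s v = ⊥ := by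
  have hvP : v ∈ P := hv.2.2.2.1 rfl
  have e := h.face_eq hv (x := v) (by rw [intrinsicInterior_singleton]; rfl)
  rw [← h.vectorSpan_Fc hvP, ← e, vectorSpan_singleton]

lemma HR.vert_of_Dr (h : HR P s) {v : E3} (hv : v ∈ P) (hD : Dr s v = ⊥) : IsVertexOf v P := by
  have : Fc P s v = {v} := by
    apply Subset.antisymm
    · intro y hy
      have hd : y - v ∈ Dr s v := by
        intro c hc hcx
        rw [map_sub, hcx, hy.2 c hc hcx, sub_self]
      rw [hD, Submodule.mem_bot, sub_eq_zero] at hd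
      exact hd
    · rintro _ rfl; exact Fc_self hv
  rw [IsVertexOf, ← this]
  exact h.isFace_Fc hv

lemma HR.vert_tight (h : HR P s) (hP : IsSimplePolytope3 P) {v : E3} (hv : IsVertexOf v P) :
    ∃ c d e, Tri s v c d e := by
  have hvP : v ∈ P := hv.2.2.2.1 rfl
  have h3 := hP.2.2 v hv
  have e1 : {F | IsFacetOf F P ∧ v ∈ F} = Fh P '' {c | c ∈ s ∧ c.1 v = c.2} := by
    ext F
    constructor
    · rintro ⟨hF, hvF⟩
      obtain ⟨c, hc, rfl⟩ := h.facet_eq hF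
      exact ⟨c, ⟨hc, hvF.2⟩, rfl⟩
    · rintro ⟨c, ⟨hc, hcv⟩, rfl⟩
      exact ⟨h.facet_Fh hc, hvP, hcv⟩
  rw [e1, ncard_image_of_injOn (fun a ha b hb hab => h.Fh_inj ha.1 hb.1 hab),
    Set.ncard_eq_three] at h3
  obtain ⟨c, d, e, h1, h2, h3, heq⟩ := h3
  have hc : c ∈ {c | c ∈ s ∧ c.1 v = c.2} := by rw [heq]; simp
  have hd : d ∈ {c | c ∈ s ∧ c.1 v = c.2} := by rw [heq]; simp
  have he : e ∈ {c | c ∈ s ∧ c.1 v = c.2} := by rw [heq]; simp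
  refine ⟨c, d, e, hc.1, hd.1, he.1, h1, h2, h3, hc.2, hd.2, he.2, fun x hx hxv => ?_⟩
  have : x ∈ {c | c ∈ s ∧ c.1 v = c.2} := ⟨hx, hxv⟩
  rw [heq] at this
  simpa using this

lemma HR.tri_of_two (h : HR P s) (hP : IsSimplePolytope3 P) {v : E3} (hv : IsVertexOf v P)
    {c d : Hs} (hc : c ∈ s) (hd : d ∈ s) (hcd : c ≠ d) (tc : c.1 v = c.2) (td : d.1 v = d.2) :
    ∃ e, Tri s v c d e := by
  obtain ⟨a, b, e, T⟩ := h.vert_tight hP hv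
  have sw : ∀ {a b e : Hs}, Tri s v a b e → Tri s v b a e := fun T =>
    ⟨T.hd, T.hc, T.he, T.hcd.symm, T.hde, T.hce, T.td, T.tc, T.te,
      fun x hx hx' => by have := T.all x hx hx'; tauto⟩
  have sw' : ∀ {a b e : Hs}, Tri s v a b e → Tri s v a e b := fun T =>
    ⟨T.hc, T.he, T.hd, T.hce, T.hcd, T.hde.symm, T.tc, T.te, T.td,
      fun x hx hx' => by have := T.all x hx hx'; tauto⟩
  have h1 : ∃ b e, Tri s v c b e := by
    rcases T.all c hc tc with rfl | rfl | rfl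
    · exact ⟨_, _, T⟩
    · exact ⟨_, _, sw T⟩
    · exact ⟨_, _, sw (sw' T)⟩
  obtain ⟨b, e, T⟩ := h1
  rcases T.all d hd td with rfl | rfl | rfl
  · exact absurd rfl hcd
  · exact ⟨_, T⟩
  · exact ⟨_, sw' T⟩

lemma HR.tri_of_three (h : HR P s) (hP : IsSimplePolytope3 P) {v : E3} (hv : IsVertexOf v P)
    {c d e : Hs} (hc : c ∈ s) (hd : d ∈ s) (he : e ∈ s) (hcd : c ≠ d) (hce : c ≠ e) (hde : d ≠ e)
    (tc : c.1 v = c.2) (td : d.1 v = d.2) (te : e.1 v = e.2) : Tri s v c d e := by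
  obtain ⟨e', T⟩ := h.tri_of_two hP hv hc hd hcd tc td
  rcases T.all e he te with rfl | rfl | rfl
  · exact absurd rfl hce
  · exact absurd rfl hde
  · exact T

lemma HR.tri_inj (h : HR P s) {v : E3} (hv : IsVertexOf v P) {c d e : Hs} (T : Tri s v c d e)
    {y : E3} (h1 : c.1 y = 0) (h2 : d.1 y = 0) (h3 : e.1 y = 0) : y = 0 := by
  have : y ∈ Dr s v := by
    intro x hx hx'
    rcases T.all x hx hx' with rfl | rfl | rfl <;> assumption
  rwa [h.vert_Dr hv, Submodule.mem_bot] at this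

lemma HR.tri_surj (h : HR P s) {v : E3} (hv : IsVertexOf v P) {c d e : Hs} (T : Tri s v c d e) :
    ∃ y : E3, c.1 y = 0 ∧ d.1 y = 0 ∧ e.1 y = -1 := by
  let L : E3 →ₗ[ℝ] (ℝ × ℝ × ℝ) := c.1.prod (d.1.prod e.1)
  have hL : Function.Injective L := by
    rw [← LinearMap.ker_eq_bot, LinearMap.ker_eq_bot']
    intro y hy
    simp only [L, LinearMap.prod_apply, Pi.prod] at hy
    have h1 := congrArg Prod.fst hy
    have h2 := congrArg (fun z => z.2.1) hy
    have h3 := congrArg (fun z => z.2.2) hy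
    exact h.tri_inj hv T h1 h2 h3
  rw [LinearMap.injective_iff_surjective_of_finrank_eq_finrank (by simp)] at hL
  obtain ⟨y, hy⟩ := hL (0, 0, -1)
  simp only [L, LinearMap.prod_apply, Pi.prod] at hy
  exact ⟨y, congrArg Prod.fst hy, congrArg (fun z => z.2.1) hy, congrArg (fun z => z.2.2) hy⟩

lemma IsVertexOf.iff_extreme {v : E3} : IsVertexOf v P ↔ v ∈ P.extremePoints ℝ := by
  rw [← isExtreme_singleton]
  exact ⟨fun h => h.2.2.2, fun h => ⟨singleton_nonempty _, isClosed_singleton,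
    convex_singleton _, h⟩⟩

lemma HR.exists_vertex (h : HR P s) {x : E3} (hx : x ∈ P) : ∃ v, IsVertexOf v P ∧ v ∈ Fc P s x := by
  have hc : IsCompact (Fc P s x) := h.cpt.of_isClosed_subset (h.isClosed_Fc x) fun y hy => hy.1
  obtain ⟨v, hv⟩ := hc.extremePoints_nonempty ⟨x, Fc_self hx⟩
  exact ⟨v, IsVertexOf.iff_extreme.2
    ((h.isFace_Fc hx).2.2.2.extremePoints_subset_extremePoints hv), hv.1⟩

lemma HR.triple (h : HR P s) (hP : IsSimplePolytope3 P) {x : E3} (hx : x ∈ P)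
    {c d e : Hs} (hc : c ∈ s) (hd : d ∈ s) (he : e ∈ s) (hcd : c ≠ d) (hce : c ≠ e) (hde : d ≠ e)
    (tc : c.1 x = c.2) (td : d.1 x = d.2) (te : e.1 x = e.2) : IsVertexOf x P := by
  obtain ⟨v, hv, hv'⟩ := h.exists_vertex hx
  have T := h.tri_of_three hP hv hc hd he hcd hce hde (hv'.2 c hc tc) (hv'.2 d hd td) (hv'.2 e he te)
  have : x - v = 0 := h.tri_inj hv T (by rw [map_sub, tc, T.tc, sub_self])
    (by rw [map_sub, td, T.td, sub_self]) (by rw [map_sub, te, T.te, sub_self])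
  rw [sub_eq_zero.1 this]; exact hv

lemma HR.edge (h : HR P s) (hP : IsSimplePolytope3 P) {c d : Hs} (hc : c ∈ s) (hd : d ∈ s)
    (hcd : c ≠ d) (hne : (Fh P c ∩ Fh P d).Nonempty) :
    IsEdgeOf (Fh P c ∩ Fh P d) P ∧ ∃ v w, IsVertexOf v P ∧ IsVertexOf w P ∧ v ≠ w ∧
      Fh P c ∩ Fh P d = segment ℝ v w := by
  obtain ⟨x, ⟨hx, tcx⟩, -, tdx⟩ := hne
  obtain ⟨v, hv, hv'⟩ := h.exists_vertex hx
  obtain ⟨e, T⟩ := h.tri_of_two hP hv hc hd hcd (hv'.2 c hc tcx) (hv'.2 d hd tdx)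
  obtain ⟨u, u1, u2, u3⟩ := h.tri_surj hv T
  have hu0 : u ≠ 0 := by rintro rfl; simp at u3
  have hvP : v ∈ P := hv'.1
  -- a point tight for exactly c, d
  obtain ⟨ε, hε, hw⟩ := Metric.eventually_nhds_iff.1 (wiggle s v u)
  have hw := hw (y := ε/2) (by simp [abs_of_pos hε]; exact hε)
  set m := v + (ε/2) • u with hm
  have mc : c.1 m = c.2 := by rw [hm, map_add, map_smul, u1, T.tc]; simp
  have md : d.1 m = d.2 := by rw [hm, map_add, map_smul, u2, T.td]; simp
  have me : e.1 m < e.2 := by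
    rw [hm, map_add, map_smul, u3, T.te, smul_eq_mul]; linarith
  have mo : ∀ a ∈ s, a ≠ c → a ≠ d → a.1 m < a.2 := by
    intro a ha hac had
    rcases ((h.mem v).1 hvP a ha).lt_or_eq with h1 | h1
    · exact hw a ha h1
    · rcases T.all a ha h1 with rfl | rfl | rfl
      · exact absurd rfl hac
      · exact absurd rfl had
      · exact me
  have hmP : m ∈ P := (h.mem m).2 fun a ha => by
    by_cases hac : a = c
    · rw [hac, mc]
    by_cases had : a = d
    · rw [had, md]
    exact (mo a ha hac had).le
  have mt : ∀ a ∈ s, a.1 m = a.2 → a = c ∨ a = d := by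
    intro a ha h1
    by_contra hcon
    push Not at hcon
    exact (mo a ha hcon.1 hcon.2).ne h1
  have hFc : Fh P c ∩ Fh P d = Fc P s m := by
    ext y
    constructor
    · rintro ⟨⟨hy, h1⟩, -, h2⟩
      refine ⟨hy, fun a ha h3 => ?_⟩
      rcases mt a ha h3 with rfl | rfl <;> assumption
    · rintro ⟨hy, h1⟩
      exact ⟨⟨hy, h1 c hc mc⟩, hy, h1 d hd md⟩
  have hDr : Dr s m = Submodule.span ℝ {u} := by
    apply le_antisymm
    · intro y hy
      have y1 := hy c hc mc
      have y2 := hy d hd md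
      have : y + (e.1 y) • u = 0 := h.tri_inj hv T (by simp [y1, u1]) (by simp [y2, u2])
        (by simp [u3])
      rw [Submodule.mem_span_singleton]
      exact ⟨-(e.1 y), by rw [neg_smul]; exact (eq_neg_of_add_eq_zero_left this).symm⟩
    · rw [Submodule.span_singleton_le_iff_mem]
      intro a ha h3
      rcases mt a ha h3 with rfl | rfl <;> assumption
  refine ⟨⟨hFc ▸ h.isFace_Fc hmP, ?_⟩, ?_⟩
  · rw [setDim, hFc, h.vectorSpan_Fc hmP, hDr, finrank_span_singleton hu0]
  -- the other end
  have hcpt : IsCompact (Fh P c ∩ Fh P d) := by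
    rw [hFc]; exact h.cpt.of_isClosed_subset (h.isClosed_Fc m) fun y hy => hy.1
  have hvm : v ∈ Fh P c ∩ Fh P d := ⟨⟨hvP, T.tc⟩, hvP, T.td⟩
  have hmm : m ∈ Fh P c ∩ Fh P d := ⟨⟨hmP, mc⟩, hmP, md⟩
  obtain ⟨w, hwm, hmin⟩ := hcpt.exists_isMinOn ⟨v, hvm⟩ (lin_cont e.1).continuousOn
  have par : ∀ y ∈ Fh P c ∩ Fh P d, y = v + (e.2 - e.1 y) • u := by
    rintro y ⟨⟨hy, y1⟩, -, y2⟩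
    have : y - (v + (e.2 - e.1 y) • u) = 0 := h.tri_inj hv T
      (by simp [u1, y1, T.tc]) (by simp [u2, y2, T.td]) (by simp [u3, T.te])
    exact sub_eq_zero.1 this
  have hwe : e.1 w < e.2 := lt_of_le_of_lt (hmin hmm) me
  have hwv : v ≠ w := by rintro rfl; exact hwe.ne T.te
  have hwV : IsVertexOf w P := by
    by_cases h3 : ∃ a ∈ s, a ≠ c ∧ a ≠ d ∧ a.1 w = a.2
    · obtain ⟨a, ha, hac, had, hat⟩ := h3
      exact h.triple hP hwm.1.1 hc hd ha hcd hac.symm had.symm hwm.1.2 hwm.2.2 hat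
    · exfalso
      push Not at h3
      have hu : u ∈ Dr s w := by
        intro a ha hat
        by_cases hac : a = c
        · rw [hac, u1]
        by_cases had : a = d
        · rw [had, u2]
        exact absurd hat (h3 a ha hac had)
      obtain ⟨δ, hδ, hδ1, -⟩ := h.move hwm.1.1 hu
      have := hmin (a := w + δ • u) ⟨⟨hδ1.1, hδ1.2 c hc hwm.1.2⟩, hδ1.1, hδ1.2 d hd hwm.2.2⟩
      simp only [map_add, map_smul, u3, smul_eq_mul, mem_ofPred_eq] at this
      linarith
  refine ⟨v, w, hv, hwV, hwv, ?_⟩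
  apply Subset.antisymm
  · intro y hy
    rw [segment_eq_image']
    have pw := par w hwm
    have py := par y hy
    have hle := hmin hy
    have hye : e.1 y ≤ e.2 := (h.mem y).1 hy.1.1 e T.he
    simp only [mem_ofPred_eq] at hle
    have hpos : 0 < e.2 - e.1 w := by linarith
    refine ⟨(e.2 - e.1 y) / (e.2 - e.1 w), ⟨div_nonneg (by linarith) hpos.le,
      (div_le_one hpos).2 (by linarith)⟩, ?_⟩
    show v + ((e.2 - e.1 y) / (e.2 - e.1 w)) • (w - v) = y
    have : w - v = (e.2 - e.1 w) • u := by
      nth_rewrite 1 [pw]; rw [add_sub_cancel_left]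
    rw [this, smul_smul, div_mul_cancel₀ _ hpos.ne', ← py]
  · rw [hFc]
    exact (h.isFace_Fc hmP).2.2.1.segment_subset (hFc ▸ hvm) (hFc ▸ hwm)

lemma vertex_segment {u v w : E3} (hu : IsVertexOf u P) (hv : v ∈ P) (hw : w ∈ P)
    (h : u ∈ segment ℝ v w) : u = v ∨ u = w := by
  by_cases h1 : u = v
  · exact Or.inl h1
  by_cases h2 : u = w
  · exact Or.inr h2
  have := hu.2.2.2.2 hv hw rfl (mem_openSegment_of_ne_left_right (Ne.symm h1) (Ne.symm h2) h)
  exact Or.inl this.symm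

lemma HR.sweep (h : HR P s) (hP : IsSimplePolytope3 P) {v w1 w2 : E3} (hv : IsVertexOf v P)
    {c d e : Hs} (T : Tri s v c d e) (h1 : w1 ∈ Fh P c ∩ Fh P d) (h2 : w2 ∈ Fh P c ∩ Fh P e)
    (hw1 : w1 ≠ v) (hw2 : w2 ≠ v) (g : E3 →ₗ[ℝ] ℝ) (hg1 : g w1 ≤ g v) (hg2 : g w2 ≤ g v)
    {y : E3} (hy : y ∈ Fh P c) : g y ≤ g v := by
  have e1 : e.1 w1 < e.2 := by
    refine lt_of_le_of_ne ((h.mem _).1 h1.1.1 e T.he) fun hh => hw1 ?_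
    exact sub_eq_zero.1 (h.tri_inj hv T (by rw [map_sub, h1.1.2, T.tc, sub_self])
      (by rw [map_sub, h1.2.2, T.td, sub_self]) (by rw [map_sub, hh, T.te, sub_self]))
  have e2 : d.1 w2 < d.2 := by
    refine lt_of_le_of_ne ((h.mem _).1 h2.1.1 d T.hd) fun hh => hw2 ?_
    exact sub_eq_zero.1 (h.tri_inj hv T (by rw [map_sub, h2.1.2, T.tc, sub_self])
      (by rw [map_sub, hh, T.td, sub_self]) (by rw [map_sub, h2.2.2, T.te, sub_self]))
  have ye := (h.mem _).1 hy.1 e T.he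
  have yd := (h.mem _).1 hy.1 d T.hd
  set α := (e.2 - e.1 y) / (e.2 - e.1 w1) with hα
  set β := (d.2 - d.1 y) / (d.2 - d.1 w2) with hβ
  have p1 : 0 < e.2 - e.1 w1 := by linarith
  have p2 : 0 < d.2 - d.1 w2 := by linarith
  have a0 : 0 ≤ α := div_nonneg (by linarith) p1.le
  have b0 : 0 ≤ β := div_nonneg (by linarith) p2.le
  have a1 : α * (e.2 - e.1 w1) = e.2 - e.1 y := div_mul_cancel₀ _ p1.ne'
  have b1 : β * (d.2 - d.1 w2) = d.2 - d.1 y := div_mul_cancel₀ _ p2.ne'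
  have key : (y - v) - (α • (w1 - v) + β • (w2 - v)) = 0 := by
    apply h.tri_inj hv T
    · simp [hy.2, T.tc, h1.1.2, h2.1.2]
    · simp only [map_sub, map_add, map_smul, smul_eq_mul, h1.2.2, T.td]
      linarith
    · simp only [map_sub, map_add, map_smul, smul_eq_mul, h2.2.2, T.te]
      linarith
  have := congrArg g key
  simp only [map_sub, map_add, map_smul, smul_eq_mul, map_zero] at this
  nlinarith

lemma HR.disc (h : HR P s) {c : Hs} (hc : c ∈ s) :
    IsDisc (Fh P c) {x | x ∈ Fh P c ∧ ∃ d ∈ s, d ≠ c ∧ d.1 x = d.2} := by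
  obtain ⟨y, hy, yc, yd⟩ := h.only hc
  have hfr : Module.finrank ℝ ℂ = Module.finrank ℝ (LinearMap.ker c.1) := by
    rw [finrank_ker (h.ne_zero hc), Complex.finrank_real_complex]
  let ψ := LinearEquiv.ofFinrankEq ℂ (LinearMap.ker c.1) hfr
  let ι : ℂ → E3 := fun z => y + (ψ z : E3)
  have hψ : Continuous (fun z : ℂ => (ψ z : E3)) :=
    ((LinearMap.ker c.1).subtype.comp ψ.toLinearMap).continuous_of_finiteDimensional
  have hι : Continuous ι := continuous_const.add hψ
  have hcι : ∀ z, c.1 (ι z) = c.2 := by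
    intro z
    simp only [ι, map_add, yc]
    have : c.1 (ψ z : E3) = 0 := (ψ z).2
    rw [this, add_zero]
  have inj : Function.Injective ι := by
    intro a b hab
    have : (ψ a : E3) = ψ b := add_left_cancel hab
    exact ψ.injective (Subtype.ext this)
  have ex : ∀ x, c.1 x = c.2 → ∃ z, ι z = x := by
    intro x hx
    refine ⟨ψ.symm ⟨x - y, by rw [LinearMap.mem_ker, map_sub, hx, yc, sub_self]⟩, ?_⟩
    simp [ι]
  set K : Set ℂ := ι ⁻¹' P with hK
  have memK : ∀ z, z ∈ K ↔ ∀ d ∈ s, d ≠ c → d.1 (ι z) ≤ d.2 := by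
    intro z
    rw [hK, mem_preimage, h.mem]
    refine ⟨fun hh d hd _ => hh d hd, fun hh d hd => ?_⟩
    by_cases hdc : d = c
    · rw [hdc, hcι]
    · exact hh d hd hdc
  have him : ι '' K = Fh P c := by
    ext x
    constructor
    · rintro ⟨z, hz, rfl⟩; exact ⟨hz, hcι z⟩
    · rintro ⟨hx, hx'⟩
      obtain ⟨z, rfl⟩ := ex x hx'
      exact ⟨z, hx, rfl⟩
  have hclK : IsClosed K := h.cpt.isClosed.preimage hι
  have h_intr : ∀ z, z ∈ interior K ↔ ∀ d ∈ s, d ≠ c → d.1 (ι z) < d.2 := by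
    intro z
    constructor
    · intro hz d hd hdc
      have hle := (memK z).1 (interior_subset hz) d hd hdc
      refine lt_of_le_of_ne hle fun heq => ?_
      have hcont : Continuous (fun t : ℝ => z + t • z) := by fun_prop
      have h1 : ∀ᶠ t in nhds (0:ℝ), z + t • z ∈ K := by
        apply hcont.continuousAt.eventually_mem
        simpa using mem_interior_iff_mem_nhds.1 hz
      obtain ⟨ε, hε, hb⟩ := Metric.eventually_nhds_iff.1 h1
      have := hb (y := ε/2) (by simp [abs_of_pos hε]; exact hε)
      have h2 := (memK _).1 this d hd hdc
      have h3 : ι (z + (ε/2) • z) = ι z + (ε/2) • (ι z - y) := by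
        simp only [ι, map_add, map_smul, Submodule.coe_add, Submodule.coe_smul]
        module
      rw [h3, map_add, map_smul, map_sub, heq, smul_eq_mul] at h2
      nlinarith [yd d hd hdc]
    · intro hz
      have ho : IsOpen (⋂ d ∈ s, ⋂ (_ : d ≠ c), {z : ℂ | d.1 (ι z) < d.2}) :=
        isOpen_biInter_finset fun d _ => isOpen_iInter_of_finite fun _ =>
          isOpen_lt ((lin_cont d.1).comp hι) continuous_const
      refine mem_interior.2 ⟨_, ?_, ho, by simpa using hz⟩
      intro w hw
      simp only [mem_iInter, mem_ofPred_eq] at hw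
      exact (memK w).2 fun d hd hdc => (hw d hd hdc).le
  have hcptK : IsCompact K := by
    have hcl : Topology.IsClosedEmbedding (fun z : ℂ => (ψ z : E3)) :=
      (LinearMap.isClosedEmbedding_of_injective
        (f := (LinearMap.ker c.1).subtype.comp ψ.toLinearMap)
        (LinearMap.ker_eq_bot.2 (fun a b hab => ψ.injective (Subtype.ext hab))))
    have : IsCompact ((fun x => x - y) '' P) := h.cpt.image (by fun_prop)
    have h2 := hcl.isCompact_preimage this
    convert h2 using 1
    ext z
    simp only [hK, mem_preimage, mem_image, ι]
    constructor
    · intro hz; exact ⟨_, hz, by simp⟩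
    · rintro ⟨x, hx, hxz⟩
      rw [← hxz]; simpa using hx
  have hconvK : Convex ℝ K := by
    intro a ha b hb p q hp hq hpq
    have : ι (p • a + q • b) = p • ι a + q • ι b := by
      simp only [ι, map_add, map_smul, Submodule.coe_add, Submodule.coe_smul, smul_add]
      have : y = p • y + q • y := by rw [← add_smul, hpq, one_smul]
      nth_rewrite 1 [this]
      abel
    rw [hK, mem_preimage, this]
    exact h.cvx ha hb hp hq hpq
  have h0 : (0:ℂ) ∈ interior K := by
    rw [h_intr]
    intro d hd hdc
    simpa [ι] using yd d hd hdc
  have D := (isDisc_convex hcptK hconvK ⟨0, h0⟩).image (ι := ι) (B := Fh P c)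
    ⟨hι.continuousOn, him ▸ inj.injOn.bijOn_image⟩
  convert D using 1
  ext x
  rw [frontier, hclK.closure_eq]
  constructor
  · rintro ⟨hx, d, hd, hdc, hdx⟩
    rw [← him] at hx
    obtain ⟨z, hz, rfl⟩ := hx
    exact ⟨z, ⟨hz, fun hz' => ((h_intr z).1 hz' d hd hdc).ne hdx⟩, rfl⟩
  · rintro ⟨z, ⟨hz, hz'⟩, rfl⟩
    refine ⟨him ▸ ⟨z, hz, rfl⟩, ?_⟩
    rw [h_intr] at hz'
    push Not at hz'
    obtain ⟨d, hd, hdc, hle⟩ := hz'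
    exact ⟨d, hd, hdc, le_antisymm ((memK z).1 hz d hd hdc) hle⟩

/-- The combinatorial-topological interface. -/
structure SG (Φ : Set (Set E3)) (V : Set E3) : Prop where
  finΦ : Φ.Finite
  finV : V.Finite
  disc : ∀ F ∈ Φ, IsDisc F (F ∩ ⋃₀ (Φ \ {F}))
  conn : IsConnected (⋃₀ Φ)
  vert : ∀ v ∈ V, ∃ F ∈ Φ, ∃ G ∈ Φ, ∃ H ∈ Φ, F ≠ G ∧ F ≠ H ∧ G ≠ H ∧ v ∈ F ∧ v ∈ G ∧ v ∈ H ∧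
    ∀ K ∈ Φ, v ∈ K → K = F ∨ K = G ∨ K = H
  triple : ∀ F ∈ Φ, ∀ G ∈ Φ, ∀ H ∈ Φ, F ≠ G → F ≠ H → G ≠ H → ∀ x, x ∈ F → x ∈ G → x ∈ H → x ∈ V
  edge : ∀ F ∈ Φ, ∀ G ∈ Φ, F ≠ G → (F ∩ G).Nonempty → ∃ v ∈ V, ∃ w ∈ V, v ≠ w ∧
    F ∩ G = segment ℝ v w ∧ ∀ u ∈ V, u ∈ F ∩ G → u = v ∨ u = w
  sweep : ∀ v ∈ V, ∀ F ∈ Φ, ∀ G ∈ Φ, ∀ H ∈ Φ, F ≠ G → F ≠ H → G ≠ H → v ∈ F → v ∈ G → v ∈ H →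
    ∀ w1 ∈ F ∩ G, ∀ w2 ∈ F ∩ H, w1 ≠ v → w2 ≠ v → ∀ g : E3 →ₗ[ℝ] ℝ, g w1 ≤ g v → g w2 ≤ g v →
    ∀ y ∈ F, g y ≤ g v

lemma IsFacetOf.compact (h : HR P s) {F : Set E3} (hF : IsFacetOf F P) : IsCompact F :=
  h.cpt.of_isClosed_subset hF.1.2.1 hF.1.2.2.2.1

lemma HR.frontier_eq (h : HR P s) : frontier P = ⋃₀ facets P := by
  ext x
  rw [h.frontier_iff]
  constructor
  · rintro ⟨hx, c, hc, hcx⟩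
    exact ⟨_, h.facet_Fh hc, hx, hcx⟩
  · rintro ⟨F, hF, hx⟩
    obtain ⟨c, hc, rfl⟩ := h.facet_eq hF
    exact ⟨hx.1, c, hc, hx.2⟩

lemma HR.sg (h : HR P s) (hP : IsSimplePolytope3 P) : SG (facets P) {v | IsVertexOf v P} := by
  refine ⟨?_, ?_, ?_, ?_, ?_, ?_, ?_, ?_⟩
  · apply (s.finite_toSet.image (Fh P)).subset
    intro F hF
    obtain ⟨c, hc, rfl⟩ := h.facet_eq hF
    exact ⟨c, hc, rfl⟩
  · obtain ⟨⟨V, hV⟩, -⟩ := hP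
    apply V.finite_toSet.subset
    intro v hv
    have := IsVertexOf.iff_extreme.1 hv
    rw [hV] at this
    exact extremePoints_convexHull_subset this
  · intro F hF
    obtain ⟨c, hc, rfl⟩ := h.facet_eq hF
    convert h.disc hc using 1
    ext x
    constructor
    · rintro ⟨hx, G, ⟨hG, hne⟩, hxG⟩
      obtain ⟨d, hd, rfl⟩ := h.facet_eq hG
      exact ⟨hx, d, hd, by rintro rfl; exact hne rfl, hxG.2⟩
    · rintro ⟨hx, d, hd, hdc, hdx⟩
      exact ⟨hx, Fh P d, ⟨h.facet_Fh hd, fun hh => hdc (h.Fh_inj hd hc hh)⟩, hx.1, hdx⟩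
  · rw [← h.frontier_eq]
    obtain ⟨f, -, -, hf⟩ := exists_homeomorph_image_interior_closure_frontier_eq_unitBall h.cvx
      h.int h.cpt.isBounded
    have hs : IsConnected (Metric.sphere (0:E3) 1) :=
      isConnected_sphere (by rw [← Module.finrank_eq_rank]; simp) 0 zero_le_one
    have := hs.image f.symm f.symm.continuous.continuousOn
    rw [← hf, ← image_comp] at this
    simpa using this
  · intro v hv
    obtain ⟨c, d, e, T⟩ := h.vert_tight hP hv
    have hvP : v ∈ P := hv.2.2.2.1 rfl
    refine ⟨_, h.facet_Fh T.hc, _, h.facet_Fh T.hd, _, h.facet_Fh T.he,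
      fun hh => T.hcd (h.Fh_inj T.hc T.hd hh), fun hh => T.hce (h.Fh_inj T.hc T.he hh),
      fun hh => T.hde (h.Fh_inj T.hd T.he hh), ⟨hvP, T.tc⟩, ⟨hvP, T.td⟩, ⟨hvP, T.te⟩, ?_⟩
    intro K hK hvK
    obtain ⟨x, hx, rfl⟩ := h.facet_eq hK
    rcases T.all x hx hvK.2 with rfl | rfl | rfl <;> simp
  · intro F hF G hG H hH h1 h2 h3 x xF xG xH
    obtain ⟨c, hc, rfl⟩ := h.facet_eq hF
    obtain ⟨d, hd, rfl⟩ := h.facet_eq hG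
    obtain ⟨e, he, rfl⟩ := h.facet_eq hH
    exact h.triple hP xF.1 hc hd he (by rintro rfl; exact h1 rfl) (by rintro rfl; exact h2 rfl)
      (by rintro rfl; exact h3 rfl) xF.2 xG.2 xH.2
  · intro F hF G hG h1 hne
    obtain ⟨c, hc, rfl⟩ := h.facet_eq hF
    obtain ⟨d, hd, rfl⟩ := h.facet_eq hG
    obtain ⟨-, v, w, hv, hw, hvw, heq⟩ := h.edge hP hc hd (by rintro rfl; exact h1 rfl) hne
    refine ⟨v, hv, w, hw, hvw, heq, fun u hu huF => ?_⟩
    rw [heq] at huF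
    exact vertex_segment hu (hv.2.2.2.1 rfl) (hw.2.2.2.1 rfl) huF
  · intro v hv F hF G hG H hH h1 h2 h3 vF vG vH w1 hw1 w2 hw2 n1 n2 g g1 g2 y hy
    obtain ⟨c, hc, rfl⟩ := h.facet_eq hF
    obtain ⟨d, hd, rfl⟩ := h.facet_eq hG
    obtain ⟨e, he, rfl⟩ := h.facet_eq hH
    exact h.sweep hP hv (h.tri_of_three hP hv hc hd he (by rintro rfl; exact h1 rfl)
      (by rintro rfl; exact h2 rfl) (by rintro rfl; exact h3 rfl) vF.2 vG.2 vH.2)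
      hw1 hw2 n1 n2 g g1 g2 hy

lemma HR.isEdge (h : HR P s) (hP : IsSimplePolytope3 P) {F G : Set E3} (hF : IsFacetOf F P)
    (hG : IsFacetOf G P) (hFG : F ≠ G) (hne : (F ∩ G).Nonempty) : IsEdgeOf (F ∩ G) P := by
  obtain ⟨c, hc, rfl⟩ := h.facet_eq hF
  obtain ⟨d, hd, rfl⟩ := h.facet_eq hG
  exact (h.edge hP hc hd (by rintro rfl; exact hFG rfl) hne).1

end geom3

section comb

open Classical in
/-- The cochain supported on one edge. -/
def ed (F0 G0 F G : Set E3) : ZMod 2 := if (F = F0 ∧ G = G0) ∨ (F = G0 ∧ G = F0) then 1 else 0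

/-- `z` is a cocycle at vertices with prescribed coboundary. -/
def HasCob (Φ : Set (Set E3)) (V : Set E3) (z : Set E3 → Set E3 → ZMod 2) (g : E3 → ZMod 2) : Prop :=
  (∀ F G, z F G = z G F) ∧ ∀ v ∈ V, ∀ F ∈ Φ, ∀ G ∈ Φ, ∀ H ∈ Φ, F ≠ G → F ≠ H → G ≠ H →
    v ∈ F → v ∈ G → v ∈ H → z F G + z G H + z F H = g v

variable {Φ : Set (Set E3)} {V : Set E3}

lemma HasCob.add {z z' : Set E3 → Set E3 → ZMod 2} {g g' : E3 → ZMod 2} (h : HasCob Φ V z g)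
    (h' : HasCob Φ V z' g') : HasCob Φ V (fun F G => z F G + z' F G) (fun v => g v + g' v) := by
  refine ⟨fun F G => by show z F G + z' F G = z G F + z' G F; rw [h.1, h'.1],
    fun v hv F hF G hG H hH h1 h2 h3 a b c => ?_⟩
  show _ = g v + g' v
  rw [← h.2 v hv F hF G hG H hH h1 h2 h3 a b c, ← h'.2 v hv F hF G hG H hH h1 h2 h3 a b c]
  ring

lemma HasCob.zero : HasCob Φ V (fun _ _ => 0) (fun _ => 0) := by
  refine ⟨fun F G => rfl, fun v hv F hF G hG H hH h1 h2 h3 a b c => by simp⟩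

lemma HasCob.smul {z : Set E3 → Set E3 → ZMod 2} {g : E3 → ZMod 2} (h : HasCob Φ V z g)
    (a : ZMod 2) : HasCob Φ V (fun F G => a * z F G) (fun v => a * g v) := by
  refine ⟨fun F G => by show a * z F G = a * z G F; rw [h.1],
    fun v hv F hF G hG H hH h1 h2 h3 p q r => ?_⟩
  show _ = a * g v
  rw [← h.2 v hv F hF G hG H hH h1 h2 h3 p q r]
  ring

lemma HasCob.sum {ι : Type*} (s : Finset ι) {z : ι → Set E3 → Set E3 → ZMod 2}
    {g : ι → E3 → ZMod 2} (h : ∀ i ∈ s, HasCob Φ V (z i) (g i)) :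
    HasCob Φ V (fun F G => ∑ i ∈ s, z i F G) (fun v => ∑ i ∈ s, g i v) := by
  classical
  induction s using Finset.induction_on with
  | empty => simpa using HasCob.zero
  | insert a s ha ih =>
    simp only [Finset.sum_insert ha]
    exact (h a (by simp)).add (ih fun i hi => h i (by simp [hi]))

lemma HasCob.congr {z : Set E3 → Set E3 → ZMod 2} {g g' : E3 → ZMod 2} (h : HasCob Φ V z g)
    (hg : ∀ v ∈ V, g v = g' v) : HasCob Φ V z g' :=
  ⟨h.1, fun v hv F hF G hG H hH h1 h2 h3 a b c => by
    rw [h.2 v hv F hF G hG H hH h1 h2 h3 a b c, hg v hv]⟩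

lemma SG.vert3 (h : SG Φ V) {x : E3} (hx : x ∈ V) {F G H : Set E3} (hF : F ∈ Φ) (hG : G ∈ Φ)
    (hH : H ∈ Φ) (h1 : F ≠ G) (h2 : F ≠ H) (h3 : G ≠ H) (xF : x ∈ F) (xG : x ∈ G) (xH : x ∈ H)
    {K : Set E3} (hK : K ∈ Φ) (xK : x ∈ K) : K = F ∨ K = G ∨ K = H := by
  obtain ⟨A, -, B, -, C, -, -, -, -, -, -, -, hall⟩ := h.vert x hx
  have a := hall F hF xF
  have b := hall G hG xG
  have c := hall H hH xH
  have d := hall K hK xK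
  grind

/-- Two facets through a vertex have a third one. -/
lemma SG.third (h : SG Φ V) {x : E3} (hx : x ∈ V) {F G : Set E3} (hF : F ∈ Φ) (hG : G ∈ Φ)
    (h1 : F ≠ G) (xF : x ∈ F) (xG : x ∈ G) : ∃ H ∈ Φ, F ≠ H ∧ G ≠ H ∧ x ∈ H := by
  obtain ⟨A, hA, B, hB, C, hC, n1, n2, n3, xA, xB, xC, hall⟩ := h.vert x hx
  have a := hall F hF xF
  have b := hall G hG xG
  have m1 := n1.symm
  have m2 := n2.symm
  have m3 := n3.symm
  rcases a with rfl | rfl | rfl <;> rcases b with rfl | rfl | rfl <;>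
    first
    | exact absurd rfl h1
    | exact ⟨A, hA, by assumption, by assumption, xA⟩
    | exact ⟨B, hB, by assumption, by assumption, xB⟩
    | exact ⟨C, hC, by assumption, by assumption, xC⟩
    | exact ⟨_, hA, by assumption, by assumption, xA⟩
    | exact ⟨_, hB, by assumption, by assumption, xB⟩
    | exact ⟨_, hC, by assumption, by assumption, xC⟩

lemma SG.ed_cob (h : SG Φ V) {F0 G0 : Set E3} (hF0 : F0 ∈ Φ) (hG0 : G0 ∈ Φ) (hne : F0 ≠ G0) :
    HasCob Φ V (ed F0 G0) (open Classical in fun v => if v ∈ F0 ∩ G0 then 1 else 0) := by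
  classical
  constructor
  · intro F G
    unfold ed
    congr 1
    grind
  · intro v hv F hF G hG H hH h1 h2 h3 vF vG vH
    by_cases hv0 : v ∈ F0 ∩ G0
    · have a := h.vert3 hv hF hG hH h1 h2 h3 vF vG vH hF0 hv0.1
      have b := h.vert3 hv hF hG hH h1 h2 h3 vF vG vH hG0 hv0.2
      simp only [hv0, if_true, ed]
      rcases a with rfl | rfl | rfl <;> rcases b with rfl | rfl | rfl <;>
        simp_all [ne_comm, eq_comm]
    · simp only [hv0, if_false, ed]
      have a : ¬ ((F = F0 ∧ G = G0) ∨ (F = G0 ∧ G = F0)) := by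
        rintro (⟨rfl, rfl⟩ | ⟨rfl, rfl⟩)
        · exact hv0 ⟨vF, vG⟩
        · exact hv0 ⟨vG, vF⟩
      have b : ¬ ((G = F0 ∧ H = G0) ∨ (G = G0 ∧ H = F0)) := by
        rintro (⟨rfl, rfl⟩ | ⟨rfl, rfl⟩)
        · exact hv0 ⟨vG, vH⟩
        · exact hv0 ⟨vH, vG⟩
      have c : ¬ ((F = F0 ∧ H = G0) ∨ (F = G0 ∧ H = F0)) := by
        rintro (⟨rfl, rfl⟩ | ⟨rfl, rfl⟩)
        · exact hv0 ⟨vF, vH⟩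
        · exact hv0 ⟨vH, vF⟩
      rw [if_neg a, if_neg b, if_neg c]; simp

lemma zmod2_cases (a : ZMod 2) : a = 0 ∨ a = 1 := by
  revert a; decide

/-- Cocycles are coboundaries. -/
lemma SG.lemmaJ (h : SG Φ V) {z : Set E3 → Set E3 → ZMod 2} (hz : HasCob Φ V z (fun _ => 0)) :
    ∃ T : Set E3 → ZMod 2, ∀ F ∈ Φ, ∀ G ∈ Φ, F ≠ G → (F ∩ G).Nonempty → z F G = T F + T G := by
  classical
  -- a generic functional
  obtain ⟨f, hf⟩ : ∃ f : E3 →ₗ[ℝ] ℝ, ∀ v ∈ V, ∀ w ∈ V, v ≠ w → f v ≠ f w := by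
    have := h.finV.to_subtype
    obtain ⟨f, hf⟩ := Module.exists_dual_forall_apply_ne_zero (K := ℝ)
      (fun p : {p : V × V // p.1 ≠ p.2} => ((p.1.1 : E3) - p.1.2 : E3))
      (fun p => sub_ne_zero.2 fun hh => p.2 (Subtype.ext hh))
    refine ⟨f, fun v hv w hw hvw heq => hf ⟨(⟨v, hv⟩, ⟨w, hw⟩), fun hh => hvw
      (congrArg Subtype.val hh)⟩ ?_⟩
    show f (v - w) = 0
    rw [map_sub, heq, sub_self]
  let supp : (Set E3 → Set E3 → ZMod 2) → Set E3 := fun z =>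
    {v | v ∈ V ∧ ∃ F ∈ Φ, ∃ G ∈ Φ, F ≠ G ∧ v ∈ F ∧ v ∈ G ∧ z F G ≠ 0}
  let low : (Set E3 → Set E3 → ZMod 2) → Set E3 := fun z => {v | v ∈ V ∧ ∃ u ∈ supp z, f v ≤ f u}
  suffices H : ∀ n : ℕ, ∀ z, HasCob Φ V z (fun _ => 0) → (low z).ncard = n →
      ∃ T : Set E3 → ZMod 2, ∀ F ∈ Φ, ∀ G ∈ Φ, F ≠ G → (F ∩ G).Nonempty → z F G = T F + T G from
    H _ z hz rfl
  intro n
  induction n using Nat.strong_induction_on with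
  | _ n ih =>
  intro z hz hn
  by_cases hs : (supp z).Nonempty
  swap
  · refine ⟨fun _ => 0, fun F hF G hG hFG hne => ?_⟩
    obtain ⟨v, hv, w, hw, hvw, heq, -⟩ := h.edge F hF G hG hFG hne
    have hvm : v ∈ F ∩ G := heq ▸ left_mem_segment ℝ v w
    by_contra hcon
    exact hs ⟨v, hv, F, hF, G, hG, hFG, hvm.1, hvm.2, by simpa using hcon⟩
  have hfin : (supp z).Finite := h.finV.subset fun v hv => hv.1
  obtain ⟨v, hvs, hmax⟩ := hfin.exists_maximalFor f _ hs
  have hmax : ∀ u ∈ supp z, f u ≤ f v := fun u hu => by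
    by_contra hcon
    push Not at hcon
    exact absurd (hmax hu hcon.le) (not_le.2 hcon)
  -- arrange the corner
  have corner : ∃ F ∈ Φ, ∃ G ∈ Φ, ∃ H ∈ Φ, F ≠ G ∧ F ≠ H ∧ G ≠ H ∧ v ∈ F ∧ v ∈ G ∧ v ∈ H ∧
      z F G = 1 ∧ z F H = 1 ∧ z G H = 0 := by
    obtain ⟨hv, F, hF, G, hG, hFG, vF, vG, hne⟩ := hvs
    obtain ⟨H, hH, h2, h3, vH⟩ := h.third hv hF hG hFG vF vG
    have hc : z F G + z G H + z F H = 0 := hz.2 v hv F hF G hG H hH hFG h2 h3 vF vG vH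
    have h1 : z F G = 1 := (zmod2_cases _).resolve_left hne
    rcases zmod2_cases (z F H) with h4 | h4 <;> rcases zmod2_cases (z G H) with h5 | h5
    · rw [h1, h4, h5] at hc; exact absurd hc (by decide)
    · exact ⟨G, hG, F, hF, H, hH, hFG.symm, h3, h2, vG, vF, vH, by rw [hz.1, h1], h5, h4⟩
    · exact ⟨F, hF, G, hG, H, hH, hFG, h2, h3, vF, vG, vH, h1, h4, h5⟩
    · rw [h1, h4, h5] at hc; exact absurd hc (by decide)
  obtain ⟨F, hF, G, hG, H, hH, h1, h2, h3, vF, vG, vH, z1, z2, z3⟩ := corner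
  have hv := hvs.1
  have other : ∀ K ∈ Φ, F ≠ K → v ∈ K → z F K = 1 → ∃ w ∈ F ∩ K, w ≠ v ∧ f w ≤ f v := by
    intro K hK hFK vK hzK
    obtain ⟨a, ha, b, hb, hab, heq, -⟩ := h.edge F hF K hK hFK ⟨v, vF, vK⟩
    have am : a ∈ F ∩ K := heq ▸ left_mem_segment ℝ a b
    have bm : b ∈ F ∩ K := heq ▸ right_mem_segment ℝ a b
    have hs1 : ∀ u ∈ V, u ∈ F ∩ K → f u ≤ f v := fun u hu hu' =>
      hmax u ⟨hu, F, hF, K, hK, hFK, hu'.1, hu'.2, by rw [hzK]; decide⟩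
    by_cases hav : a = v
    · exact ⟨b, bm, fun hh => hab (hav.trans hh.symm), hs1 b hb bm⟩
    · exact ⟨a, am, hav, hs1 a ha am⟩
  obtain ⟨w1, hw1, n1, f1⟩ := other G hG h1 vG z1
  obtain ⟨w2, hw2, n2, f2⟩ := other H hH h2 vH z2
  have hsw := h.sweep v hv F hF G hG H hH h1 h2 h3 vF vG vH w1 hw1 w2 hw2 n1 n2 f f1 f2
  let ι : Set E3 → ZMod 2 := fun K => if K = F then 1 else 0
  let z' : Set E3 → Set E3 → ZMod 2 := fun A B => z A B + (ι A + ι B)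
  have hz' : HasCob Φ V z' (fun _ => 0) := by
    refine ⟨fun A B => ?_, fun u hu A hA B hB C hC a b c d e g => ?_⟩
    · simp only [z', hz.1 A B, add_comm (ι A)]
    · have := hz.2 u hu A hA B hB C hC a b c d e g
      have e2 : ∀ x y w a b c : ZMod 2, x + y + w = 0 →
        x + (a + b) + (y + (b + c)) + (w + (a + c)) = 0 := by decide
      exact e2 _ _ _ _ _ _ this
  have hsupp' : ∀ u ∈ supp z', f u < f v := by
    rintro u ⟨hu, A, hA, B, hB, hAB, uA, uB, hne⟩
    have hle : f u ≤ f v := by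
      by_cases hAF : A = F
      · exact hsw u (hAF ▸ uA)
      by_cases hBF : B = F
      · exact hsw u (hBF ▸ uB)
      refine hmax u ⟨hu, A, hA, B, hB, hAB, uA, uB, ?_⟩
      simpa [z', ι, hAF, hBF] using hne
    refine lt_of_le_of_ne hle fun heq => hne ?_
    have huv : u = v := by
      by_contra hcon
      exact hf u hu v hv hcon heq
    subst huv
    have a := h.vert3 hu hF hG hH h1 h2 h3 vF vG vH hA uA
    have b := h.vert3 hu hF hG hH h1 h2 h3 vF vG vH hB uB
    have z1' : z G F = 1 := by rw [hz.1, z1]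
    have z2' : z H F = 1 := by rw [hz.1, z2]
    have z3' : z H G = 0 := by rw [hz.1, z3]
    have hs := h1.symm
    have hs' := h2.symm
    simp only [z', ι]
    rcases a with rfl | rfl | rfl <;> rcases b with rfl | rfl | rfl <;>
      first
      | exact absurd rfl hAB
      | (simp only [z1, z2, z3, z1', z2', z3', hs, hs', if_true, if_false]; decide)
  have hlt : (low z').ncard < n := by
    rw [← hn]
    apply ncard_lt_ncard _ (h.finV.subset fun v hv => hv.1)
    refine ⟨fun x hx => ?_, fun hsub => ?_⟩
    · obtain ⟨hx, u, hu, hxu⟩ := hx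
      exact ⟨hx, v, hvs, hxu.trans (hsupp' u hu).le⟩
    · obtain ⟨-, u, hu, hvu⟩ := hsub (show v ∈ low z from ⟨hv, v, hvs, le_rfl⟩)
      exact absurd (hsupp' u hu) (not_lt.2 hvu)
  obtain ⟨T, hT⟩ := ih _ hlt z' hz' rfl
  refine ⟨fun K => T K + ι K, fun A hA B hB hAB hne => ?_⟩
  have := hT A hA B hB hAB hne
  have e2 : ∀ x a b s t : ZMod 2, x + (a + b) = s + t → x = s + a + (t + b) := by decide
  exact e2 _ _ _ _ _ this

/-- Combinatorial connectivity of a set of facets. -/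
def Conn (S : Set (Set E3)) : Prop :=
  ∀ T ⊆ S, T.Nonempty → (S \ T).Nonempty → ∃ F ∈ T, ∃ G ∈ S \ T, (F ∩ G).Nonempty

lemma Conn.const {S : Set (Set E3)} (hS : Conn S) {T : Set E3 → ZMod 2}
    (hT : ∀ F ∈ S, ∀ G ∈ S, F ≠ G → (F ∩ G).Nonempty → T F = T G) :
    ∀ F ∈ S, ∀ G ∈ S, T F = T G := by
  intro F hF G hG
  by_contra hne
  obtain ⟨A, hA, B, hB, hAB⟩ := hS {K | K ∈ S ∧ T K = T F} (fun K hK => hK.1) ⟨F, hF, rfl⟩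
    ⟨G, hG, fun hh => hne hh.2.symm⟩
  have hne' : A ≠ B := by rintro rfl; exact hB.2 hA
  exact hB.2 ⟨hB.1, (hT A hA.1 B hB.1 hne' hAB).symm.trans hA.2⟩

lemma SG.isCompact (h : SG Φ V) {F : Set E3} (hF : F ∈ Φ) : IsCompact F := (h.disc F hF).1

lemma SG.isCompact_sUnion (h : SG Φ V) {S : Set (Set E3)} (hS : S ⊆ Φ) : IsCompact (⋃₀ S) :=
  (h.finΦ.subset hS).isCompact_sUnion fun F hF => (h.isCompact (hS hF))

lemma SG.isClosed_sUnion (h : SG Φ V) {S : Set (Set E3)} (hS : S ⊆ Φ) : IsClosed (⋃₀ S) :=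
  (h.isCompact_sUnion hS).isClosed

lemma SG.conn_all (h : SG Φ V) : Conn Φ := by
  intro T hT hne hne'
  obtain ⟨F, hF⟩ := hne
  obtain ⟨G, hG⟩ := hne'
  have hc := h.conn.isPreconnected
  rw [isPreconnected_closed_iff] at hc
  obtain ⟨x, -, hx⟩ := hc (⋃₀ T) (⋃₀ (Φ \ T)) (h.isClosed_sUnion hT)
    (h.isClosed_sUnion sdiff_subset)
    (by rw [← sUnion_union, union_sdiff_cancel hT])
    (by obtain ⟨x, hx⟩ := (h.disc F (hT hF)).nonempty
        exact ⟨x, ⟨F, hT hF, hx⟩, F, hF, hx⟩)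
    (by obtain ⟨x, hx⟩ := (h.disc G hG.1).nonempty
        exact ⟨x, ⟨G, hG.1, hx⟩, G, hG, hx⟩)
  obtain ⟨⟨A, hA, xA⟩, B, hB, xB⟩ := hx
  exact ⟨A, hA, B, hB, x, xA, xB⟩

/-- Adjacency of boundary vertices along the boundary. -/
def BRel (Φ : Set (Set E3)) (V : Set E3) (S : Set (Set E3)) (v w : E3) : Prop :=
  v ∈ V ∧ w ∈ V ∧ ∃ F ∈ S, ∃ G ∈ Φ \ S, v ∈ F ∩ G ∧ w ∈ F ∩ G

lemma BRel.symm {S : Set (Set E3)} {v w : E3} (h : BRel Φ V S v w) : BRel Φ V S w v := by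
  obtain ⟨a, b, F, hF, G, hG, c, d⟩ := h
  exact ⟨b, a, F, hF, G, hG, d, c⟩

def Mixed (S : Set (Set E3)) (F G : Set E3) : Prop := (F ∈ S ∧ G ∉ S) ∨ (F ∉ S ∧ G ∈ S)

lemma mixed_rel {S : Set (Set E3)} {F G : Set E3} {v w : E3} (hF : F ∈ Φ) (hG : G ∈ Φ)
    (hm : Mixed S F G) (hv : v ∈ V) (hw : w ∈ V) (vm : v ∈ F ∩ G) (wm : w ∈ F ∩ G) :
    BRel Φ V S v w := by
  rcases hm with ⟨a, b⟩ | ⟨a, b⟩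
  · exact ⟨hv, hw, F, a, G, ⟨hG, b⟩, vm, wm⟩
  · exact ⟨hv, hw, G, b, F, ⟨hF, a⟩, vm.symm, wm.symm⟩

open Classical in
/-- The cochain of mixed edges in the class of `u`. -/
def zc (Φ : Set (Set E3)) (V : Set E3) (S : Set (Set E3)) (u : E3) (F G : Set E3) : ZMod 2 :=
  if Mixed S F G ∧ ∃ v ∈ V, v ∈ F ∩ G ∧ Relation.ReflTransGen (BRel Φ V S) u v then 1 else 0

lemma zc_eq {S : Set (Set E3)} {u v : E3} {F G : Set E3} (hF : F ∈ Φ) (hG : G ∈ Φ)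
    (hv : v ∈ V) (vm : v ∈ F ∩ G) : zc Φ V S u F G =
      open Classical in
      if Mixed S F G ∧ Relation.ReflTransGen (BRel Φ V S) u v then 1 else 0 := by
  classical
  unfold zc
  congr 1
  apply propext
  constructor
  · rintro ⟨hm, w, hw, wm, hr⟩
    exact ⟨hm, hr.tail (mixed_rel hF hG hm hw hv wm vm)⟩
  · rintro ⟨hm, hr⟩
    exact ⟨hm, v, hv, vm, hr⟩

lemma zc_cob {S : Set (Set E3)} (u : E3) : HasCob Φ V (zc Φ V S u) (fun _ => 0) := by
  classical
  constructor
  · intro F G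
    unfold zc
    congr 1
    apply propext
    rw [inter_comm F G]
    unfold Mixed
    tauto
  · intro v hv F hF G hG H hH h1 h2 h3 vF vG vH
    rw [zc_eq hF hG hv ⟨vF, vG⟩, zc_eq hG hH hv ⟨vG, vH⟩, zc_eq hF hH hv ⟨vF, vH⟩]
    by_cases hr : Relation.ReflTransGen (BRel Φ V S) u v
    · simp only [hr, and_true, Mixed]
      by_cases a : F ∈ S <;> by_cases b : G ∈ S <;> by_cases c : H ∈ S <;>
        simp [a, b, c] <;> decide
    · simp [hr]

lemma SG.exists_vertex (h : SG Φ V) {F G : Set E3} (hF : F ∈ Φ) (hG : G ∈ Φ) (hFG : F ≠ G)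
    (hne : (F ∩ G).Nonempty) : ∃ v ∈ V, v ∈ F ∩ G := by
  obtain ⟨v, hv, w, -, -, heq, -⟩ := h.edge F hF G hG hFG hne
  exact ⟨v, hv, heq ▸ left_mem_segment ℝ v w⟩

lemma SG.one_class (h : SG Φ V) {S : Set (Set E3)} (hS : S ⊆ Φ) (c1 : Conn S) (c2 : Conn (Φ \ S))
    {u v : E3} (hu : u ∈ V) (hv : v ∈ V) (u1 : u ∈ ⋃₀ S) (u2 : u ∈ ⋃₀ (Φ \ S))
    (v1 : v ∈ ⋃₀ S) (v2 : v ∈ ⋃₀ (Φ \ S)) : Relation.ReflTransGen (BRel Φ V S) u v := by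
  classical
  obtain ⟨T, hT⟩ := h.lemmaJ (zc_cob (Φ := Φ) (V := V) (S := S) u)
  have eq0 : ∀ a b : ZMod 2, 0 = a + b → a = b := by decide
  have k1 := c1.const (T := T) fun F hF G hG hne hm => by
    have := hT F (hS hF) G (hS hG) hne hm
    rw [zc, if_neg (by unfold Mixed; tauto)] at this
    exact eq0 _ _ this
  have k2 := c2.const (T := T) fun F hF G hG hne hm => by
    have := hT F hF.1 G hG.1 hne hm
    have h3 := hF.2
    have h4 := hG.2
    rw [zc, if_neg (by unfold Mixed; tauto)] at this
    exact eq0 _ _ this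
  obtain ⟨F, hF, uF⟩ := u1
  obtain ⟨G, hG, uG⟩ := u2
  obtain ⟨F', hF', vF⟩ := v1
  obtain ⟨G', hG', vG⟩ := v2
  have e1 := hT F (hS hF) G hG.1 (by rintro rfl; exact hG.2 hF) ⟨u, uF, uG⟩
  have e2 := hT F' (hS hF') G' hG'.1 (by rintro rfl; exact hG'.2 hF') ⟨v, vF, vG⟩
  rw [zc_eq (hS hF) hG.1 hu ⟨uF, uG⟩, if_pos ⟨Or.inl ⟨hF, hG.2⟩, Relation.ReflTransGen.refl⟩] at e1
  rw [zc_eq (hS hF') hG'.1 hv ⟨vF, vG⟩, k1 F' hF' F hF, k2 G' hG' G hG, ← e1] at e2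
  by_contra hcon
  rw [if_neg fun hh => hcon hh.2] at e2
  exact absurd e2 (by decide)

open Classical in
/-- Chains along the boundary. -/
lemma SG.chain (h : SG Φ V) {S : Set (Set E3)} (hS : S ⊆ Φ) {r v : E3}
    (hr : Relation.ReflTransGen (BRel Φ V S) r v) :
    ∃ q : Set E3 → Set E3 → ZMod 2, (∀ F G, ¬ Mixed S F G → q F G = 0) ∧
      HasCob Φ V q (fun x => (if x = r then 1 else 0) + if x = v then 1 else 0) := by
  induction hr with
  | refl =>
    refine ⟨fun _ _ => 0, fun _ _ _ => rfl, HasCob.zero.congr fun x _ => ?_⟩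
    by_cases hx : x = r <;> simp [hx] <;> decide
  | @tail b c hb hbc ih =>
    obtain ⟨q, q1, q2⟩ := ih
    by_cases hbc' : b = c
    · subst hbc'; exact ⟨q, q1, q2⟩
    obtain ⟨bV, cV, F, hF, G, hG, bm, cm⟩ := hbc
    have hFG : F ≠ G := by rintro rfl; exact hG.2 hF
    refine ⟨_, ?_, (q2.add (h.ed_cob (hS hF) hG.1 hFG)).congr ?_⟩
    · intro A B hm
      rw [q1 A B hm, zero_add, ed, if_neg]
      rintro (⟨rfl, rfl⟩ | ⟨rfl, rfl⟩)
      · exact hm (Or.inl ⟨hF, hG.2⟩)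
      · exact hm (Or.inr ⟨hG.2, hF⟩)
    · intro x hx
      obtain ⟨v, hv, w, hw, hvw, heq, hall⟩ := h.edge F (hS hF) G hG.1 hFG ⟨b, bm⟩
      have hb' := hall b bV bm
      have hc' := hall c cV cm
      have : x ∈ F ∩ G ↔ x = b ∨ x = c := by
        constructor
        · intro hh
          have := hall x hx hh
          grind
        · rintro (rfl | rfl) <;> assumption
      simp only [this]
      generalize (if x = r then (1 : ZMod 2) else 0) = t
      by_cases xb : x = b
      · rw [if_pos xb, if_pos (Or.inl xb), if_neg (fun hh => hbc' (xb.symm.trans hh))]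
        revert t; decide
      · by_cases xc : x = c
        · rw [if_neg xb, if_pos (Or.inr xc), if_pos xc, add_zero]
        · rw [if_neg xb, if_neg (by tauto), if_neg xc, add_zero, add_zero]

end comb

section comb2

variable {Φ : Set (Set E3)} {V : Set E3}

/-- The points of an edge which are in no other facet. -/
def eint (Φ : Set (Set E3)) (F G : Set E3) : Set E3 :=
  {x | x ∈ F ∧ x ∈ G ∧ ∀ K ∈ Φ, x ∈ K → K = F ∨ K = G}

lemma SG.edge_closure (h : SG Φ V) {F G : Set E3} (hF : F ∈ Φ) (hG : G ∈ Φ) (hFG : F ≠ G) :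
    F ∩ G ⊆ closure (eint Φ F G) := by
  intro x hx
  obtain ⟨v, hv, w, hw, hvw, heq, hall⟩ := h.edge F hF G hG hFG ⟨x, hx⟩
  rw [heq, ← closure_openSegment] at hx
  refine closure_mono (fun y hy => ?_) hx
  have hym : y ∈ F ∩ G := heq ▸ openSegment_subset_segment ℝ v w hy
  refine ⟨hym.1, hym.2, fun K hK yK => ?_⟩
  by_contra hcon
  push Not at hcon
  have hyV := h.triple F hF G hG K hK hFG hcon.1.symm hcon.2.symm y hym.1 hym.2 yK
  rcases hall y hyV hym with rfl | rfl
  · exact hvw (left_mem_openSegment_iff.1 hy)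
  · exact hvw (right_mem_openSegment_iff.1 hy)

lemma SG.edge_point (h : SG Φ V) {F G : Set E3} (hF : F ∈ Φ) (hG : G ∈ Φ) (hFG : F ≠ G)
    (hne : (F ∩ G).Nonempty) : (eint Φ F G).Nonempty := by
  obtain ⟨x, hx⟩ := hne
  exact closure_nonempty_iff.1 ⟨x, h.edge_closure hF hG hFG hx⟩

lemma SG.edge_conn (h : SG Φ V) {F G : Set E3} (hF : F ∈ Φ) (hG : G ∈ Φ) (hFG : F ≠ G)
    (hne : (F ∩ G).Nonempty) : IsConnected (F ∩ G) := by
  refine ⟨hne, ?_⟩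
  obtain ⟨v, hv, w, hw, hvw, heq, hall⟩ := h.edge F hF G hG hFG hne
  rw [heq]
  exact (convex_segment v w).isPreconnected

lemma SG.edge_nontriv (h : SG Φ V) {F G : Set E3} (hF : F ∈ Φ) (hG : G ∈ Φ) (hFG : F ≠ G)
    (hne : (F ∩ G).Nonempty) : (F ∩ G).Nontrivial := by
  obtain ⟨v, hv, w, hw, hvw, heq, hall⟩ := h.edge F hF G hG hFG hne
  rw [heq]
  exact ⟨v, left_mem_segment ℝ v w, w, right_mem_segment ℝ v w, hvw⟩

lemma SG.conn_compl_singleton (h : SG Φ V) {F : Set E3} (hF : F ∈ Φ) : Conn (Φ \ {F}) := by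
  intro X hX hne hne'
  by_contra hcon
  push Not at hcon
  -- both parts touch F
  have t1 : ∃ A ∈ X, (F ∩ A).Nonempty := by
    obtain ⟨A, hA, B, hB, hAB⟩ := h.conn_all X (hX.trans sdiff_subset) hne
      ⟨F, hF, fun hh => (hX hh).2 rfl⟩
    by_cases hBF : B = F
    · subst hBF; exact ⟨A, hA, by rwa [inter_comm]⟩
    · exact absurd (hcon A hA B ⟨⟨hB.1, hBF⟩, hB.2⟩) hAB.ne_empty
  have t2 : ∃ A ∈ (Φ \ {F}) \ X, (F ∩ A).Nonempty := by
    obtain ⟨A, hA, B, hB, hAB⟩ := h.conn_all ((Φ \ {F}) \ X) (sdiff_subset.trans sdiff_subset) hne'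
      ⟨F, hF, fun hh => hh.1.2 rfl⟩
    by_cases hBF : B = F
    · subst hBF; exact ⟨A, hA, by rwa [inter_comm]⟩
    · by_cases hBX : B ∈ X
      · have := hcon B hBX A hA
        rw [inter_comm] at this
        exact absurd this hAB.ne_empty
      · exact absurd ⟨⟨hB.1, hBF⟩, hBX⟩ hB.2
  obtain ⟨A, hA, a, aF, aA⟩ := t1
  obtain ⟨B, hB, b, bF, bB⟩ := t2
  have hc := (h.disc F hF).isCirc.isConnected.isPreconnected
  rw [isPreconnected_closed_iff] at hc
  obtain ⟨x, -, ⟨C, hC, xC⟩, D, hD, xD⟩ := hc (⋃₀ X) (⋃₀ ((Φ \ {F}) \ X))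
    (h.isClosed_sUnion (hX.trans sdiff_subset))
    (h.isClosed_sUnion (sdiff_subset.trans sdiff_subset))
    (by rw [← sUnion_union, union_sdiff_cancel hX]; exact inter_subset_right)
    ⟨a, ⟨aF, A, hX hA, aA⟩, A, hA, aA⟩ ⟨b, ⟨bF, B, hB.1, bB⟩, B, hB, bB⟩
  have := hcon C hC D hD
  exact (this ▸ (⟨xC, xD⟩ : x ∈ C ∩ D) : x ∈ (∅ : Set E3))

lemma SG.removal (h : SG Φ V) {S : Set (Set E3)} (hS : S ⊆ Φ) (c1 : Conn S)
    (hne : (Φ \ S).Nonempty) (hn : S.Nonempty) :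
    ∃ F ∈ S, (∃ G ∈ Φ \ S, (F ∩ G).Nonempty) ∧ Conn (S \ {F}) := by
  by_contra hcon
  push Not at hcon
  have main : ∀ n : ℕ, ∀ F K, F ∈ S → K ⊆ S \ {F} → K.Nonempty →
      (∀ A ∈ K, ∀ B ∈ (S \ {F}) \ K, ¬ (A ∩ B).Nonempty) → K.ncard = n → False := by
    intro n
    induction n using Nat.strong_induction_on with
    | _ n ih =>
    intro F K hF hK hKn hadj hKc
    obtain ⟨F', hF', B, hB, hFB⟩ := h.conn_compl_singleton (hS hF) K
      (hK.trans (sdiff_subset_sdiff_left hS)) hKn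
      (by obtain ⟨G, hG⟩ := hne
          exact ⟨G, ⟨hG.1, by rintro rfl; exact hG.2 hF⟩, fun hh => hG.2 (hK hh).1⟩)
    have hBS : B ∉ S := fun hBS => hadj F' hF' B ⟨⟨hBS, hB.1.2⟩, hB.2⟩ hFB
    have hnc := hcon F' (hK hF').1 ⟨B, ⟨hB.1.1, hBS⟩, hFB⟩
    have : ∃ K' ⊆ S \ {F'}, K'.Nonempty ∧ F ∉ K' ∧
        ∀ A ∈ K', ∀ B ∈ (S \ {F'}) \ K', ¬ (A ∩ B).Nonempty := by
      unfold Conn at hnc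
      push Not at hnc
      obtain ⟨K', hK', n1, n2, hk⟩ := hnc
      by_cases hFK : F ∈ K'
      · refine ⟨(S \ {F'}) \ K', sdiff_subset, n2, fun hh => hh.2 hFK, fun A hA B hB hAB => ?_⟩
        have hBK : B ∈ K' := by
          by_contra hh
          exact hB.2 ⟨hB.1, hh⟩
        have := hk B hBK A hA
        rw [inter_comm] at this
        exact hAB.ne_empty this
      · exact ⟨K', hK', n1, hFK, fun A hA B hB hAB => hAB.ne_empty (hk A hA B hB)⟩
    obtain ⟨K', hK', n1, hFK, hadj'⟩ := this
    by_cases hsub : K' ⊆ K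
    · refine ih K'.ncard ?_ F' K' (hK hF').1 hK' n1 hadj' rfl
      rw [← hKc]
      exact ncard_lt_ncard ⟨hsub, fun hh => (hK' (hh hF')).2 rfl⟩
        (h.finΦ.subset (hK.trans (sdiff_subset.trans hS)))
    · rw [not_subset] at hsub
      obtain ⟨C, hC, hCK⟩ := hsub
      obtain ⟨A, hA, B, hB, hAB⟩ := c1 (K' \ K) (sdiff_subset.trans (hK'.trans sdiff_subset))
        ⟨C, hC, hCK⟩ ⟨F', (hK hF').1, fun hh => hh.2 hF'⟩
      have hA' : A ∈ (S \ {F}) \ K := ⟨⟨(hK' hA.1).1, by rintro rfl; exact hFK hA.1⟩, hA.2⟩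
      by_cases hBK : B ∈ K
      · exact hadj B hBK A hA' (by rwa [inter_comm])
      · by_cases hBK' : B ∈ K'
        · exact hB.2 ⟨hBK', hBK⟩
        · exact hadj' A hA.1 B ⟨⟨hB.1, by rintro rfl; exact hBK hF'⟩, hBK'⟩ hAB
  obtain ⟨F, hF, G, hG, hFG⟩ := h.conn_all S hS hn hne
  have := hcon F hF ⟨G, hG, hFG⟩
  unfold Conn at this
  push Not at this
  obtain ⟨K, hK, n1, -, hk⟩ := this
  exact main _ F K hF hK n1 (fun A hA B hB hAB => hAB.ne_empty (hk A hA B hB)) rfl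

lemma Conn.insert {S : Set (Set E3)} (c : Conn S) {F G : Set E3} (hG : G ∈ S)
    (hFG : (F ∩ G).Nonempty) : Conn (insert F S) := by
  intro T hT hne hne'
  by_cases h1 : (S ∩ T).Nonempty
  · by_cases h2 : (S \ (S ∩ T)).Nonempty
    · obtain ⟨A, hA, B, hB, hAB⟩ := c (S ∩ T) inter_subset_left h1 h2
      exact ⟨A, hA.2, B, ⟨Or.inr hB.1, fun hh => hB.2 ⟨hB.1, hh⟩⟩, hAB⟩
    · have hST : S ⊆ T := fun x hx => by
        by_contra hh
        exact h2 ⟨x, hx, fun h3 => hh h3.2⟩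
      obtain ⟨x, hx, hx'⟩ := hne'
      rcases hx with rfl | hx
      · exact ⟨G, hST hG, x, ⟨Or.inl rfl, hx'⟩, by rwa [inter_comm]⟩
      · exact absurd (hST hx) hx'
  · obtain ⟨x, hx⟩ := hne
    rcases hT hx with rfl | hxS
    · exact ⟨x, hx, G, ⟨Or.inr hG, fun hh => h1 ⟨G, hG, hh⟩⟩, hFG⟩
    · exact absurd ⟨x, hxS, hx⟩ h1

lemma SG.J_conn (h : SG Φ V) {S : Set (Set E3)} (hS : S ⊆ Φ) (c1 : Conn S) (c2 : Conn (Φ \ S))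
    {F : Set E3} (hF : F ∈ S) (c3 : Conn (S \ {F})) : IsPreconnected (F ∩ ⋃₀ (S \ {F})) := by
  classical
  rw [isPreconnected_closed_iff]
  intro u w hu hw hcov ⟨a, ⟨aF, A, hA, aA⟩, au⟩ ⟨b, ⟨bF, B, hB, bB⟩, bw⟩
  by_contra hemp
  have hemp : ∀ x ∈ F, ∀ G ∈ S \ {F}, x ∈ G → x ∈ u → x ∈ w → False := fun x xF G hG xG xu xw =>
    hemp ⟨x, ⟨xF, G, hG, xG⟩, xu, xw⟩
  have hneF : ∀ G ∈ S \ {F}, F ≠ G := fun G hG hh => hG.2 hh.symm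
  -- each edge lies on one side
  have side : ∀ G ∈ S \ {F}, ∀ x ∈ F ∩ G, x ∈ u → F ∩ G ⊆ u := by
    intro G hG x hx xu y hy
    have hc := (h.edge_conn (hS hF) (hS hG.1) (hneF G hG) ⟨x, hx⟩).isPreconnected
    rw [isPreconnected_closed_iff] at hc
    by_contra hyu
    have hyw : y ∈ w := (hcov ⟨hy.1, G, hG, hy.2⟩).resolve_left hyu
    obtain ⟨t, ht, tu, tw⟩ := hc u w hu hw (fun z hz => hcov ⟨hz.1, G, hG, hz.2⟩) ⟨x, hx, xu⟩
      ⟨y, hy, hyw⟩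
    exact hemp t ht.1 G hG ht.2 tu tw
  have hfin1 : {G | G ∈ S \ {F} ∧ (F ∩ G).Nonempty ∧ F ∩ G ⊆ u}.Finite :=
    h.finΦ.subset fun G hG => hS hG.1.1
  obtain ⟨N1, hN1⟩ : ∃ N1 : Finset (Set E3), ∀ G, G ∈ N1 ↔
      G ∈ S \ {F} ∧ (F ∩ G).Nonempty ∧ F ∩ G ⊆ u := ⟨hfin1.toFinset, fun G => by simp⟩
  obtain ⟨Vf, hVf⟩ : ∃ Vf : Finset E3, ∀ x, x ∈ Vf ↔ x ∈ V := ⟨h.finV.toFinset, fun G => by simp⟩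
  have hz0 := HasCob.sum N1 (z := fun G => ed F G)
    (g := fun G v => if v ∈ F ∩ G then 1 else 0) (Φ := Φ) (V := V) fun G hG => by
      have := (hN1 G).1 hG
      convert h.ed_cob (hS hF) (hS this.1.1) (hneF G this.1)
  obtain ⟨g, hg⟩ : ∃ g : E3 → ZMod 2, g = fun v => ∑ G ∈ N1, if v ∈ F ∩ G then 1 else 0 := ⟨_, rfl⟩
  rw [← hg] at hz0
  have gsum : ∑ v ∈ Vf, g v = 0 := by
    rw [hg, Finset.sum_comm]
    apply Finset.sum_eq_zero
    intro G hG
    obtain ⟨hGS, hne, -⟩ := (hN1 G).1 hG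
    obtain ⟨p, hp, q, hq, hpq, heq, hall⟩ := h.edge F (hS hF) G (hS hGS.1) (hneF G hGS) hne
    have : ∀ v ∈ Vf, (if v ∈ F ∩ G then (1 : ZMod 2) else 0) =
        (if v = p then 1 else 0) + if v = q then 1 else 0 := by
      intro v hv
      have hv := (hVf v).1 hv
      by_cases h1 : v = p
      · subst h1
        rw [if_pos (heq ▸ left_mem_segment ℝ v q), if_pos rfl, if_neg hpq, add_zero]
      · by_cases h2 : v = q
        · subst h2
          rw [if_pos (heq ▸ right_mem_segment ℝ p v), if_pos rfl, if_neg h1, zero_add]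
        · rw [if_neg, if_neg h1, if_neg h2, add_zero]
          intro hh
          rcases hall v hv hh with h3 | h3
          · exact h1 h3
          · exact h2 h3
    rw [Finset.sum_congr rfl this, Finset.sum_add_distrib, Finset.sum_ite_eq', Finset.sum_ite_eq',
      if_pos ((hVf p).2 hp), if_pos ((hVf q).2 hq)]
    decide
  have gbd : ∀ v ∈ V, g v ≠ 0 → v ∈ ⋃₀ S ∧ v ∈ ⋃₀ (Φ \ S) := by
    intro v hv hgv
    have hex : ∃ G ∈ N1, v ∈ F ∩ G := by
      by_contra hcon
      push Not at hcon
      apply hgv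
      rw [hg]
      exact Finset.sum_eq_zero fun G hG => if_neg (hcon G hG)
    obtain ⟨G, hG, vF, vG⟩ := hex
    obtain ⟨hGS, hne, hGu⟩ := (hN1 G).1 hG
    obtain ⟨H, hH, h2, h3, vH⟩ := h.third hv (hS hF) (hS hGS.1) (hneF G hGS) vF vG
    refine ⟨⟨F, hF, vF⟩, H, ⟨hH, fun hHS => hgv ?_⟩, vH⟩
    have hH1 : H ∈ N1 := (hN1 H).2 ⟨⟨hHS, h2.symm⟩, ⟨v, vF, vH⟩,
      side H ⟨hHS, h2.symm⟩ v ⟨vF, vH⟩ (hGu ⟨vF, vG⟩)⟩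
    rw [hg]
    have : ∀ K ∈ N1, (if v ∈ F ∩ K then (1 : ZMod 2) else 0) =
        (if K = G then 1 else 0) + if K = H then 1 else 0 := by
      intro K hK
      have hKS := ((hN1 K).1 hK).1
      by_cases e1 : K = G
      · subst e1
        rw [if_pos ⟨vF, vG⟩, if_pos rfl, if_neg h3, add_zero]
      · by_cases e2 : K = H
        · subst e2
          rw [if_pos ⟨vF, vH⟩, if_neg e1, if_pos rfl, zero_add]
        · rw [if_neg, if_neg e1, if_neg e2, add_zero]
          intro hh
          rcases h.vert3 hv (hS hF) (hS hGS.1) hH (hneF G hGS) h2 h3 vF vG vH (hS hKS.1) hh.2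
            with e | e | e
          · exact hneF K hKS e.symm
          · exact e1 e
          · exact e2 e
    show (∑ K ∈ N1, if v ∈ F ∩ K then (1 : ZMod 2) else 0) = 0
    rw [Finset.sum_congr rfl this, Finset.sum_add_distrib, Finset.sum_ite_eq', Finset.sum_ite_eq',
      if_pos hG, if_pos hH1]
    decide
  -- the correcting chains
  have hr : ∃ r, ∀ v ∈ V, g v ≠ 0 → Relation.ReflTransGen (BRel Φ V S) r v := by
    by_cases hex : ∃ r ∈ V, g r ≠ 0
    · obtain ⟨r, hr, hgr⟩ := hex
      exact ⟨r, fun v hv hgv => h.one_class hS c1 c2 hr hv (gbd r hr hgr).1 (gbd r hr hgr).2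
        (gbd v hv hgv).1 (gbd v hv hgv).2⟩
    · push Not at hex
      exact ⟨0, fun v hv hgv => absurd (hex v hv) hgv⟩
  obtain ⟨r, hr⟩ := hr
  have hq : ∀ v, ∃ q : Set E3 → Set E3 → ZMod 2, v ∈ V → (∀ A B, ¬ Mixed S A B → q A B = 0) ∧
      HasCob Φ V q (fun x => g v * ((if x = r then 1 else 0) + if x = v then 1 else 0)) := by
    intro v
    by_cases hgv : g v = 0
    · exact ⟨fun _ _ => 0, fun _ => ⟨fun _ _ _ => rfl, HasCob.zero.congr fun x _ => by
        rw [hgv, zero_mul]⟩⟩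
    by_cases hv : v ∈ V
    · obtain ⟨q, q1, q2⟩ := h.chain hS (hr v hv hgv)
      refine ⟨q, fun _ => ⟨q1, q2.congr fun x _ => ?_⟩⟩
      rw [(zmod2_cases (g v)).resolve_left hgv, one_mul]
    · exact ⟨fun _ _ => 0, fun hh => absurd hh hv⟩
  choose q hq using hq
  have hZ := hz0.add (HasCob.sum Vf (z := q) fun v hv => (hq v ((hVf v).1 hv)).2)
  have hZ' := hZ.congr (g' := fun _ => 0) fun x hx => by
    simp only [mul_add, Finset.sum_add_distrib]
    rw [← Finset.sum_mul, gsum, zero_mul, zero_add]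
    simp only [mul_ite, mul_one, mul_zero]
    rw [Finset.sum_ite_eq, if_pos ((hVf x).2 hx)]
    generalize g x = t
    revert t; decide
  obtain ⟨T, hT⟩ := h.lemmaJ hZ'
  have val : ∀ A ∈ S, ∀ B ∈ S, A ≠ B → (A ∩ B).Nonempty → ∑ G ∈ N1, ed F G A B = T A + T B := by
    intro A hA B hB hAB hne
    rw [← hT A (hS hA) B (hS hB) hAB hne, Finset.sum_eq_zero (s := Vf), add_zero]
    intro v hv
    exact (hq v ((hVf v).1 hv)).1 A B (by unfold Mixed; tauto)
  have eq0 : ∀ a b : ZMod 2, 0 = a + b → a = b := by decide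
  have k := c3.const (T := T) fun A hA B hB hne hm => by
    have := val A hA.1 B hB.1 hne hm
    rw [Finset.sum_eq_zero] at this
    · exact eq0 _ _ this
    · intro G hG
      rw [ed, if_neg]
      rintro (⟨e, -⟩ | ⟨-, e⟩)
      · exact hA.2 e
      · exact hB.2 e
  have valF : ∀ G ∈ S \ {F}, (F ∩ G).Nonempty → (if G ∈ N1 then 1 else 0) = T F + T G := by
    intro G hG hne
    rw [← val F hF G hG.1 (hneF G hG) hne, ← Finset.sum_ite_eq N1 G (fun _ => (1 : ZMod 2))]
    refine Finset.sum_congr rfl fun G' hG' => ?_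
    unfold ed
    congr 1
    apply propext
    constructor
    · intro e; exact Or.inl ⟨rfl, e⟩
    · rintro (⟨-, e⟩ | ⟨-, e⟩)
      · exact e
      · exact absurd e hG.2
  have v1 := valF A hA ⟨a, aF, aA⟩
  have v2 := valF B hB ⟨b, bF, bB⟩
  rw [if_pos ((hN1 A).2 ⟨hA, ⟨a, aF, aA⟩, side A hA a ⟨aF, aA⟩ au⟩), k A hA B hB] at v1
  rw [← v1, if_neg] at v2
  · exact absurd v2 (by decide)
  · intro hh
    exact hemp b bF B hB bB (((hN1 B).1 hh).2.2 ⟨bF, bB⟩) bw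

/-- The disc theorem. -/
lemma SG.disc_thm (h : SG Φ V) : ∀ n : ℕ, ∀ S ⊆ Φ, S.ncard = n → S.Nonempty → (Φ \ S).Nonempty →
    Conn S → Conn (Φ \ S) → IsDisc (⋃₀ S) (⋃₀ S ∩ ⋃₀ (Φ \ S)) := by
  intro n
  induction n using Nat.strong_induction_on with
  | _ n ih =>
  intro S hS hn hne hne' c1 c2
  by_cases hsing : ∃ F, S = {F}
  · obtain ⟨F, rfl⟩ := hsing
    rw [sUnion_singleton]
    exact h.disc F (hS rfl)
  obtain ⟨F, hF, ⟨H, hH, hFH⟩, c3⟩ := h.removal hS c1 hne' hne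
  have hn' : (S \ {F}).Nonempty := by
    by_contra hcon
    rw [not_nonempty_iff_eq_empty, sdiff_eq_empty] at hcon
    exact hsing ⟨F, hcon.antisymm (singleton_subset_iff.2 hF)⟩
  have hcomp : Φ \ (S \ {F}) = insert F (Φ \ S) := by
    ext G
    simp only [mem_sdiff, mem_singleton_iff, mem_insert_iff]
    constructor
    · rintro ⟨a, b⟩
      by_cases hGF : G = F
      · exact Or.inl hGF
      · exact Or.inr ⟨a, fun hh => b ⟨hh, hGF⟩⟩
    · rintro (rfl | ⟨a, b⟩)
      · exact ⟨hS hF, fun hh => hh.2 rfl⟩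
      · exact ⟨a, fun hh => b hh.1⟩
  have hlt : (S \ {F}).ncard < n := by
    rw [← hn]
    exact ncard_lt_ncard ⟨sdiff_subset, fun hh => (hh hF).2 rfl⟩ (h.finΦ.subset hS)
  have hd := ih _ hlt (S \ {F}) (sdiff_subset.trans hS) rfl hn'
    (by rw [hcomp]; exact ⟨F, Or.inl rfl⟩) c3 (by rw [hcomp]; exact c2.insert hH hFH)
  rw [hcomp] at hd
  have hFd := h.disc F (hS hF)
  -- F touches the rest
  obtain ⟨F', hF', G, hG, hFG⟩ := c1 {F} (singleton_subset_iff.2 hF) ⟨F, rfl⟩ hn'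
  obtain rfl : F' = F := hF'
  have hFneG : F' ≠ G := fun hh => hG.2 hh.symm
  have hsubJ : F' ∩ G ⊆ F' ∩ ⋃₀ (S \ {F'}) := fun x hx => ⟨hx.1, G, hG, hx.2⟩
  have key1 : ∀ B ∈ Φ \ S, ∀ x ∈ eint Φ F' B,
      x ∈ (F' ∩ ⋃₀ (Φ \ {F'})) \ (F' ∩ ⋃₀ (S \ {F'})) := by
    intro B hB x hx
    refine ⟨⟨hx.1, B, ⟨hB.1, ?_⟩, hx.2.1⟩, ?_⟩
    · rintro rfl; exact hB.2 hF
    · rintro ⟨-, K, hK, xK⟩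
      rcases hx.2.2 K (hS hK.1) xK with rfl | rfl
      · exact hK.2 rfl
      · exact hB.2 hK.1
  have key2 : ∀ A ∈ S \ {F'}, ∀ B ∈ Φ \ S, ∀ x ∈ eint Φ A B,
      x ∈ (⋃₀ (S \ {F'}) ∩ ⋃₀ (insert F' (Φ \ S))) \ (F' ∩ ⋃₀ (S \ {F'})) := by
    intro A hA B hB x hx
    refine ⟨⟨⟨A, hA, hx.1⟩, B, Or.inr hB, hx.2.1⟩, ?_⟩
    rintro ⟨xF, -⟩
    rcases hx.2.2 F' (hS hF) xF with e | e
    · exact hA.2 e.symm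
    · exact hB.2 (e ▸ hF)
  have hg := glue hFd hd (J := F' ∩ ⋃₀ (S \ {F'})) rfl
    (fun x hx => ⟨hx.1, by
      obtain ⟨K, hK, xK⟩ := hx.2
      exact ⟨K, ⟨hS hK.1, hK.2⟩, xK⟩⟩)
    (fun x hx => ⟨hx.2, F', Or.inl rfl, hx.1⟩)
    ⟨hFG.mono hsubJ, h.J_conn hS c1 c2 hF c3⟩
    ((h.edge_nontriv (hS hF) (hS hG.1) hFneG hFG).mono hsubJ)
    (by
      obtain ⟨x, hx⟩ := h.edge_point (hS hF) hH.1 (by rintro rfl; exact hH.2 hF) hFH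
      have := key1 H hH x hx
      intro hh
      exact this.2 (hh ▸ this.1))
    (by
      obtain ⟨A, hA, B, hB, hAB⟩ := h.conn_compl_singleton (hS hF) (S \ {F'})
        (sdiff_subset_sdiff_left hS) hn' (by
          obtain ⟨K, hK⟩ := hne'
          exact ⟨K, ⟨hK.1, by rintro rfl; exact hK.2 hF⟩, fun hh => hK.2 hh.1⟩)
      have hB' : B ∈ Φ \ S := ⟨hB.1.1, fun hh => hB.2 ⟨hh, hB.1.2⟩⟩
      obtain ⟨x, hx⟩ := h.edge_point (hS hA.1) hB'.1 (by rintro rfl; exact hB'.2 hA.1) hAB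
      have := key2 A hA B hB' x hx
      intro hh
      exact this.2 (hh ▸ this.1))
  have e1 : F' ∪ ⋃₀ (S \ {F'}) = ⋃₀ S := by
    rw [← sUnion_insert, insert_sdiff_singleton, insert_eq_of_mem hF]
  rw [e1] at hg
  convert hg using 1
  apply Subset.antisymm
  · rintro x ⟨⟨A, hA, xA⟩, B, hB, xB⟩
    have hAB : A ≠ B := by rintro rfl; exact hB.2 hA
    have hx := h.edge_closure (hS hA) hB.1 hAB ⟨xA, xB⟩
    by_cases hAF : A = F'
    · subst hAF
      exact Or.inl (closure_mono (fun y hy => key1 B hB y hy) hx)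
    · exact Or.inr (closure_mono (fun y hy => key2 A ⟨hA, hAF⟩ B hB y hy) hx)
  · apply union_subset
    · apply closure_minimal _ ((h.isClosed_sUnion hS).inter (h.isClosed_sUnion sdiff_subset))
      rintro x ⟨⟨xF, K, hK, xK⟩, hn⟩
      exact ⟨⟨F', hF, xF⟩, K, ⟨hK.1, fun hh => hn ⟨xF, K, ⟨hh, hK.2⟩, xK⟩⟩, xK⟩
    · apply closure_minimal _ ((h.isClosed_sUnion hS).inter (h.isClosed_sUnion sdiff_subset))
      rintro x ⟨⟨⟨A, hA, xA⟩, K, hK, xK⟩, hn⟩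
      refine ⟨⟨A, hA.1, xA⟩, K, ?_, xK⟩
      rcases hK with rfl | hK
      · exact absurd ⟨xK, A, hA, xA⟩ hn
      · exact hK

end comb2

section comb3

variable {Φ : Set (Set E3)} {V : Set E3}

lemma SG.other_end (h : SG Φ V) {F G : Set E3} (hF : F ∈ Φ) (hG : G ∈ Φ) (hFG : F ≠ G) {v : E3}
    (hv : v ∈ V) (vm : v ∈ F ∩ G) : ∃ w ∈ V, w ≠ v ∧ F ∩ G = segment ℝ v w ∧
      ∀ u ∈ V, u ∈ F ∩ G → u = v ∨ u = w := by
  obtain ⟨a, ha, b, hb, hab, heq, hall⟩ := h.edge F hF G hG hFG ⟨v, vm⟩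
  rcases hall v hv vm with rfl | rfl
  · exact ⟨b, hb, hab.symm, heq, hall⟩
  · exact ⟨a, ha, hab, by rw [heq, segment_symm], fun u hu hum => (hall u hu hum).symm⟩

lemma SG.seg_of_two (h : SG Φ V) {F G : Set E3} (hF : F ∈ Φ) (hG : G ∈ Φ) (hFG : F ≠ G) {v w : E3}
    (hv : v ∈ V) (vm : v ∈ F ∩ G) (hw : w ∈ V) (wm : w ∈ F ∩ G) (hvw : v ≠ w) :
    F ∩ G = segment ℝ v w ∧ ∀ u ∈ V, u ∈ F ∩ G → u = v ∨ u = w := by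
  obtain ⟨a, ha, hav, heq, hall⟩ := h.other_end hF hG hFG hv vm
  rcases hall w hw wm with rfl | rfl
  · exact absurd rfl hvw
  · exact ⟨heq, hall⟩

/-- Three facets do not share two vertices. -/
lemma SG.three_unique (h : SG Φ V) {F G H : Set E3} (hF : F ∈ Φ) (hG : G ∈ Φ) (hH : H ∈ Φ)
    (h1 : F ≠ G) (h2 : F ≠ H) (h3 : G ≠ H) {v w : E3} (vF : v ∈ F) (vG : v ∈ G) (vH : v ∈ H)
    (wF : w ∈ F) (wG : w ∈ G) (wH : w ∈ H) : v = w := by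
  by_contra hvw
  have hv := h.triple F hF G hG H hH h1 h2 h3 v vF vG vH
  have hw := h.triple F hF G hG H hH h1 h2 h3 w wF wG wH
  obtain ⟨e1, hall⟩ := h.seg_of_two hF hG h1 hv ⟨vF, vG⟩ hw ⟨wF, wG⟩ hvw
  obtain ⟨e2, -⟩ := h.seg_of_two hF hH h2 hv ⟨vF, vH⟩ hw ⟨wF, wH⟩ hvw
  have hm : midpoint ℝ v w ∈ segment ℝ v w := midpoint_mem_segment v w
  have m1 : midpoint ℝ v w ∈ F ∩ G := e1 ▸ hm
  have m2 : midpoint ℝ v w ∈ F ∩ H := e2 ▸ hm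
  have mV := h.triple F hF G hG H hH h1 h2 h3 _ m1.1 m1.2 m2.2
  rcases hall _ mV m1 with e | e
  · exact hvw ((midpoint_eq_left_iff ℝ).1 e)
  · exact hvw ((midpoint_eq_right_iff ℝ).1 e)

lemma SG.lone (h : SG Φ V) {S : Set (Set E3)} {v : E3} (hv : v ∈ V)
    {A B : Set E3} (hA : A ∈ Φ) (hB : B ∈ Φ) (hm : Mixed S A B) (vA : v ∈ A) (vB : v ∈ B) :
    ∃ F ∈ Φ, ∃ G ∈ Φ, ∃ H ∈ Φ, F ≠ G ∧ F ≠ H ∧ G ≠ H ∧ v ∈ F ∧ v ∈ G ∧ v ∈ H ∧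
      Mixed S F G ∧ Mixed S F H ∧ ¬ Mixed S G H := by
  have hAB : A ≠ B := by rintro rfl; unfold Mixed at hm; tauto
  obtain ⟨C, hC, h2, h3, vC⟩ := h.third hv hA hB hAB vA vB
  by_cases hAC : Mixed S A C
  · exact ⟨A, hA, B, hB, C, hC, hAB, h2, h3, vA, vB, vC, hm, hAC, by unfold Mixed at *; tauto⟩
  · exact ⟨B, hB, A, hA, C, hC, hAB.symm, h3, h2, vB, vA, vC, by unfold Mixed at *; tauto,
      by unfold Mixed at *; tauto, hAC⟩

/-- The boundary graph. -/
def bgraph (Φ : Set (Set E3)) (V : Set E3) (S : Set (Set E3)) : SimpleGraph V where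
  Adj v w := v ≠ w ∧ BRel Φ V S v w
  symm := ⟨fun _ _ h => ⟨h.1.symm, h.2.symm⟩⟩
  loopless := ⟨fun _ h => h.1 rfl⟩

lemma SG.isCycles (h : SG Φ V) {S : Set (Set E3)} (hS : S ⊆ Φ) : (bgraph Φ V S).IsCycles := by
  intro v hne
  obtain ⟨w, hvw, -, -, A, hA, B, hB, vm, -⟩ := hne
  obtain ⟨F, hF, G, hG, H, hH, h1, h2, h3, vF, vG, vH, m1, m2, m3⟩ :=
    h.lone (S := S) v.2 (hS hA) hB.1 (Or.inl ⟨hA, hB.2⟩) vm.1 vm.2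
  obtain ⟨a, ha, hav, ea, alla⟩ := h.other_end hF hG h1 v.2 ⟨vF, vG⟩
  obtain ⟨b, hb, hbv, eb, allb⟩ := h.other_end hF hH h2 v.2 ⟨vF, vH⟩
  have am : a ∈ F ∩ G := ea ▸ right_mem_segment ℝ _ _
  have bm : b ∈ F ∩ H := eb ▸ right_mem_segment ℝ _ _
  have hab : a ≠ b := by
    rintro rfl
    exact hav (h.three_unique hF hG hH h1 h2 h3 vF vG vH am.1 am.2 bm.2).symm
  rw [ncard_eq_two]
  refine ⟨⟨a, ha⟩, ⟨b, hb⟩, fun hh => hab (congrArg Subtype.val hh), ?_⟩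
  ext u
  simp only [SimpleGraph.mem_neighborSet, mem_insert_iff, mem_singleton_iff]
  constructor
  · rintro ⟨hvu, -, -, C, hC, D, hD, vm', um⟩
    have hvu' : (u : E3) ≠ v := fun hh => hvu (Subtype.ext hh.symm)
    have a1 := h.vert3 v.2 hF hG hH h1 h2 h3 vF vG vH (hS hC) vm'.1
    have a2 := h.vert3 v.2 hF hG hH h1 h2 h3 vF vG vH hD.1 vm'.2
    have hD2 := hD.2
    have ka : ∀ x ∈ F ∩ G, x = u → u = ⟨a, ha⟩ ∨ u = ⟨b, hb⟩ := fun x hx e =>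
      Or.inl (Subtype.ext ((alla u u.2 (e ▸ hx)).resolve_left hvu'))
    have kb : ∀ x ∈ F ∩ H, x = u → u = ⟨a, ha⟩ ∨ u = ⟨b, hb⟩ := fun x hx e =>
      Or.inr (Subtype.ext ((allb u u.2 (e ▸ hx)).resolve_left hvu'))
    unfold Mixed at m1 m2 m3
    rcases a1 with rfl | rfl | rfl <;> rcases a2 with rfl | rfl | rfl
    · exact absurd hC hD2
    · exact ka u um rfl
    · exact kb u um rfl
    · exact ka u um.symm rfl
    · exact absurd hC hD2
    · exact absurd (Or.inl ⟨hC, hD2⟩) m3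
    · exact kb u um.symm rfl
    · exact absurd (Or.inr ⟨hD2, hC⟩) m3
    · exact absurd hC hD2
  · rintro (rfl | rfl)
    · exact ⟨fun hh => hav (congrArg Subtype.val hh).symm,
        mixed_rel hF hG m1 v.2 ha ⟨vF, vG⟩ am⟩
    · exact ⟨fun hh => hbv (congrArg Subtype.val hh).symm,
        mixed_rel hF hH m2 v.2 hb ⟨vF, vH⟩ bm⟩

lemma bgraph_reach {S : Set (Set E3)} {u v : E3} (hu : u ∈ V)
    (hr : Relation.ReflTransGen (BRel Φ V S) u v) (hv : v ∈ V) :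
    (bgraph Φ V S).Reachable ⟨u, hu⟩ ⟨v, hv⟩ := by
  induction hr with
  | refl => exact SimpleGraph.Reachable.refl _
  | @tail b c hb hbc ih =>
    by_cases e : b = c
    · subst e; exact ih hv
    · refine (ih hbc.1).trans (SimpleGraph.Adj.reachable ⟨fun hh => e (congrArg Subtype.val hh), hbc⟩)

lemma SG.edge_cycle (h : SG Φ V) {S : Set (Set E3)} (hS : S ⊆ Φ) (hne : S.Nonempty)
    (hne' : (Φ \ S).Nonempty) (c1 : Conn S) (c2 : Conn (Φ \ S)) :
    ∃ (n : ℕ) (v : Fin n → E3), 3 ≤ n ∧ Function.Injective v ∧ (∀ i, v i ∈ V) ∧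
      (∀ i, ∃ F ∈ S, ∃ G ∈ Φ \ S, F ∩ G = segment ℝ (v i) (v (nxt i))) ∧
      ⋃₀ S ∩ ⋃₀ (Φ \ S) = ⋃ i, segment ℝ (v i) (v (nxt i)) := by
  classical
  have := h.finV.to_subtype
  have := Fintype.ofFinite V
  obtain ⟨F0, hF0, G0, hG0, hFG0⟩ := h.conn_all S hS hne hne'
  have hnFG : ∀ F ∈ S, ∀ G ∈ Φ \ S, F ≠ G := by
    rintro F hF G hG rfl
    exact hG.2 hF
  obtain ⟨a, ha, b, hb, hab, heq, -⟩ := h.edge F0 (hS hF0) G0 hG0.1 (hnFG _ hF0 _ hG0) hFG0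
  have am : a ∈ F0 ∩ G0 := heq ▸ left_mem_segment ℝ a b
  have bm : b ∈ F0 ∩ G0 := heq ▸ right_mem_segment ℝ a b
  have hadj : (bgraph Φ V S).Adj ⟨a, ha⟩ ⟨b, hb⟩ :=
    ⟨fun hh => hab (congrArg Subtype.val hh), ha, hb, F0, hF0, G0, hG0, am, bm⟩
  obtain ⟨p, hp, hverts⟩ := (h.isCycles hS).exists_cycle_toSubgraph_verts_eq_connectedComponentSupp
    (c := (bgraph Φ V S).connectedComponentMk ⟨a, ha⟩) rfl ⟨_, hadj⟩
  have hlen := hp.three_le_length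
  have hnx : ∀ i : Fin p.length, p.getVert (nxt i).1 = p.getVert (i.1 + 1) := by
    intro i
    have hi := i.2
    show p.getVert ((i.1 + 1) % p.length) = _
    rcases Nat.lt_or_ge (i.1 + 1) p.length with h1 | h1
    · rw [Nat.mod_eq_of_lt h1]
    · have : i.1 + 1 = p.length := by omega
      rw [this, Nat.mod_self, p.getVert_zero, p.getVert_length]
  have hseg : ∀ i : Fin p.length, ∃ F ∈ S, ∃ G ∈ Φ \ S,
      F ∩ G = segment ℝ (p.getVert i.1 : E3) (p.getVert (nxt i).1) := by
    intro i
    rw [hnx]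
    obtain ⟨hne, -, -, F, hF, G, hG, m1, m2⟩ := p.adj_getVert_succ i.2
    exact ⟨F, hF, G, hG, (h.seg_of_two (hS hF) hG.1 (hnFG _ hF _ hG) (Subtype.coe_prop _) m1
      (Subtype.coe_prop _) m2 fun hh => hne (Subtype.ext hh)).1⟩
  refine ⟨p.length, fun i => p.getVert i.1, hlen, ?_, fun i => Subtype.coe_prop _, hseg, ?_⟩
  · intro i j hij
    have hi := i.2
    have hj := j.2
    exact Fin.ext (hp.getVert_injOn' (by rw [mem_ofPred_eq]; omega) (by rw [mem_ofPred_eq]; omega)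
      (Subtype.ext hij))
  · apply Subset.antisymm
    · rintro x ⟨⟨F, hF, xF⟩, G, hG, xG⟩
      obtain ⟨u, hu, w, hw, huw, heq, -⟩ := h.edge F (hS hF) G hG.1 (hnFG _ hF _ hG) ⟨x, xF, xG⟩
      have um : u ∈ F ∩ G := heq ▸ left_mem_segment ℝ u w
      have wm : w ∈ F ∩ G := heq ▸ right_mem_segment ℝ u w
      have hadj' : (bgraph Φ V S).Adj ⟨u, hu⟩ ⟨w, hw⟩ :=
        ⟨fun hh => huw (congrArg Subtype.val hh), hu, hw, F, hF, G, hG, um, wm⟩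
      have hmem : (⟨u, hu⟩ : V) ∈ p.toSubgraph.verts := by
        rw [hverts, SimpleGraph.ConnectedComponent.mem_supp_iff,
          SimpleGraph.ConnectedComponent.eq]
        exact bgraph_reach hu (h.one_class hS c1 c2 hu ha ⟨F, hF, um.1⟩ ⟨G, hG, um.2⟩
          ⟨F0, hF0, am.1⟩ ⟨G0, hG0, am.2⟩) ha
      have hsub := (hp.adj_toSubgraph_iff_of_isCycles (h.isCycles hS) hmem ⟨w, hw⟩).2 hadj'
      obtain ⟨i, hi, hil⟩ := p.toSubgraph_adj_iff.1 hsub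
      rw [mem_iUnion]
      refine ⟨⟨i, hil⟩, ?_⟩
      have hx : x ∈ segment ℝ u w := heq ▸ ⟨xF, xG⟩
      have e := hnx ⟨i, hil⟩
      simp only [e]
      rcases Sym2.eq_iff.1 hi with ⟨e1, e2⟩ | ⟨e1, e2⟩
      · rw [e1, e2]; exact hx
      · rw [e1, e2, segment_symm]; exact hx
    · intro x hx
      obtain ⟨i, hi⟩ := mem_iUnion.1 hx
      obtain ⟨F, hF, G, hG, e⟩ := hseg i
      have hi' : x ∈ F ∩ G := e ▸ hi
      exact ⟨⟨F, hF, hi'.1⟩, G, hG, hi'.2⟩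

end comb3

section belt

variable {Φ : Set (Set E3)} {V : Set E3} {k : ℕ}

lemma nxt_val (i : Fin k) : (nxt i).1 = if i.1 + 1 = k then 0 else i.1 + 1 := by
  have hi := i.2
  show (i.1 + 1) % k = _
  split_ifs with h
  · rw [h, Nat.mod_self]
  · exact Nat.mod_eq_of_lt (by omega)

lemma prv_val (i : Fin k) : (prv i).1 = if i.1 = 0 then k - 1 else i.1 - 1 := by
  have hi := i.2
  show (i.1 + (k - 1)) % k = _
  split_ifs with h
  · rw [h, zero_add]; exact Nat.mod_eq_of_lt (by omega)
  · rw [show i.1 + (k - 1) = i.1 - 1 + k by omega, Nat.add_mod_right]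
    exact Nat.mod_eq_of_lt (by omega)

lemma nxt_prv (i : Fin k) : nxt (prv i) = i := by
  have hi := i.2
  apply Fin.ext
  rw [nxt_val, prv_val]
  split_ifs <;> omega

lemma prv_nxt (i : Fin k) : prv (nxt i) = i := by
  have hi := i.2
  apply Fin.ext
  have h1 := prv_val (nxt i)
  have h2 := nxt_val i
  split_ifs at h1 h2 <;> omega

lemma cyc_ind {Q : Fin k → Prop} (i0 : Fin k) (h0 : Q i0) (hs : ∀ i, Q i → Q (nxt i)) :
    ∀ i, Q i := by
  have hk := i0.2
  have key : ∀ m : ℕ, Q ⟨(i0.1 + m) % k, Nat.mod_lt _ i0.pos⟩ := by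
    intro m
    induction m with
    | zero =>
      have : (⟨(i0.1 + 0) % k, Nat.mod_lt _ i0.pos⟩ : Fin k) = i0 :=
        Fin.ext (Nat.mod_eq_of_lt (by omega))
      rw [this]; exact h0
    | succ m ih =>
      have := hs _ ih
      have e : nxt (⟨(i0.1 + m) % k, Nat.mod_lt _ i0.pos⟩ : Fin k) =
          ⟨(i0.1 + (m + 1)) % k, Nat.mod_lt _ i0.pos⟩ := by
        apply Fin.ext
        show ((i0.1 + m) % k + 1) % k = (i0.1 + (m + 1)) % k
        rw [Nat.mod_add_mod, add_assoc]
      rwa [e] at this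
  intro i
  have := key (i.1 + k - i0.1)
  have e : (⟨(i0.1 + (i.1 + k - i0.1)) % k, Nat.mod_lt _ i0.pos⟩ : Fin k) = i := by
    apply Fin.ext
    show (i0.1 + (i.1 + k - i0.1)) % k = i.1
    rw [show i0.1 + (i.1 + k - i0.1) = i.1 + k by omega, Nat.add_mod_right]
    exact Nat.mod_eq_of_lt i.2
  rwa [e] at this

lemma isArc_segment {v w : E3} (h : v ≠ w) : IsArc (segment ℝ v w) v w := by
  have hh : HomeoOn (AffineMap.lineMap v w : ℝ → E3) (Icc 0 1) (segment ℝ v w) := by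
    refine ⟨(AffineMap.lineMap_continuous).continuousOn, ?_⟩
    rw [segment_eq_image_lineMap]
    exact (AffineMap.lineMap_injective ℝ h).injOn.bijOn_image
  have := IsArc.of_param (zero_lt_one) hh
  rwa [AffineMap.lineMap_apply_zero, AffineMap.lineMap_apply_one] at this

/-- Combinatorial belts. -/
structure CB (Φ : Set (Set E3)) {k : ℕ} (B : Fin k → Set E3) : Prop where
  hk : 3 ≤ k
  mem : ∀ i, B i ∈ Φ
  inj : Function.Injective B
  meet : ∀ i, (B i ∩ B (nxt i)).Nonempty
  adj : ∀ p q, p ≠ q → (B p ∩ B q).Nonempty → q = nxt p ∨ p = nxt q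
  no3 : ∀ p q r, p ≠ q → p ≠ r → q ≠ r → ∀ x, x ∈ B p → x ∈ B q → x ∈ B r → False

lemma CB.nxt_ne {B : Fin k → Set E3} (c : CB Φ B) (i : Fin k) : i ≠ nxt i := by
  have := c.hk
  intro h
  have := congrArg Fin.val h
  rw [nxt_val] at this
  split_ifs at this <;> omega

lemma CB.nxt2_ne {B : Fin k → Set E3} (c : CB Φ B) (i : Fin k) : i ≠ nxt (nxt i) := by
  have := c.hk
  intro h
  have := congrArg Fin.val h
  rw [nxt_val, nxt_val] at this
  split_ifs at this <;> omega

lemma CB.ne {B : Fin k → Set E3} (c : CB Φ B) (i : Fin k) : B i ≠ B (nxt i) :=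
  fun h => c.nxt_ne i (c.inj h)

/-- Vertices of the belt edges are covered by outer facets. -/
lemma CB.vert_out {B : Fin k → Set E3} (c : CB Φ B) (h : SG Φ V) {i : Fin k} {x : E3}
    (hx : x ∈ V) (xm : x ∈ B i ∩ B (nxt i)) : ∃ H ∈ Φ \ range B, x ∈ H := by
  obtain ⟨H, hH, h2, h3, xH⟩ := h.third hx (c.mem i) (c.mem _) (c.ne i) xm.1 xm.2
  refine ⟨H, ⟨hH, ?_⟩, xH⟩
  rintro ⟨j, rfl⟩
  exact c.no3 i (nxt i) j (c.nxt_ne i) (fun e => h2 (e ▸ rfl)) (fun e => h3 (e ▸ rfl)) x xm.1 xm.2 xH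

/-- A splitting of the complement of the belt. -/
structure BS (Φ : Set (Set E3)) (V : Set E3) {k : ℕ} (B : Fin k → Set E3) (T1 T2 : Set (Set E3)) :
    Prop where
  un : T1 ∪ T2 = Φ \ range B
  dj : ∀ F ∈ T1, ∀ G ∈ T2, ∀ x, x ∈ F → x ∈ G → False
  ends : ∀ i, ∃ u ∈ V, ∃ w ∈ V, u ∈ B i ∩ B (nxt i) ∧ w ∈ B i ∩ B (nxt i) ∧ u ∈ ⋃₀ T1 ∧ w ∈ ⋃₀ T2

lemma BS.symm {B : Fin k → Set E3} {T1 T2 : Set (Set E3)} (b : BS Φ V B T1 T2) :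
    BS Φ V B T2 T1 := by
  refine ⟨by rw [union_comm, b.un], fun F hF G hG x xF xG => b.dj G hG F hF x xG xF, fun i => ?_⟩
  obtain ⟨u, hu, w, hw, um, wm, u1, w1⟩ := b.ends i
  exact ⟨w, hw, u, hu, wm, um, w1, u1⟩

lemma CB.star {B : Fin k → Set E3} (c : CB Φ B) (h : SG Φ V) {i0 : Fin k} (h0 : i0.1 = 0) {u w : E3}
    (hu : u ∈ V) (hw : w ∈ V) (hne : u ≠ w) (um : u ∈ B i0 ∩ B (nxt i0))
    (wm : w ∈ B i0 ∩ B (nxt i0)) : ¬ Relation.ReflTransGen (BRel Φ V (range B)) u w := by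
  classical
  intro hr
  have hk := c.hk
  have hS : range B ⊆ Φ := by rintro _ ⟨i, rfl⟩; exact c.mem i
  obtain ⟨q, q1, q2⟩ := h.chain hS hr
  obtain ⟨heq, hall⟩ := h.seg_of_two (c.mem i0) (c.mem (nxt i0)) (c.ne i0) hu um hw wm hne
  have hZ := (q2.add (h.ed_cob (c.mem i0) (c.mem (nxt i0)) (c.ne i0))).congr (g' := fun _ => 0)
    fun x hx => by
      by_cases e1 : x = u
      · rw [if_pos e1, if_neg (fun e => hne (e1.symm.trans e)), if_pos (e1 ▸ um)]; decide
      · by_cases e2 : x = w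
        · rw [if_neg e1, if_pos e2, if_pos (e2 ▸ wm)]; decide
        · rw [if_neg e1, if_neg e2, if_neg]
          · decide
          · intro hh
            rcases hall x hx hh with e | e
            · exact e1 e
            · exact e2 e
  obtain ⟨T, hT⟩ := h.lemmaJ hZ
  have hmix : ∀ i j, q (B i) (B j) = 0 := fun i j => q1 _ _ (by
    have h1 : B i ∈ range B := ⟨i, rfl⟩
    have h2 : B j ∈ range B := ⟨j, rfl⟩
    unfold Mixed; tauto)
  have eq0 : ∀ a b : ZMod 2, 0 = a + b → a = b := by decide
  have step : ∀ i, i ≠ i0 → T (B i) = T (B (nxt i)) := by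
    intro i hi
    have := hT (B i) (c.mem i) (B (nxt i)) (c.mem _) (c.ne i) (c.meet i)
    rw [hmix, zero_add, ed, if_neg] at this
    · exact eq0 _ _ this
    · rintro (⟨e, -⟩ | ⟨e, e'⟩)
      · exact hi (c.inj e)
      · have e := c.inj e
        have e' := c.inj e'
        rw [e] at e'
        exact c.nxt2_ne i0 e'.symm
  have h1 := hT (B i0) (c.mem i0) (B (nxt i0)) (c.mem _) (c.ne i0) (c.meet i0)
  rw [hmix, zero_add, ed, if_pos (Or.inl ⟨rfl, rfl⟩)] at h1
  have all : ∀ m : ℕ, ∀ hm : m < k, 1 ≤ m → T (B ⟨m, hm⟩) = T (B (nxt i0)) := by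
    intro m
    induction m with
    | zero => intro _ h; omega
    | succ m ih =>
      intro hm _
      by_cases hm0 : m = 0
      · subst hm0
        congr 2
        apply Fin.ext
        rw [nxt_val]
        split_ifs <;> (try simp only at *) <;> omega
      · rw [← ih (by omega) (by omega), step ⟨m, by omega⟩ (fun e => hm0 (by
          have := congrArg Fin.val e
          simp only at this; omega))]
        congr 2
        apply Fin.ext
        rw [nxt_val]
        split_ifs <;> (try simp only at *) <;> omega
  have h2 := all (k - 1) (by omega) (by omega)
  rw [step ⟨k - 1, by omega⟩ (fun e => by
          have := congrArg Fin.val e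
          simp only at this; omega)] at h2
  have e : nxt (⟨k - 1, by omega⟩ : Fin k) = i0 := by
    apply Fin.ext
    rw [nxt_val]
    split_ifs <;> (try simp only at *) <;> omega
  rw [e] at h2
  rw [h2] at h1
  generalize T (B (nxt i0)) = t at h1
  revert t; decide

/-- Quadrilateral structure of a belt facet. -/
structure Qd (Φ : Set (Set E3)) {k : ℕ} (B : Fin k → Set E3) (T1 T2 : Set (Set E3)) (i : Fin k)
    (p q p' q' : E3) : Prop where
  ae : IsArc (B (prv i) ∩ B i) p q
  ae' : IsArc (B i ∩ B (nxt i)) p' q'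
  a1 : IsArc (B i ∩ ⋃₀ T1) p p'
  a2 : IsArc (B i ∩ ⋃₀ T2) q q'
  un : B i ∩ ⋃₀ (Φ \ {B i}) =
    (B (prv i) ∩ B i) ∪ (B i ∩ B (nxt i)) ∪ (B i ∩ ⋃₀ T1) ∪ (B i ∩ ⋃₀ T2)
  e1 : (B (prv i) ∩ B i) ∩ (B i ∩ ⋃₀ T1) = {p}
  e1' : (B i ∩ B (nxt i)) ∩ (B i ∩ ⋃₀ T1) = {p'}
  e2 : (B (prv i) ∩ B i) ∩ (B i ∩ ⋃₀ T2) = {q}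
  e2' : (B i ∩ B (nxt i)) ∩ (B i ∩ ⋃₀ T2) = {q'}

lemma CB.quadr {B : Fin k → Set E3} (c : CB Φ B) (h : SG Φ V) {T1 T2 : Set (Set E3)}
    (un : T1 ∪ T2 = Φ \ range B) (dj : ∀ F ∈ T1, ∀ G ∈ T2, ∀ x, x ∈ F → x ∈ G → False) (i : Fin k)
    {u w : E3} (hu : u ∈ V) (hw : w ∈ V) (um : u ∈ B (prv i) ∩ B i) (wm : w ∈ B (prv i) ∩ B i)
    (u1 : u ∈ ⋃₀ T1) (w1 : w ∈ ⋃₀ T2) : ∃ p q p' q', p' ∈ V ∧ q' ∈ V ∧ Qd Φ B T1 T2 i p q p' q' := by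
  have hnp : nxt (prv i) = i := nxt_prv i
  have hpi : prv i ≠ i := fun e => c.nxt_ne (prv i) (by rw [hnp]; exact e)
  have hpn : prv i ≠ nxt i := fun e => c.nxt2_ne (prv i) (by rw [hnp]; exact e)
  have hin := c.nxt_ne i
  have hBp : B (prv i) ≠ B i := fun e => hpi (c.inj e)
  have hBn := c.ne i
  have hT1 : T1 ⊆ Φ := fun F hF => (un ▸ Or.inl hF : F ∈ Φ \ range B).1
  have hT2 : T2 ⊆ Φ := fun F hF => (un ▸ Or.inr hF : F ∈ Φ \ range B).1
  have hT1B : ∀ F ∈ T1, ∀ j, B j ≠ F := fun F hF j e =>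
    (un ▸ Or.inl hF : F ∈ Φ \ range B).2 ⟨j, e⟩
  have hT2B : ∀ F ∈ T2, ∀ j, B j ≠ F := fun F hF j e =>
    (un ▸ Or.inr hF : F ∈ Φ \ range B).2 ⟨j, e⟩
  have me : (B (prv i) ∩ B i).Nonempty := ⟨u, um⟩
  have hdis : ∀ x, x ∈ B (prv i) ∩ B i → x ∈ B i ∩ B (nxt i) → False := fun x hx hx' =>
    c.no3 (prv i) i (nxt i) hpi hpn hin x hx.1 hx.2 hx'.2
  have dj' : ∀ x, x ∈ ⋃₀ T1 → x ∈ ⋃₀ T2 → False := by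
    rintro x ⟨F, hF, xF⟩ ⟨G, hG, xG⟩
    exact dj F hF G hG x xF xG
  obtain ⟨p, q, p', q', K1, K2, ae, ae', a1, a2, hC, x1, x1', x2, x2', hK⟩ :=
    circle_split4 (h.disc (B i) (c.mem i)).isCirc (e := B (prv i) ∩ B i) (e' := B i ∩ B (nxt i))
    (fun x hx => ⟨hx.2, B (prv i), ⟨c.mem _, hBp⟩, hx.1⟩)
    (fun x hx => ⟨hx.1, B (nxt i), ⟨c.mem _, hBn.symm⟩, hx.2⟩)
    ((h.isCompact (c.mem _)).isClosed.inter (h.isCompact (c.mem _)).isClosed)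
    ((h.isCompact (c.mem _)).isClosed.inter (h.isCompact (c.mem _)).isClosed)
    (h.edge_conn (c.mem _) (c.mem _) hBp me)
    (h.edge_conn (c.mem _) (c.mem _) hBn (c.meet i))
    (h.edge_nontriv (c.mem _) (c.mem _) hBp me)
    (h.edge_nontriv (c.mem _) (c.mem _) hBn (c.meet i))
    (disjoint_left.2 hdis)
  -- end points are vertices
  have huw : u ≠ w := by rintro rfl; exact dj' u u1 w1
  obtain ⟨es, eall⟩ := h.seg_of_two (c.mem _) (c.mem _) hBp hu um hw wm huw
  have ends := ae.endpoints (es ▸ isArc_segment huw)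
  obtain ⟨s, hs, t, ht, hst, es', eall'⟩ := h.edge _ (c.mem _) _ (c.mem _) hBn (c.meet i)
  have ends' := ae'.endpoints (es' ▸ isArc_segment hst)
  have pqV : p ∈ V ∧ q ∈ V := by
    rcases ends with ⟨rfl, rfl⟩ | ⟨rfl, rfl⟩ <;> exact ⟨by assumption, by assumption⟩
  have pqV' : p' ∈ V ∧ q' ∈ V := by
    rcases ends' with ⟨rfl, rfl⟩ | ⟨rfl, rfl⟩ <;> exact ⟨by assumption, by assumption⟩
  have outV : ∀ x ∈ V, x ∈ B (prv i) ∩ B i ∨ x ∈ B i ∩ B (nxt i) → x ∈ ⋃₀ T1 ∪ ⋃₀ T2 := by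
    intro x hx hx'
    have : ∃ H ∈ Φ \ range B, x ∈ H := by
      rcases hx' with hx' | hx'
      · exact c.vert_out h (i := prv i) hx (by rw [hnp]; exact hx')
      · exact c.vert_out h hx hx'
    rw [← sUnion_union, un]
    exact this
  have out : ∀ K : Set E3, K ⊆ B i ∩ ⋃₀ (Φ \ {B i}) → (∀ x ∈ K, x ∈ B (prv i) ∩ B i → x ∈ V) →
      (∀ x ∈ K, x ∈ B i ∩ B (nxt i) → x ∈ V) → IsConnected K →
      K ⊆ ⋃₀ T1 ∨ K ⊆ ⋃₀ T2 := by
    intro K hKC k1 k2 hKc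
    have hsub : K ⊆ ⋃₀ T1 ∪ ⋃₀ T2 := by
      intro x hx
      obtain ⟨xi, G, hG, xG⟩ := hKC hx
      by_cases hGr : G ∈ range B
      · obtain ⟨j, rfl⟩ := hGr
        have hij : i ≠ j := by rintro rfl; exact hG.2 rfl
        rcases c.adj i j hij ⟨x, xi, xG⟩ with rfl | e
        · exact outV x (k2 x hx ⟨xi, xG⟩) (Or.inr ⟨xi, xG⟩)
        · have : j = prv i := by rw [e, prv_nxt]
          subst this
          exact outV x (k1 x hx ⟨xG, xi⟩) (Or.inl ⟨xG, xi⟩)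
      · rw [← sUnion_union, un]
        exact ⟨G, ⟨hG.1, hGr⟩, xG⟩
    have := isPreconnected_iff_subset_of_disjoint_closed.1 hKc.isPreconnected (⋃₀ T1) (⋃₀ T2)
      (h.isClosed_sUnion hT1) (h.isClosed_sUnion hT2) hsub (by
        rw [← disjoint_iff_inter_eq_empty, disjoint_left]
        exact fun x _ hx => dj' x hx.1 hx.2)
    exact this
  have m1 : ∀ x ∈ B (prv i) ∩ B i, x ∈ K1 → x = p := fun x hx hx' => by
    have : x ∈ (B (prv i) ∩ B i) ∩ K1 := ⟨hx, hx'⟩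
    rw [x1] at this; exact this
  have m1' : ∀ x ∈ B i ∩ B (nxt i), x ∈ K1 → x = p' := fun x hx hx' => by
    have : x ∈ (B i ∩ B (nxt i)) ∩ K1 := ⟨hx, hx'⟩
    rw [x1'] at this; exact this
  have m2 : ∀ x ∈ B (prv i) ∩ B i, x ∈ K2 → x = q := fun x hx hx' => by
    have : x ∈ (B (prv i) ∩ B i) ∩ K2 := ⟨hx, hx'⟩
    rw [x2] at this; exact this
  have m2' : ∀ x ∈ B i ∩ B (nxt i), x ∈ K2 → x = q' := fun x hx hx' => by
    have : x ∈ (B i ∩ B (nxt i)) ∩ K2 := ⟨hx, hx'⟩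
    rw [x2'] at this; exact this
  have sub1 : K1 ⊆ B i ∩ ⋃₀ (Φ \ {B i}) := by rw [hC]; exact fun x hx => Or.inl (Or.inr hx)
  have sub2 : K2 ⊆ B i ∩ ⋃₀ (Φ \ {B i}) := by rw [hC]; exact fun x hx => Or.inr hx
  have o1 := out K1 sub1 (fun x hx hx' => m1 x hx' hx ▸ pqV.1)
    (fun x hx hx' => m1' x hx' hx ▸ pqV'.1) a1.isConnected
  have o2 := out K2 sub2 (fun x hx hx' => m2 x hx' hx ▸ pqV.2)
    (fun x hx hx' => m2' x hx' hx ▸ pqV'.2) a2.isConnected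
  -- a general finishing step
  have fin : ∀ (p q p' q' : E3) (K1 K2 : Set E3), IsArc (B (prv i) ∩ B i) p q →
      IsArc (B i ∩ B (nxt i)) p' q' → IsArc K1 p p' → IsArc K2 q q' →
      B i ∩ ⋃₀ (Φ \ {B i}) = (B (prv i) ∩ B i) ∪ (B i ∩ B (nxt i)) ∪ K1 ∪ K2 →
      (B (prv i) ∩ B i) ∩ K1 = {p} → (B i ∩ B (nxt i)) ∩ K1 = {p'} →
      (B (prv i) ∩ B i) ∩ K2 = {q} → (B i ∩ B (nxt i)) ∩ K2 = {q'} →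
      K1 ⊆ ⋃₀ T1 → K2 ⊆ ⋃₀ T2 → Qd Φ B T1 T2 i p q p' q' := by
    intro p q p' q' K1 K2 ae ae' a1 a2 hC x1 x1' x2 x2' s1 s2
    have sub1 : K1 ⊆ B i ∩ ⋃₀ (Φ \ {B i}) := by rw [hC]; exact fun x hx => Or.inl (Or.inr hx)
    have sub2 : K2 ⊆ B i ∩ ⋃₀ (Φ \ {B i}) := by rw [hC]; exact fun x hx => Or.inr hx
    -- vertices on edges
    have onV : ∀ x ∈ V, x ∈ B (prv i) ∩ B i → x = p ∨ x = q := by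
      intro x hx hx'
      have e := ae.endpoints (es ▸ isArc_segment huw)
      have e2 := eall x hx hx'
      rcases e with ⟨rfl, rfl⟩ | ⟨rfl, rfl⟩
      · exact e2
      · exact e2.symm
    have onV' : ∀ x ∈ V, x ∈ B i ∩ B (nxt i) → x = p' ∨ x = q' := by
      intro x hx hx'
      have e := ae'.endpoints (es' ▸ isArc_segment hst)
      have e2 := eall' x hx hx'
      rcases e with ⟨rfl, rfl⟩ | ⟨rfl, rfl⟩
      · exact e2
      · exact e2.symm
    have f1 : B i ∩ ⋃₀ T1 = K1 := by
      apply Subset.antisymm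
      · rintro x ⟨xi, F, hF, xF⟩
        have hx : x ∈ B i ∩ ⋃₀ (Φ \ {B i}) := ⟨xi, F, ⟨hT1 hF, (hT1B F hF i).symm⟩, xF⟩
        rw [hC] at hx
        rcases hx with ((hx | hx) | hx) | hx
        · have xV := h.triple _ (c.mem _) _ (c.mem _) F (hT1 hF) hBp (hT1B F hF _) (hT1B F hF _) x
            hx.1 hx.2 xF
          rcases onV x xV hx with rfl | rfl
          · exact a1.2.1
          · exact (dj' x ⟨F, hF, xF⟩ (s2 a2.2.1)).elim
        · have xV := h.triple _ (c.mem _) _ (c.mem _) F (hT1 hF) hBn (hT1B F hF _) (hT1B F hF _) x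
            hx.1 hx.2 xF
          rcases onV' x xV hx with rfl | rfl
          · exact a1.2.2.1
          · exact (dj' x ⟨F, hF, xF⟩ (s2 a2.2.2.1)).elim
        · exact hx
        · exact (dj' x ⟨F, hF, xF⟩ (s2 hx)).elim
      · exact fun x hx => ⟨(sub1 hx).1, s1 hx⟩
    have f2 : B i ∩ ⋃₀ T2 = K2 := by
      apply Subset.antisymm
      · rintro x ⟨xi, F, hF, xF⟩
        have hx : x ∈ B i ∩ ⋃₀ (Φ \ {B i}) := ⟨xi, F, ⟨hT2 hF, (hT2B F hF i).symm⟩, xF⟩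
        rw [hC] at hx
        rcases hx with ((hx | hx) | hx) | hx
        · have xV := h.triple _ (c.mem _) _ (c.mem _) F (hT2 hF) hBp (hT2B F hF _) (hT2B F hF _) x
            hx.1 hx.2 xF
          rcases onV x xV hx with rfl | rfl
          · exact (dj' x (s1 a1.2.1) ⟨F, hF, xF⟩).elim
          · exact a2.2.1
        · have xV := h.triple _ (c.mem _) _ (c.mem _) F (hT2 hF) hBn (hT2B F hF _) (hT2B F hF _) x
            hx.1 hx.2 xF
          rcases onV' x xV hx with rfl | rfl
          · exact (dj' x (s1 a1.2.2.1) ⟨F, hF, xF⟩).elim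
          · exact a2.2.2.1
        · exact (dj' x (s1 hx) ⟨F, hF, xF⟩).elim
        · exact hx
      · exact fun x hx => ⟨(sub2 hx).1, s2 hx⟩
    exact ⟨ae, ae', f1 ▸ a1, f2 ▸ a2, by rw [f1, f2]; exact hC, by rw [f1]; exact x1,
      by rw [f1]; exact x1', by rw [f2]; exact x2, by rw [f2]; exact x2'⟩
  have pk := a1.2.1
  have qk := a2.2.1
  have dec : (K1 ⊆ ⋃₀ T1 ∧ K2 ⊆ ⋃₀ T2) ∨ (K2 ⊆ ⋃₀ T1 ∧ K1 ⊆ ⋃₀ T2) := by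
    rcases ends with ⟨rfl, rfl⟩ | ⟨rfl, rfl⟩
    · left
      exact ⟨o1.resolve_right fun hh => dj' _ u1 (hh pk), o2.resolve_left fun hh => dj' _ (hh qk) w1⟩
    · right
      exact ⟨o2.resolve_right fun hh => dj' _ u1 (hh qk), o1.resolve_left fun hh => dj' _ (hh pk) w1⟩
  rcases dec with ⟨s1, s2⟩ | ⟨s1, s2⟩
  · exact ⟨p, q, p', q', pqV'.1, pqV'.2,
      fin p q p' q' K1 K2 ae ae' a1 a2 hC x1 x1' x2 x2' s1 s2⟩
  · refine ⟨q, p, q', p', pqV'.2, pqV'.1,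
      fin q p q' p' K2 K1 ae.symm ae'.symm a2 a1 ?_ x2 x2' x1 x1' s1 s2⟩
    rw [hC, union_assoc, union_comm K1 K2, ← union_assoc]

end belt

section belt2

variable {Φ : Set (Set E3)} {V : Set E3} {k : ℕ}

lemma CB.conn {B : Fin k → Set E3} (c : CB Φ B) : Conn (range B) := by
  intro X hX hne hne'
  obtain ⟨F, hF⟩ := hne
  obtain ⟨G, hG, hGX⟩ := hne'
  by_contra hcon
  push Not at hcon
  obtain ⟨i0, rfl⟩ := hX hF
  obtain ⟨j, rfl⟩ := hG
  have all : ∀ i, B i ∈ X := cyc_ind i0 hF fun i hi => by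
    by_contra hn
    have := hcon _ hi (B (nxt i)) ⟨⟨_, rfl⟩, hn⟩
    exact (c.meet i).ne_empty this
  exact hGX (all j)

lemma Conn.union {S S' : Set (Set E3)} (c : Conn S) (c' : Conn S') {F G : Set E3} (hF : F ∈ S)
    (hG : G ∈ S') (hFG : (F ∩ G).Nonempty) : Conn (S ∪ S') := by
  intro T hT hne hne'
  by_contra hcon
  push Not at hcon
  have key : ∀ R : Set (Set E3), Conn R → R ⊆ S ∪ S' → ∀ A ∈ R, A ∈ T → R ⊆ T := by
    intro R hR hRS A hA hAT D hD
    by_contra hn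
    obtain ⟨A', hA', D', hD', hm⟩ := hR (R ∩ T) inter_subset_left ⟨A, hA, hAT⟩
      ⟨D, hD, fun hh => hn hh.2⟩
    exact hm.ne_empty (hcon A' hA'.2 D' ⟨hRS hD'.1, fun hh => hD'.2 ⟨hD'.1, hh⟩⟩)
  have k1 := key S c subset_union_left
  have k2 := key S' c' subset_union_right
  have hiff : F ∈ T ↔ G ∈ T := by
    constructor
    · intro h1
      by_contra h2
      exact hFG.ne_empty (hcon F h1 G ⟨Or.inr hG, h2⟩)
    · intro h1
      by_contra h2
      rw [inter_comm] at hFG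
      exact hFG.ne_empty (hcon G h1 F ⟨Or.inl hF, h2⟩)
  have hFT : F ∈ T ∧ G ∈ T := by
    obtain ⟨A, hA⟩ := hne
    rcases hT hA with h1 | h1
    · have := k1 A h1 hA hF
      exact ⟨this, hiff.1 this⟩
    · have := k2 A h1 hA hG
      exact ⟨hiff.2 this, this⟩
  obtain ⟨D, hD, hDT⟩ := hne'
  rcases hD with h1 | h1
  · exact hDT (k1 F hF hFT.1 h1)
  · exact hDT (k2 G hG hFT.2 h1)

lemma zmod2_add_eq_zero {a b : ZMod 2} (h : 0 = a + b) : a = b := by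
  revert a b; decide

lemma zmod2_add_eq_one {a b : ZMod 2} (h : 1 = a + b) : a ≠ b := by
  revert a b; decide

lemma CB.split {B : Fin k → Set E3} (c : CB Φ B) (h : SG Φ V) : ∃ T1 T2, BS Φ V B T1 T2 := by
  classical
  have hk := c.hk
  have i0pos : 0 < k := by omega
  let i0 : Fin k := ⟨0, i0pos⟩
  obtain ⟨u, hu, w, hw, huw, heq, -⟩ :=
    h.edge (B i0) (c.mem i0) (B (nxt i0)) (c.mem _) (c.ne i0) (c.meet i0)
  have um : u ∈ B i0 ∩ B (nxt i0) := heq ▸ left_mem_segment ℝ u w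
  have wm : w ∈ B i0 ∩ B (nxt i0) := heq ▸ right_mem_segment ℝ u w
  obtain ⟨T, hT⟩ := h.lemmaJ (zc_cob (Φ := Φ) (V := V) (S := range B) u)
  have nonmix : ∀ F G, (F ∈ range B ↔ G ∈ range B) → zc Φ V (range B) u F G = 0 := by
    intro F G hFG
    unfold zc
    rw [if_neg]
    rintro ⟨hm, -⟩
    unfold Mixed at hm
    tauto
  have ct : ∀ F ∈ range B, ∀ G ∈ range B, T F = T G := by
    apply c.conn.const
    rintro _ ⟨i, rfl⟩ _ ⟨j, rfl⟩ hne hm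
    have := hT _ (c.mem i) _ (c.mem j) hne hm
    rw [nonmix _ _ (by simp)] at this
    exact zmod2_add_eq_zero this
  let T1 : Set (Set E3) := {F | F ∈ Φ \ range B ∧ T F ≠ T (B i0)}
  let T2 : Set (Set E3) := {F | F ∈ Φ \ range B ∧ T F = T (B i0)}
  have un : T1 ∪ T2 = Φ \ range B := by
    ext F
    constructor
    · rintro (h1 | h1)
      · exact h1.1
      · exact h1.1
    · intro h1
      by_cases h2 : T F = T (B i0)
      · exact Or.inr ⟨h1, h2⟩
      · exact Or.inl ⟨h1, h2⟩
  have dj : ∀ F ∈ T1, ∀ G ∈ T2, ∀ x, x ∈ F → x ∈ G → False := by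
    intro F hF G hG x xF xG
    have hne : F ≠ G := by rintro rfl; exact hF.2 hG.2
    have := hT F hF.1.1 G hG.1.1 hne ⟨x, xF, xG⟩
    rw [nonmix F G (iff_of_false hF.1.2 hG.1.2)] at this
    exact hF.2 ((zmod2_add_eq_zero this).trans hG.2)
  obtain ⟨H, hH, uH⟩ := c.vert_out h hu um
  obtain ⟨H', hH', wH⟩ := c.vert_out h hw wm
  have hneH : ∀ H ∈ Φ \ range B, B i0 ≠ H := fun H hH e => hH.2 ⟨i0, e⟩
  have hHT : H ∈ T1 := by
    have := hT (B i0) (c.mem i0) H hH.1 (hneH H hH) ⟨u, um.1, uH⟩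
    rw [zc_eq (c.mem i0) hH.1 hu ⟨um.1, uH⟩,
      if_pos ⟨Or.inl ⟨⟨i0, rfl⟩, hH.2⟩, Relation.ReflTransGen.refl⟩] at this
    exact ⟨hH, (zmod2_add_eq_one this).symm⟩
  have hHT' : H' ∈ T2 := by
    have := hT (B i0) (c.mem i0) H' hH'.1 (hneH H' hH') ⟨w, wm.1, wH⟩
    rw [zc_eq (c.mem i0) hH'.1 hw ⟨wm.1, wH⟩,
      if_neg (fun hh => c.star h rfl hu hw huw um wm hh.2)] at this
    exact ⟨hH', (zmod2_add_eq_zero this).symm⟩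
  refine ⟨T1, T2, un, dj, cyc_ind i0 ⟨u, hu, w, hw, um, wm, ⟨H, hHT, uH⟩, ⟨H', hHT', wH⟩⟩ ?_⟩
  rintro i ⟨u, hu, w, hw, um, wm, u1, w1⟩
  obtain ⟨p, q, p', q', hp', hq', Q⟩ := c.quadr h un dj (nxt i) hu hw
    (by rw [prv_nxt]; exact um) (by rw [prv_nxt]; exact wm) u1 w1
  have e1 := Q.e1'.ge rfl
  have e2 := Q.e2'.ge rfl
  exact ⟨p', hp', q', hq', e1.1, e2.1, e1.2.2, e2.2.2⟩

variable {T1 T2 : Set (Set E3)} {B : Fin k → Set E3}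

lemma BS.sub1 (b : BS Φ V B T1 T2) : T1 ⊆ Φ \ range B := b.un ▸ subset_union_left

lemma BS.dj' (b : BS Φ V B T1 T2) : ∀ x, x ∈ ⋃₀ T1 → x ∈ ⋃₀ T2 → False := by
  rintro x ⟨F, hF, xF⟩ ⟨G, hG, xG⟩
  exact b.dj F hF G hG x xF xG

lemma BS.qd (b : BS Φ V B T1 T2) (c : CB Φ B) (h : SG Φ V) :
    ∃ a d : Fin k → E3, ∀ i, Qd Φ B T1 T2 i (a (prv i)) (d (prv i)) (a i) (d i) := by
  have : ∀ i, ∃ p q p' q', Qd Φ B T1 T2 i p q p' q' := by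
    intro i
    obtain ⟨u, hu, w, hw, um, wm, u1, w1⟩ := b.ends (prv i)
    rw [nxt_prv] at um wm
    obtain ⟨p, q, p', q', -, -, Q⟩ := c.quadr h b.un b.dj i hu hw um wm u1 w1
    exact ⟨p, q, p', q', Q⟩
  choose p q p' q' Q using this
  refine ⟨p', q', fun i => ?_⟩
  have h1 := (Q i).e1.ge rfl
  have h2 := (Q i).e2.ge rfl
  have g1 : p i = p' (prv i) := by
    have := (Q (prv i)).e1'
    rw [nxt_prv] at this
    exact this.le ⟨h1.1, h1.1.1, h1.2.2⟩
  have g2 : q i = q' (prv i) := by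
    have := (Q (prv i)).e2'
    rw [nxt_prv] at this
    exact this.le ⟨h2.1, h2.1.1, h2.2.2⟩
  rw [← g1, ← g2]
  exact Q i

lemma BS.conn1 (b : BS Φ V B T1 T2) (c : CB Φ B) (h : SG Φ V) : Conn T1 := by
  have hk := c.hk
  have i0pos : 0 < k := by omega
  let i0 : Fin k := ⟨0, i0pos⟩
  obtain ⟨a, d, Q⟩ := b.qd c h
  have hT1 : T1 ⊆ Φ := b.sub1.trans sdiff_subset
  have key : ∀ X ⊆ T1, X.Nonempty → (∀ F ∈ X, ∀ G ∈ T1 \ X, F ∩ G = ∅) →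
      ∀ i, B i ∩ ⋃₀ T1 ⊆ ⋃₀ X := by
    intro X hX hne hcl
    have step : ∀ i x, x ∈ B i → x ∈ ⋃₀ X → B i ∩ ⋃₀ T1 ⊆ ⋃₀ X := by
      intro i x xB xX
      have hd : ∀ y, y ∈ ⋃₀ X → y ∈ ⋃₀ (T1 \ X) → False := by
        rintro y ⟨F, hF, yF⟩ ⟨G, hG, yG⟩
        exact (hcl F hF G hG).le ⟨yF, yG⟩
      rcases isPreconnected_iff_subset_of_disjoint_closed.1 (Q i).a1.isConnected.isPreconnected
        (⋃₀ X) (⋃₀ (T1 \ X)) (h.isClosed_sUnion (hX.trans hT1))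
        (h.isClosed_sUnion (sdiff_subset.trans hT1)) (by
          rw [← sUnion_union, union_sdiff_cancel hX]; exact inter_subset_right) (by
        rw [← disjoint_iff_inter_eq_empty, disjoint_left]
        exact fun y _ hy => hd y hy.1 hy.2) with h1 | h1
      · exact h1
      · exact (hd x xX (h1 ⟨xB, sUnion_mono hX xX⟩)).elim
    obtain ⟨A, hA, D, hD, y, yA, yD⟩ := h.conn_all X (hX.trans hT1) hne
      ⟨B i0, c.mem i0, fun hh => (b.sub1 (hX hh)).2 ⟨i0, rfl⟩⟩
    have : D ∈ range B := by
      by_contra hn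
      have hD' : D ∈ T1 ∪ T2 := b.un ▸ ⟨hD.1, hn⟩
      rcases hD' with h1 | h1
      · exact (hcl A hA D ⟨h1, hD.2⟩).le ⟨yA, yD⟩
      · exact b.dj A (hX hA) D h1 y yA yD
    obtain ⟨i, rfl⟩ := this
    refine cyc_ind i (step i y yD ⟨A, hA, yA⟩) fun j hj => ?_
    have e := (Q j).e1'.ge rfl
    exact step (nxt j) (a j) e.1.2 (hj e.2)
  intro X hX hne hne'
  by_contra hcon
  push Not at hcon
  have k1 := key X hX hne hcon i0
  have k2 := key (T1 \ X) sdiff_subset hne' (fun F hF G hG => by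
    rw [inter_comm]
    refine hcon G ?_ F hF
    by_contra hn
    exact hG.2 ⟨hG.1, hn⟩) i0
  have hp := (Q i0).a1.2.1
  obtain ⟨F, hF, xF⟩ := k1 hp
  obtain ⟨G, hG, xG⟩ := k2 hp
  exact (hcon F hF G hG).le ⟨xF, xG⟩

lemma BS.compl1 (b : BS Φ V B T1 T2) (c : CB Φ B) (h : SG Φ V) : Φ \ T1 = range B ∪ T2 := by
  ext F
  constructor
  · rintro ⟨h1, h2⟩
    by_cases hr : F ∈ range B
    · exact Or.inl hr
    · have : F ∈ T1 ∪ T2 := b.un ▸ ⟨h1, hr⟩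
      exact Or.inr (this.resolve_left h2)
  · rintro (⟨i, rfl⟩ | h1)
    · exact ⟨c.mem i, fun hh => (b.sub1 hh).2 ⟨i, rfl⟩⟩
    · have h2 : F ∈ Φ \ range B := b.un ▸ Or.inr h1
      refine ⟨h2.1, fun hh => ?_⟩
      obtain ⟨x, hx⟩ := (h.disc F h2.1).nonempty
      exact b.dj F hh F h1 x hx hx

lemma BS.conn1c (b : BS Φ V B T1 T2) (c : CB Φ B) (h : SG Φ V) : Conn (Φ \ T1) := by
  have hk := c.hk
  have i0pos : 0 < k := by omega
  let i0 : Fin k := ⟨0, i0pos⟩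
  rw [b.compl1 c h]
  obtain ⟨u, hu, w, hw, um, wm, u1, ⟨G, hG, wG⟩⟩ := b.ends i0
  exact c.conn.union (b.symm.conn1 c h) (F := B i0) ⟨i0, rfl⟩ hG ⟨w, wm.1, wG⟩

lemma BS.bd1 (b : BS Φ V B T1 T2) (c : CB Φ B) (h : SG Φ V) :
    ⋃₀ T1 ∩ ⋃₀ (Φ \ T1) = ⋃₀ T1 ∩ ⋃ i, B i := by
  rw [b.compl1 c h, sUnion_union, sUnion_range]
  ext x
  constructor
  · rintro ⟨h1, h2 | h2⟩
    · exact ⟨h1, h2⟩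
    · exact (b.dj' x h1 h2).elim
  · rintro ⟨h1, h2⟩
    exact ⟨h1, Or.inl h2⟩

lemma BS.nonempty1 (b : BS Φ V B T1 T2) (c : CB Φ B) : T1.Nonempty := by
  have hk := c.hk
  have i0pos : 0 < k := by omega
  obtain ⟨u, hu, w, hw, um, wm, ⟨G, hG, -⟩, -⟩ := b.ends ⟨0, i0pos⟩
  exact ⟨G, hG⟩

lemma BS.nonempty1c (b : BS Φ V B T1 T2) (c : CB Φ B) : (Φ \ T1).Nonempty := by
  have hk := c.hk
  have i0pos : 0 < k := by omega
  exact ⟨B ⟨0, i0pos⟩, c.mem _, fun hh => (b.sub1 hh).2 ⟨_, rfl⟩⟩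

lemma BS.disc1 (b : BS Φ V B T1 T2) (c : CB Φ B) (h : SG Φ V) :
    IsDisc (⋃₀ T1) (⋃₀ T1 ∩ ⋃ i, B i) := by
  rw [← b.bd1 c h]
  exact h.disc_thm _ T1 (b.sub1.trans sdiff_subset) rfl (b.nonempty1 c) (b.nonempty1c c)
    (b.conn1 c h) (b.conn1c c h)

lemma BS.annulus (b : BS Φ V B T1 T2) (c : CB Φ B) (h : SG Φ V) :
    ∃ g : E3 → ℝ × E3, HomeoOn g (⋃ i, B i) (Icc 0 1 ×ˢ (⋃₀ T1 ∩ ⋃ i, B i)) := by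
  obtain ⟨a, d, Q⟩ := b.qd c h
  have cl : ∀ i, IsClosed (B i) := fun i => (h.isCompact (c.mem i)).isClosed
  have hσ : ∀ i, ∃ σ : E3 → ℝ, HomeoOn σ (B i ∩ B (nxt i)) (Icc 0 1) ∧ σ (a i) = 0 ∧ σ (d i) = 1 :=
    fun i => (Q i).ae'.2.2.2
  choose σ s1 s2 s3 using hσ
  have hG : ∀ i, ∃ g : E3 → ℝ × E3, HomeoOn g (B i) (Icc 0 1 ×ˢ (B i ∩ ⋃₀ T1)) ∧
      (∀ x ∈ B (prv i) ∩ B i, g x = (σ (prv i) x, a (prv i))) ∧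
      (∀ x ∈ B i ∩ B (nxt i), g x = (σ i x, a i)) := by
    intro i
    have s1p := s1 (prv i)
    rw [nxt_prv] at s1p
    have hpi : prv i ≠ i := fun e => c.nxt_ne (prv i) (by rw [nxt_prv]; exact e)
    have hpn : prv i ≠ nxt i := fun e => c.nxt2_ne (prv i) (by rw [nxt_prv]; exact e)
    refine quad (h.disc (B i) (c.mem i)) (Q i).un ((cl _).inter (cl _)) ((cl _).inter (cl _)) ?_ s1p
      (s2 _) (s3 _) (s1 i) (s2 i) (s3 i) (Q i).a1 (Q i).a2 (Q i).e1 (Q i).e1' (Q i).e2 (Q i).e2' ?_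
    · rw [eq_empty_iff_forall_notMem]
      rintro x ⟨h1, h2⟩
      exact c.no3 (prv i) i (nxt i) hpi hpn (c.nxt_ne i) x h1.1 h1.2 h2.2
    · rw [eq_empty_iff_forall_notMem]
      rintro x ⟨h1, h2⟩
      exact b.dj' x h1.2 h2.2
  choose G g1 g2 g3 using hG
  obtain ⟨g, hg, -⟩ := paste_homeo B (fun i => Icc 0 1 ×ˢ (B i ∩ ⋃₀ T1)) G
    cl g1 (by
      have key : ∀ i, ∀ x ∈ B i ∩ B (nxt i), G i x = G (nxt i) x := by
        intro i x hx
        rw [g3 i x hx, g2 (nxt i) x (by rw [prv_nxt]; exact hx), prv_nxt]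
      intro i j x hx
      by_cases hij : i = j
      · rw [hij]
      rcases c.adj i j hij ⟨x, hx⟩ with rfl | rfl
      · exact key i x hx
      · exact (key j x hx.symm).symm) (by
      have key : ∀ i, ∀ y ∈ (Icc 0 1 ×ˢ (B i ∩ ⋃₀ T1) : Set (ℝ × E3)) ∩
          Icc 0 1 ×ˢ (B (nxt i) ∩ ⋃₀ T1), ∃ x ∈ B i ∩ B (nxt i), G i x = y ∧ G (nxt i) x = y := by
        rintro i ⟨t, y⟩ ⟨⟨ht, y1, y2⟩, ⟨-, y3, -⟩⟩
        obtain rfl : y = a i := (Q i).e1'.le ⟨⟨y1, y3⟩, y1, y2⟩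
        obtain ⟨x, hx, rfl⟩ := (s1 i).2.surjOn ht
        exact ⟨x, hx, g3 i x hx, by rw [g2 (nxt i) x (by rw [prv_nxt]; exact hx), prv_nxt]⟩
      intro i j y hy
      by_cases hij : i = j
      · subst hij
        obtain ⟨x, hx, rfl⟩ := (g1 i).2.surjOn hy.1
        exact ⟨x, ⟨hx, hx⟩, rfl⟩
      rcases c.adj i j hij ⟨y.2, hy.1.2.1, hy.2.2.1⟩ with rfl | rfl
      · obtain ⟨x, hx, e, -⟩ := key i y hy
        exact ⟨x, hx, e⟩
      · obtain ⟨x, hx, -, e⟩ := key j y hy.symm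
        exact ⟨x, hx.symm, e⟩)
  refine ⟨g, ?_⟩
  have : (⋃ i, (Icc 0 1 ×ˢ (B i ∩ ⋃₀ T1) : Set (ℝ × E3))) = Icc 0 1 ×ˢ (⋃₀ T1 ∩ ⋃ i, B i) := by
    rw [← prod_iUnion, ← iUnion_inter, inter_comm]
  rwa [this] at hg

lemma sphere_homeo : Nonempty (↥(Metric.sphere (0 : ℂ) 1) ≃ₜ
    ↥(Metric.sphere (0 : EuclideanSpace ℝ (Fin 2)) 1)) := by
  have e := Complex.orthonormalBasisOneI.repr
  have h : e.toHomeomorph '' (Metric.sphere (0 : ℂ) 1) = Metric.sphere 0 1 := by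
    have := e.image_sphere 0 1
    rw [map_zero] at this
    exact this
  exact ⟨(e.toHomeomorph.image _).trans (Homeomorph.setCongr h)⟩

lemma closedBall_homeo : Nonempty (↥(Metric.closedBall (0 : ℂ) 1) ≃ₜ
    ↥(Metric.closedBall (0 : EuclideanSpace ℝ (Fin 2)) 1)) := by
  have e := Complex.orthonormalBasisOneI.repr
  have h : e.toHomeomorph '' (Metric.closedBall (0 : ℂ) 1) = Metric.closedBall 0 1 := by
    have := e.image_closedBall 0 1
    rw [map_zero] at this
    exact this
  exact ⟨(e.toHomeomorph.image _).trans (Homeomorph.setCongr h)⟩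

lemma BS.cyl (b : BS Φ V B T1 T2) (c : CB Φ B) (h : SG Φ V) :
    Nonempty (↥(⋃ i, B i) ≃ₜ
      ↥(Set.Icc (0:ℝ) 1) × ↥(Metric.sphere (0 : EuclideanSpace ℝ (Fin 2)) 1)) := by
  obtain ⟨g, hg⟩ := b.annulus c h
  obtain ⟨e1⟩ := hg.homeomorph (isCompact_iUnion fun i => h.isCompact (c.mem i))
  obtain ⟨hC, f, hf⟩ := (b.disc1 c h).isCirc
  obtain ⟨e2⟩ := hf.homeomorph hC
  obtain ⟨e3⟩ := sphere_homeo
  exact ⟨(e1.trans (Homeomorph.Set.prod _ _)).trans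
    ((Homeomorph.refl _).prodCongr (e2.trans e3))⟩

/-- The open part of a disc is connected and dense. -/
lemma IsDisc.open_part {A C : Set E3} (hd : IsDisc A C) :
    IsConnected (A \ C) ∧ closure (A \ C) = A := by
  have hne := hd.nonempty
  obtain ⟨hA, hCA, f, hf, hC⟩ := hd
  obtain ⟨g, hg, l, r⟩ := hf.symm hA hne
  have e : A \ C = g '' Metric.ball 0 1 := by
    ext x
    constructor
    · rintro ⟨h1, h2⟩
      refine ⟨f x, ?_, l x h1⟩
      rw [IsDisc.mem_iff hCA hf hC h1] at h2
      have := hf.2.mapsTo h1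
      rw [mem_closedBall_zero_iff] at this
      rw [mem_ball_zero_iff]
      exact lt_of_le_of_ne this h2
    · rintro ⟨z, hz, rfl⟩
      have hz' := Metric.ball_subset_closedBall hz
      have h1 := hg.2.mapsTo hz'
      refine ⟨h1, ?_⟩
      rw [IsDisc.mem_iff hCA hf hC h1, r z hz']
      rw [mem_ball_zero_iff] at hz
      exact hz.ne
  constructor
  · rw [e]
    exact (Metric.isConnected_ball one_pos).image g (hg.1.mono Metric.ball_subset_closedBall)
  · apply subset_antisymm
    · exact closure_minimal sdiff_subset hA.isClosed
    · rw [e, ← hg.image_eq]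
      have : Metric.closedBall (0 : ℂ) 1 = closure (Metric.ball 0 1) :=
        (closure_ball _ one_ne_zero).symm
      rw [this]
      apply ContinuousOn.image_closure
      rw [← this]
      exact hg.1

end belt2

section final

variable {Φ : Set (Set E3)} {V : Set E3} {k : ℕ} {T1 T2 : Set (Set E3)} {B : Fin k → Set E3}

lemma BS.open1 (b : BS Φ V B T1 T2) (c : CB Φ B) (h : SG Φ V) :
    IsConnected (⋃₀ T1 \ ⋃ i, B i) ∧ closure (⋃₀ T1 \ ⋃ i, B i) = ⋃₀ T1 := by
  have := (b.disc1 c h).open_part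
  rwa [sdiff_self_inter] at this

lemma BS.comp1 (b : BS Φ V B T1 T2) (c : CB Φ B) (h : SG Φ V) :
    IsCompOf (⋃₀ T1 \ ⋃ i, B i) ((⋃₀ T1 \ ⋃ i, B i) ∪ (⋃₀ T2 \ ⋃ i, B i)) := by
  obtain ⟨⟨⟨x, hx⟩, hc⟩, -⟩ := b.open1 c h
  refine ⟨x, Or.inl hx, subset_antisymm ?_ ?_⟩
  · exact hc.subset_connectedComponentIn hx subset_union_left
  · have hpre := isPreconnected_connectedComponentIn
      (F := (⋃₀ T1 \ ⋃ i, B i) ∪ (⋃₀ T2 \ ⋃ i, B i)) (x := x)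
    have hsub := connectedComponentIn_subset ((⋃₀ T1 \ ⋃ i, B i) ∪ (⋃₀ T2 \ ⋃ i, B i)) x
    have hxm := mem_connectedComponentIn
      (F := (⋃₀ T1 \ ⋃ i, B i) ∪ (⋃₀ T2 \ ⋃ i, B i)) (x := x) (Or.inl hx)
    have hdj := b.dj'
    rcases isPreconnected_iff_subset_of_disjoint_closed.1 hpre (⋃₀ T1) (⋃₀ T2)
      (h.isClosed_sUnion (b.sub1.trans sdiff_subset))
      (h.isClosed_sUnion (b.symm.sub1.trans sdiff_subset))
      (fun y hy => (hsub hy).imp (fun hh => hh.1) (fun hh => hh.1)) (by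
        rw [← disjoint_iff_inter_eq_empty, disjoint_left]
        exact fun y _ hy => hdj y hy.1 hy.2) with h1 | h1
    · intro y hy
      rcases hsub hy with h2 | h2
      · exact h2
      · exact ⟨h1 hy, h2.2⟩
    · exact (hdj x hx.1 (h1 hxm)).elim

lemma BS.ball1 (b : BS Φ V B T1 T2) (c : CB Φ B) (h : SG Φ V) :
    Nonempty (↥(⋃₀ T1) ≃ₜ ↥(Metric.closedBall (0 : EuclideanSpace ℝ (Fin 2)) 1)) := by
  obtain ⟨hA, -, f, hf, -⟩ := b.disc1 c h
  obtain ⟨e⟩ := hf.homeomorph hA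
  obtain ⟨e'⟩ := closedBall_homeo
  exact ⟨e.trans e'⟩

lemma IsBelt.cb {P : Set E3} (hB : IsBelt P B) : CB (facets P) B := by
  obtain ⟨hk, ⟨hk0, hf, he⟩, h3, h4⟩ := hB
  have he := he (by omega)
  have adj : ∀ p q, p ≠ q → (B p ∩ B q).Nonempty → q = nxt p ∨ p = nxt q := by
    intro p q hpq hne
    by_cases hk3 : k = 3
    · have hp := p.2
      have hq := q.2
      have hv : p.1 ≠ q.1 := fun e => hpq (Fin.ext e)
      rw [Fin.ext_iff, Fin.ext_iff, nxt_val, nxt_val]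
      split_ifs <;> omega
    · exact (h4 (by omega) p q hpq).1 hne
  have hdim : ∀ i, B i ≠ B (nxt i) := by
    intro i e
    have h1 := (he i).2
    rw [← e, inter_self, (hf i).2] at h1
    omega
  refine ⟨hk, hf, ?_, fun i => (he i).1.1, adj, ?_⟩
  · intro p q e
    by_contra hpq
    rcases adj p q hpq (by rw [← e, inter_self]; exact (hf p).1.1) with h1 | h1
    · exact hdim p (h1 ▸ e)
    · exact hdim q (h1 ▸ e.symm)
  · intro p q r hpq hpr hqr x xp xq xr
    have hp := p.2
    have hq := q.2
    have hr := r.2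
    have v1 : p.1 ≠ q.1 := fun e => hpq (Fin.ext e)
    have v2 : p.1 ≠ r.1 := fun e => hpr (Fin.ext e)
    have v3 : q.1 ≠ r.1 := fun e => hqr (Fin.ext e)
    have n1 := nxt_val p
    have n2 := nxt_val q
    have n3 := nxt_val r
    by_cases hk3 : k = 3
    · rcases adj p q hpq ⟨x, xp, xq⟩ with h1 | h1
      · have : r = nxt q := by
          rw [Fin.ext_iff] at h1 ⊢
          split_ifs at n1 n2 <;> omega
        have hh := h3 hk3 p
        rw [← h1, ← this] at hh
        exact hh.le ⟨⟨xp, xq⟩, xr⟩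
      · have : r = nxt p := by
          rw [Fin.ext_iff] at h1 ⊢
          split_ifs at n1 n2 <;> omega
        have hh := h3 hk3 q
        rw [← h1, ← this] at hh
        exact hh.le ⟨⟨xq, xp⟩, xr⟩
    · have a1 := adj p q hpq ⟨x, xp, xq⟩
      have a2 := adj p r hpr ⟨x, xp, xr⟩
      have a3 := adj q r hqr ⟨x, xq, xr⟩
      rw [Fin.ext_iff, Fin.ext_iff] at a1 a2 a3
      split_ifs at n1 n2 n3 <;> omega

lemma BS.cycle1 {P : Set E3} {s} (hR : HR P s) (hP : IsSimplePolytope3 P)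
    (b : BS (facets P) {v | IsVertexOf v P} B T1 T2) (c : CB (facets P) B) :
    IsSimpleEdgeCycle P (⋃₀ T1 ∩ ⋃ i, B i) := by
  have h := hR.sg hP
  obtain ⟨n, v, h1, h2, h3, h4, h5⟩ := h.edge_cycle (b.sub1.trans sdiff_subset) (b.nonempty1 c)
    (b.nonempty1c c) (b.conn1 c h) (b.conn1c c h)
  refine ⟨n, v, h1, h2, h3, fun i => ?_, by rw [← h5, b.bd1 c h]⟩
  obtain ⟨F, hF, G, hG, e⟩ := h4 i
  rw [← e]
  refine hR.isEdge hP (b.sub1 hF).1 hG.1 (fun e => hG.2 (e ▸ hF)) ?_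
  rw [e]
  exact ⟨_, left_mem_segment ℝ _ _⟩

lemma BS.W1 {P : Set E3} {s} (hR : HR P s) (b : BS (facets P) V B T1 T2) (c : CB (facets P) B) :
    {F | IsFacetOf F P ∧ intrinsicInterior ℝ F ⊆ ⋃₀ T1 \ ⋃ i, B i} = T1 := by
  ext F
  constructor
  · rintro ⟨hF, hsub⟩
    obtain ⟨x, hx⟩ := hF.1.exists_int
    obtain ⟨⟨G, hG, xG⟩, -⟩ := hsub hx
    by_contra hn
    exact hR.intrinsic_not_mem hF (b.sub1 hG).1 (fun e => hn (e ▸ hG)) hx xG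
  · intro hF
    have hF' := b.sub1 hF
    refine ⟨hF'.1, fun x hx => ⟨⟨F, hF, intrinsicInterior_subset hx⟩, ?_⟩⟩
    rw [mem_iUnion]
    rintro ⟨i, hi⟩
    exact hR.intrinsic_not_mem hF'.1 (c.mem i) (fun e => hF'.2 ⟨i, e.symm⟩) hx hi

end final
/-- Lemma on `k`-belts: the union `|B|` of a `k`-belt is a cylinder, its boundary
consists of two disjoint simple edge-cycles `γ₁, γ₂`, the complement `∂P ∖ |B|` has two
connected components `P₁, P₂`, the facets split as `W₁ ⊔ W₂ ⊔ B`, the closure of `P_α`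
is `|W_α|` and is a disk, and the boundary of `P_α` is `γ_α`. -/
theorem belt_lemma (P : Set E3) (hP : IsSimplePolytope3 P) {k : ℕ}
    (B : Fin k → Set E3) (hB : IsBelt P B) :
    Nonempty (↥(⋃ i, B i) ≃ₜ
      ↥(Set.Icc (0:ℝ) 1) × ↥(Metric.sphere (0 : EuclideanSpace ℝ (Fin 2)) 1)) ∧
    ∃ γ₁ γ₂ P₁ P₂ : Set E3,
      IsSimpleEdgeCycle P γ₁ ∧ IsSimpleEdgeCycle P γ₂ ∧ Disjoint γ₁ γ₂ ∧
      (⋃ i, B i) ∩ closure (frontier P \ ⋃ i, B i) = γ₁ ∪ γ₂ ∧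
      IsCompOf P₁ (frontier P \ ⋃ i, B i) ∧ IsCompOf P₂ (frontier P \ ⋃ i, B i) ∧
      P₁ ≠ P₂ ∧ P₁ ∪ P₂ = frontier P \ ⋃ i, B i ∧
      (let W₁ : Set (Set E3) := {F | IsFacetOf F P ∧ intrinsicInterior ℝ F ⊆ P₁}
       let W₂ : Set (Set E3) := {F | IsFacetOf F P ∧ intrinsicInterior ℝ F ⊆ P₂}
       W₁ ∩ W₂ = ∅ ∧ W₁ ∩ Set.range B = ∅ ∧ W₂ ∩ Set.range B = ∅ ∧
       W₁ ∪ W₂ ∪ Set.range B = facets P ∧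
       closure P₁ = ⋃₀ W₁ ∧ closure P₂ = ⋃₀ W₂ ∧
       Nonempty (↥(closure P₁) ≃ₜ ↥(Metric.closedBall (0 : EuclideanSpace ℝ (Fin 2)) 1)) ∧
       Nonempty (↥(closure P₂) ≃ₜ ↥(Metric.closedBall (0 : EuclideanSpace ℝ (Fin 2)) 1)) ∧
       closure P₁ \ P₁ = γ₁ ∧ closure P₂ \ P₂ = γ₂) := by
  obtain ⟨s, hR⟩ := exists_HR hP
  have h := hR.sg hP
  have c := hB.cb
  obtain ⟨T1, T2, b⟩ := c.split h
  have b' := b.symm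
  have o1 := b.open1 c h
  have o2 := b'.open1 c h
  have hfr : frontier P \ ⋃ i, B i = (⋃₀ T1 \ ⋃ i, B i) ∪ (⋃₀ T2 \ ⋃ i, B i) := by
    rw [hR.frontier_eq, ← union_sdiff_distrib, ← sUnion_union, b.un]
    ext x
    constructor
    · rintro ⟨⟨F, hF, xF⟩, hx⟩
      refine ⟨⟨F, ⟨hF, ?_⟩, xF⟩, hx⟩
      rintro ⟨i, rfl⟩
      exact hx (mem_iUnion.2 ⟨i, xF⟩)
    · rintro ⟨⟨F, hF, xF⟩, hx⟩
      exact ⟨⟨F, hF.1, xF⟩, hx⟩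
  refine ⟨b.cyl c h, ⋃₀ T1 ∩ ⋃ i, B i, ⋃₀ T2 ∩ ⋃ i, B i, ⋃₀ T1 \ ⋃ i, B i, ⋃₀ T2 \ ⋃ i, B i,
    b.cycle1 hR hP c, b'.cycle1 hR hP c, ?_, ?_, ?_, ?_, ?_, hfr.symm, ?_⟩
  · exact disjoint_left.2 fun x h1 h2 => b.dj' x h1.1 h2.1
  · rw [hfr, closure_union, o1.2, o2.2, inter_union_distrib_left, inter_comm, inter_comm (⋃ i, B i)]
  · rw [hfr]
    exact b.comp1 c h
  · rw [hfr, union_comm]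
    exact b'.comp1 c h
  · intro e
    obtain ⟨x, hx⟩ := o1.1.nonempty
    exact b.dj' x hx.1 (e ▸ hx : x ∈ ⋃₀ T2 \ ⋃ i, B i).1
  · intro W₁ W₂
    have w1 : W₁ = T1 := b.W1 hR c
    have w2 : W₂ = T2 := b'.W1 hR c
    clear_value W₁ W₂
    subst w1 w2
    rw [o1.2, o2.2]
    refine ⟨?_, ?_, ?_, ?_, rfl, rfl, b.ball1 c h, b'.ball1 c h, sdiff_sdiff_right_self _ _,
      sdiff_sdiff_right_self _ _⟩
    · rw [eq_empty_iff_forall_notMem]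
      rintro F ⟨h1, h2⟩
      obtain ⟨x, hx⟩ := (b.sub1 h1).1.1.1
      exact b.dj F h1 F h2 x hx hx
    · rw [eq_empty_iff_forall_notMem]
      rintro F ⟨h1, h2⟩
      exact (b.sub1 h1).2 h2
    · rw [eq_empty_iff_forall_notMem]
      rintro F ⟨h1, h2⟩
      exact (b'.sub1 h1).2 h2
    · rw [b.un]
      apply sdiff_union_of_subset
      rintro _ ⟨i, rfl⟩
      exact c.mem i
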